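/- Let β : B₄ → GL(3,R) be as below, let x₁ denote the element [yxy,x] of B₄ (and of G̃), and let Ñ be the normal closure in G̃ of the three elements x₁⁴, [x₁², yxy], and [yxy,x₁]·t·x₁⁻¹·t⁻¹. Then the kernel of β equals the preimage under ε̃ of Ñ; that is, for every b ∈ B₄, β(b) = 1 if and only if ε̃(b) ∈ Ñ. -/

import Mathlib

/-!
Common setup: the commutator convention `[a,b] = a⁻¹b⁻¹ab` of the paper, the sequence
`x₀ = x`, `x_{i+1} = [yxy, x_i]`, the Laurent polynomial ring `R = 𝔽₂[t,t⁻¹]`, and the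
images `X`, `Y` of `σ₁σ₂σ₃` and `σ₁σ₂σ₃σ₁` in `GL(3, R)` under the mod-2 reduced Burau
representation of the 4-strand braid group.
-/

open Matrix LaurentPolynomial

noncomputable section

set_option maxRecDepth 100000

/-- The paper's commutator convention: `[a,b] = a⁻¹b⁻¹ab`. -/
def br {G : Type*} [Group G] (a b : G) : G := a⁻¹ * b⁻¹ * a * b

/-- The recursively defined elements `x₀ = x`, `x_{i+1} = [yxy, x_i]`. -/
def xseq {G : Type*} [Group G] (x y : G) : ℕ → G
  | 0 => x
  | n + 1 => br (y * x * y) (xseq x y n)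

/-- `R = 𝔽₂[t,t⁻¹]`, the ring of Laurent polynomials over the field with two elements. -/
abbrev R2 : Type := LaurentPolynomial (ZMod 2)

instance : CharP R2 2 := charP_of_injective_algebraMap (algebraMap (ZMod 2) R2).injective 2

/-- The matrix `X = t·!![0,0,1; 1,0,1; 0,1,1]`. -/
def Xmat : Matrix (Fin 3) (Fin 3) R2 := (T 1 : R2) • !![0,0,1; 1,0,1; 0,1,1]

/-- The matrix `Y = t·!![0,0,1; t,1,1; 0,1,1]`. -/
def Ymat : Matrix (Fin 3) (Fin 3) R2 := (T 1 : R2) • !![0,0,1; T 1,1,1; 0,1,1]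

/-- An explicit inverse for `Xmat`. -/
def Xmatinv : Matrix (Fin 3) (Fin 3) R2 := (T (-1) : R2) • !![1,1,0; 1,0,1; 1,0,0]

/-- An explicit inverse for `Ymat`. -/
def Ymatinv : Matrix (Fin 3) (Fin 3) R2 := (T (-2) : R2) • !![0,1,1; T 1,0,T 1; T 1,0,0]

lemma Xmat_mul_Xmatinv : Xmat * Xmatinv = 1 := by
  rw [Xmat, Xmatinv, Matrix.smul_mul, Matrix.mul_smul, smul_smul, ← T_add]
  simp only [Matrix.mul_fin_three, mul_zero, zero_mul, mul_one, one_mul, add_zero, zero_add,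
    ← T_add, CharTwo.add_self_eq_zero]
  rw [Matrix.one_fin_three]
  simp only [Matrix.smul_of, Matrix.smul_cons, smul_eq_mul, Matrix.smul_empty, ← T_add,
    mul_zero, mul_one]
  norm_num [T_zero]

lemma Xmatinv_mul_Xmat : Xmatinv * Xmat = 1 := by
  rw [Xmat, Xmatinv, Matrix.smul_mul, Matrix.mul_smul, smul_smul, ← T_add]
  simp only [Matrix.mul_fin_three, mul_zero, zero_mul, mul_one, one_mul, add_zero, zero_add,
    ← T_add, CharTwo.add_self_eq_zero]
  rw [Matrix.one_fin_three]
  simp only [Matrix.smul_of, Matrix.smul_cons, smul_eq_mul, Matrix.smul_empty, ← T_add,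
    mul_zero, mul_one]
  norm_num [T_zero]

lemma Ymat_mul_Ymatinv : Ymat * Ymatinv = 1 := by
  rw [Ymat, Ymatinv, Matrix.smul_mul, Matrix.mul_smul, smul_smul, ← T_add]
  simp only [Matrix.mul_fin_three, mul_zero, zero_mul, mul_one, one_mul, add_zero, zero_add,
    ← T_add, CharTwo.add_self_eq_zero]
  rw [Matrix.one_fin_three]
  simp only [Matrix.smul_of, Matrix.smul_cons, smul_eq_mul, Matrix.smul_empty, ← T_add,
    mul_zero, mul_one]
  norm_num [T_zero]

lemma Ymatinv_mul_Ymat : Ymatinv * Ymat = 1 := by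
  rw [Ymat, Ymatinv, Matrix.mul_smul, Matrix.smul_mul, smul_smul, ← T_add]
  simp only [Matrix.mul_fin_three, mul_zero, zero_mul, mul_one, one_mul, add_zero, zero_add,
    ← T_add, CharTwo.add_self_eq_zero]
  rw [Matrix.one_fin_three]
  simp only [Matrix.smul_of, Matrix.smul_cons, smul_eq_mul, Matrix.smul_empty, ← T_add,
    mul_zero, mul_one]
  norm_num [T_zero]

/-- `X ∈ GL(3, 𝔽₂[t,t⁻¹])`, the mod-2 reduced Burau image of `σ₁σ₂σ₃`. -/
def X : GL (Fin 3) R2 := ⟨Xmat, Xmatinv, Xmat_mul_Xmatinv, Xmatinv_mul_Xmat⟩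

/-- `Y ∈ GL(3, 𝔽₂[t,t⁻¹])`, the mod-2 reduced Burau image of `σ₁σ₂σ₃σ₁`. -/
def Y : GL (Fin 3) R2 := ⟨Ymat, Ymatinv, Ymat_mul_Ymatinv, Ymatinv_mul_Ymat⟩

/-- Relators of `B₄ = ⟨x, y | x⁴ = y³, [x², yxy] = 1⟩`. -/
def b4Rels : Set (FreeGroup (Fin 2)) :=
  {(FreeGroup.of 0) ^ 4 * ((FreeGroup.of 1) ^ 3)⁻¹,
    br ((FreeGroup.of 0) ^ 2) (FreeGroup.of 1 * FreeGroup.of 0 * FreeGroup.of 1)}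

/-- The 4-strand braid group `B₄`, presented as `⟨x, y | x⁴ = y³, [x², yxy] = 1⟩`. -/
abbrev B4 : Type := PresentedGroup b4Rels

/-- The generator `x = σ₁σ₂σ₃` of `B₄`. -/
def bx : B4 := PresentedGroup.of 0

/-- The generator `y = σ₁σ₂σ₃σ₁` of `B₄`. -/
def by' : B4 := PresentedGroup.of 1

/-- `G̃`, the HNN extension of `B₄` along the identity isomorphism of the subgroup
`⟨yxy, x⁴⟩`. -/
abbrev GrpGt : Type :=
  HNNExtension B4 (Subgroup.closure {by' * bx * by', bx ^ 4})
    (Subgroup.closure {by' * bx * by', bx ^ 4}) (MulEquiv.refl _)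

/-- The canonical injection `ε̃ : B₄ ↪ G̃`. -/
def εB : B4 →* GrpGt := HNNExtension.of

/-- The stable letter `t` of the HNN extension `G̃`. -/
def tGt : GrpGt := HNNExtension.t

/-- The element `x₁ = [yxy, x]` of `B₄`. -/
def x1 : B4 := br (by' * bx * by') bx

set_option linter.all false

/-! Part 1 -/

noncomputable section

def tt : R2 := T 1
def ti : R2 := T (-1)
lemma tt_ti : tt * ti = 1 := by rw [tt, ti, ← T_add]; simp
lemma T1_eq : (T 1 : R2) = tt := rfl
lemma Tm1_eq : (T (-1) : R2) = ti := rfl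
lemma Tm2_eq : (T (-2) : R2) = ti * ti := by rw [ti, ← T_add]; norm_num

def mX : Matrix (Fin 3) (Fin 3) R2 := !![tt,tt,0;0,tt,tt;0,0,tt]
def mXi : Matrix (Fin 3) (Fin 3) R2 := !![ti,ti,ti;0,ti,ti;0,0,ti]
def mY : Matrix (Fin 3) (Fin 3) R2 := !![tt,tt,0;tt+tt^2,tt+tt^2,tt^2;tt+tt^2,tt^2,tt^2]
def mYi : Matrix (Fin 3) (Fin 3) R2 := !![ti,ti,ti;0,ti,ti;ti^2+ti,ti^2,0]
def mB : Matrix (Fin 3) (Fin 3) R2 := !![1,1,1;0,1,0;1,0,0]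
def mBi : Matrix (Fin 3) (Fin 3) R2 := !![0,0,1;0,1,0;1,1,1]
def mZ : Matrix (Fin 3) (Fin 3) R2 := !![tt^4,tt^3+tt^4,tt^4;0,tt^3,tt^4;0,0,tt^4]
def mZi : Matrix (Fin 3) (Fin 3) R2 := !![ti^4,ti^4+ti^3,ti^3;0,ti^3,ti^3;0,0,ti^4]

lemma mX_mXi : mX * mXi = 1 := by
  have := tt_ti; refine Matrix.ext fun i j => ?_; fin_cases i <;> fin_cases j <;>
  simp [mX, mXi, mY, mYi, mB, mBi, mZ, mZi, Matrix.mul_apply, Fin.sum_univ_three] <;> grind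
lemma mXi_mX : mXi * mX = 1 := by
  have := tt_ti; refine Matrix.ext fun i j => ?_; fin_cases i <;> fin_cases j <;>
  simp [mX, mXi, mY, mYi, mB, mBi, mZ, mZi, Matrix.mul_apply, Fin.sum_univ_three] <;> grind
lemma mY_mYi : mY * mYi = 1 := by
  have := tt_ti; refine Matrix.ext fun i j => ?_; fin_cases i <;> fin_cases j <;>
  simp [mX, mXi, mY, mYi, mB, mBi, mZ, mZi, Matrix.mul_apply, Fin.sum_univ_three] <;> grind
lemma mYi_mY : mYi * mY = 1 := by
  have := tt_ti; refine Matrix.ext fun i j => ?_; fin_cases i <;> fin_cases j <;>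
  simp [mX, mXi, mY, mYi, mB, mBi, mZ, mZi, Matrix.mul_apply, Fin.sum_univ_three] <;> grind
lemma mB_mBi : mB * mBi = 1 := by
  have := tt_ti; refine Matrix.ext fun i j => ?_; fin_cases i <;> fin_cases j <;>
  simp [mX, mXi, mY, mYi, mB, mBi, mZ, mZi, Matrix.mul_apply, Fin.sum_univ_three] <;> grind
lemma mBi_mB : mBi * mB = 1 := by
  have := tt_ti; refine Matrix.ext fun i j => ?_; fin_cases i <;> fin_cases j <;>
  simp [mX, mXi, mY, mYi, mB, mBi, mZ, mZi, Matrix.mul_apply, Fin.sum_univ_three] <;> grind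
lemma mZ_eq : mY * mX * mY = mZ := by
  have := tt_ti; refine Matrix.ext fun i j => ?_; fin_cases i <;> fin_cases j <;>
  simp [mX, mXi, mY, mYi, mB, mBi, mZ, mZi, Matrix.mul_apply, Fin.sum_univ_three] <;> grind
lemma mZi_eq : mYi * mXi * mYi = mZi := by
  have := tt_ti; refine Matrix.ext fun i j => ?_; fin_cases i <;> fin_cases j <;>
  simp [mX, mXi, mY, mYi, mB, mBi, mZ, mZi, Matrix.mul_apply, Fin.sum_univ_three] <;> grind

lemma conjX : Xmat * mB = mB * mX := by
  have := tt_ti; refine Matrix.ext fun i j => ?_; fin_cases i <;> fin_cases j <;>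
  simp [Xmat, T1_eq, mX, mB, Matrix.mul_apply, Fin.sum_univ_three] <;> grind
lemma conjY : Ymat * mB = mB * mY := by
  have := tt_ti; refine Matrix.ext fun i j => ?_; fin_cases i <;> fin_cases j <;>
  simp [Ymat, T1_eq, mY, mB, Matrix.mul_apply, Fin.sum_univ_three] <;> grind

def gX : GL (Fin 3) R2 := ⟨mX, mXi, mX_mXi, mXi_mX⟩
def gY : GL (Fin 3) R2 := ⟨mY, mYi, mY_mYi, mYi_mY⟩
def gB : GL (Fin 3) R2 := ⟨mB, mBi, mB_mBi, mBi_mB⟩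

lemma gB_X : gB⁻¹ * X * gB = gX := by
  rw [mul_assoc, inv_mul_eq_iff_eq_mul]; exact Units.ext conjX
lemma gB_Y : gB⁻¹ * Y * gB = gY := by
  rw [mul_assoc, inv_mul_eq_iff_eq_mul]; exact Units.ext conjY
end

/-! Part 2 -/

noncomputable section

def mX1 : Matrix (Fin 3) (Fin 3) R2 := !![1,ti+1,ti+1+tt;0,1,1+tt;0,0,1]
def mX2 : Matrix (Fin 3) (Fin 3) R2 := !![1,ti^2+1,ti^2+1+tt+tt^2;0,1,1+tt^2;0,0,1]
def mD : Matrix (Fin 3) (Fin 3) R2 :=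
  !![(tt+ti)*(1+tt),(1+ti)*(1+tt),0;0,(1+tt)^2,tt^2;0,0,1+tt]

lemma mX1_eq : mZ * mX = mX * mZ * mX1 := by
  have := tt_ti; refine Matrix.ext fun i j => ?_; fin_cases i <;> fin_cases j <;>
  simp [mX, mX1, mZ, Matrix.mul_apply, Fin.sum_univ_three] <;> grind
lemma mX2_eq : mZ * mX1 = mX1 * mZ * mX2 := by
  have := tt_ti; refine Matrix.ext fun i j => ?_; fin_cases i <;> fin_cases j <;>
  simp [mX2, mX1, mZ, Matrix.mul_apply, Fin.sum_univ_three] <;> grind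
lemma mD_X1 : mD * mX1 = mX2 * mD := by
  have := tt_ti; refine Matrix.ext fun i j => ?_; fin_cases i <;> fin_cases j <;>
  simp [mX2, mX1, mD, Matrix.mul_apply, Fin.sum_univ_three] <;> grind
lemma mD_Z : mD * mZ = mZ * mD := by
  have := tt_ti; refine Matrix.ext fun i j => ?_; fin_cases i <;> fin_cases j <;>
  simp [mZ, mD, Matrix.mul_apply, Fin.sum_univ_three] <;> grind
lemma mX1_sq : mX1 * mX1 = !![1,0,tt+ti;0,1,0;0,0,1] := by
  have := tt_ti; refine Matrix.ext fun i j => ?_; fin_cases i <;> fin_cases j <;>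
  simp [mX1, Matrix.mul_apply, Fin.sum_univ_three] <;> grind
lemma mX1_4 : (mX1 * mX1) * (mX1 * mX1) = 1 := by
  rw [mX1_sq]
  refine Matrix.ext fun i j => ?_; fin_cases i <;> fin_cases j <;>
  simp [Matrix.mul_apply, Fin.sum_univ_three] <;> grind
lemma mX1_sq_Z : (mX1 * mX1) * mZ = mZ * (mX1 * mX1) := by
  rw [mX1_sq]
  refine Matrix.ext fun i j => ?_; fin_cases i <;> fin_cases j <;>
  simp [mZ, Matrix.mul_apply, Fin.sum_univ_three] <;> grind
lemma mX_4 : (mX * mX) * (mX * mX) = tt^4 • (1 : Matrix (Fin 3) (Fin 3) R2) := by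
  refine Matrix.ext fun i j => ?_; fin_cases i <;> fin_cases j <;>
  simp [mX, Matrix.mul_apply, Fin.sum_univ_three] <;> grind

lemma tt_coeff (n : ℤ) : (tt : R2).coeff n = if n = 1 then 1 else 0 := by
  rw [tt, T_apply]; simp [eq_comm]

lemma one_add_tt_ne : (1 + tt : R2) ≠ 0 := by
  intro h
  have h2 : (1 + tt : R2).coeff 1 = 0 := by rw [h]; rfl
  have h3 : (1 + tt : R2) = T 0 + T 1 := by rw [T_zero]; rfl
  rw [h3] at h2
  simp [T_apply, -T_zero] at h2
lemma tt_add_ti_ne : (tt + ti : R2) ≠ 0 := by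
  intro h
  have h2 : (tt + ti : R2).coeff 1 = 0 := by rw [h]; rfl
  rw [tt, ti] at h2
  simp [T_apply] at h2

lemma mD_det : mD.det ≠ 0 := by
  rw [Matrix.det_fin_three]
  simp [mD, one_add_tt_ne, tt_add_ti_ne]

abbrev KK := FractionRing R2
def toK : GL (Fin 3) R2 →* GL (Fin 3) KK := Matrix.GeneralLinearGroup.map (algebraMap R2 KK)
lemma toK_inj : Function.Injective toK := by
  intro a b h
  apply Units.ext
  have h2 : (toK a).val = (toK b).val := by rw [h]
  refine Matrix.ext fun i j => ?_
  have := congrFun (congrFun h2 i) j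
  exact IsFractionRing.injective R2 KK this
def gD : GL (Fin 3) KK := Matrix.GeneralLinearGroup.mkOfDetNeZero
  ((algebraMap R2 KK).mapMatrix mD) (by
    rw [← RingHom.map_det]
    exact fun h => mD_det ((map_eq_zero_iff _ (IsFractionRing.injective R2 KK)).1 h))

lemma gD_comm {a b : GL (Fin 3) R2} (h : mD * a.val = b.val * mD) :
    gD * toK a = toK b * gD := by
  apply Units.ext
  show (algebraMap R2 KK).mapMatrix mD * (algebraMap R2 KK).mapMatrix a.val =
    (algebraMap R2 KK).mapMatrix b.val * (algebraMap R2 KK).mapMatrix mD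
  rw [← map_mul, ← map_mul, h]

lemma br_eq_iff {G : Type*} [Group G] {a b c : G} : br a b = c ↔ a * b = b * a * c := by
  unfold br
  constructor
  · rintro rfl; group
  · intro h; rw [mul_assoc, h]; group

lemma br_eq_one_iff {G : Type*} [Group G] {a b : G} : br a b = 1 ↔ a * b = b * a := by
  rw [br_eq_iff, mul_one]
lemma map_br {G H : Type*} [Group G] [Group H] (f : G →* H) (a b : G) :
   f (br a b) = br (f a) (f b) := by simp [br]

def gZ : GL (Fin 3) R2 := gY * gX * gY
lemma gZ_val : (gZ : Matrix (Fin 3) (Fin 3) R2) = mZ := mZ_eq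
lemma gX_val : (gX : Matrix (Fin 3) (Fin 3) R2) = mX := rfl
lemma brX1_val : ((br gZ gX : GL (Fin 3) R2) : Matrix (Fin 3) (Fin 3) R2) = mX1 := by
  have h : gZ * gX = gX * gZ * br gZ gX := br_eq_iff.1 rfl
  have h2 := congrArg (Units.val) h
  simp only [Units.val_mul, gZ_val] at h2
  rw [show (gX : Matrix (Fin 3) (Fin 3) R2) = mX from rfl, mX1_eq] at h2
  have := (gX * gZ).isUnit.mul_left_injective
  have h3 : ((gX * gZ : GL (Fin 3) R2) : Matrix _ _ R2) = mX * mZ := by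
    rw [Units.val_mul, gZ_val]; rfl
  rw [← h3] at h2
  exact ((gX * gZ).isUnit.mul_left_cancel h2).symm
lemma brX2_val : ((br gZ (br gZ gX) : GL (Fin 3) R2) : Matrix (Fin 3) (Fin 3) R2) = mX2 := by
  set g1 := br gZ gX with hg1
  have h : gZ * g1 = g1 * gZ * br gZ g1 := br_eq_iff.1 rfl
  have h2 := congrArg (Units.val) h
  simp only [Units.val_mul, gZ_val] at h2
  have h0 : (g1 : Matrix (Fin 3) (Fin 3) R2) = mX1 := brX1_val
  rw [h0, mX2_eq] at h2
  have h3 : ((g1 * gZ : GL (Fin 3) R2) : Matrix _ _ R2) = mX1 * mZ := by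
    rw [Units.val_mul, gZ_val, h0]
  rw [← h3] at h2
  exact ((g1 * gZ).isUnit.mul_left_cancel h2).symm

def bz : B4 := by' * bx * by'

lemma easyDir (π : B4 →* GL (Fin 3) R2) (hx : π bx = gX) (hy : π by' = gY) (b : B4)
   (hb : εB b ∈ Subgroup.normalClosure
        {εB x1 ^ 4, br (εB x1 ^ 2) (εB (by' * bx * by')),
          br (εB (by' * bx * by')) (εB x1) * tGt * (εB x1)⁻¹ * tGt⁻¹}) : π b = 1 := by
  have hz : π (by' * bx * by') = gZ := by rw [map_mul, map_mul, hx, hy]; rfl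
  have h1 : π x1 = br gZ gX := by rw [x1, map_br, hz, hx]
  have hcomm : ∀ a : (Subgroup.closure {by' * bx * by', bx ^ 4} : Subgroup B4),
      gD * (toK.comp π) a = (toK.comp π) ((MulEquiv.refl _ : _ ≃* _) a : _) * gD := by
    rintro ⟨a, ha⟩
    show gD * toK (π a) = toK (π a) * gD
    induction ha using Subgroup.closure_induction with
    | mem a ha =>
      apply gD_comm
      rcases ha with rfl | rfl
      · rw [hz, gZ_val, mD_Z]
      · rw [map_pow, hx]
        have : ((gX ^ 4 : GL (Fin 3) R2) : Matrix _ _ R2) = (mX * mX) * (mX * mX) := by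
          rw [show gX ^ 4 = (gX * gX) * (gX * gX) by
          simp only [pow_succ, pow_zero, one_mul, mul_assoc]]; rfl
        rw [this, mX_4]; simp
    | one => simp
    | mul a b _ _ ha hb => rw [map_mul, map_mul, ← mul_assoc, ha, mul_assoc, hb, mul_assoc]
    | inv a _ ha => 
      have : Commute gD (toK (π a)) := ha
      rw [map_inv, map_inv]; exact this.inv_right
  let F : GrpGt →* GL (Fin 3) KK := HNNExtension.lift (toK.comp π) gD hcomm
  have hFε : ∀ a, F (εB a) = toK (π a) := fun a => HNNExtension.lift_of _ _ _ _
  have hFt : F tGt = gD := HNNExtension.lift_t _ _ _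
  have hle : Subgroup.normalClosure {εB x1 ^ 4, br (εB x1 ^ 2) (εB (by' * bx * by')),
          br (εB (by' * bx * by')) (εB x1) * tGt * (εB x1)⁻¹ * tGt⁻¹} ≤ F.ker := by
    apply Subgroup.normalClosure_le_normal
    rintro w (rfl | rfl | rfl)
    · show F _ = 1
      rw [map_pow, hFε, ← map_pow, h1]
      have : (br gZ gX) ^ 4 = 1 := by
        rw [show (br gZ gX) ^ 4 = (br gZ gX * br gZ gX) * (br gZ gX * br gZ gX) by
          simp only [pow_succ, pow_zero, one_mul, mul_assoc]]
        apply Units.ext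
        simp only [Units.val_mul, brX1_val]; exact mX1_4
      rw [this, map_one]
    · show F _ = 1
      rw [map_br, map_pow, hFε, hFε, ← map_pow, ← map_br, h1, hz]
      have : br ((br gZ gX) ^ 2) gZ = 1 := by
        rw [br_eq_one_iff, pow_two]
        apply Units.ext
        simp only [Units.val_mul, brX1_val, gZ_val]; exact mX1_sq_Z
      rw [this, map_one]
    · show F _ = 1
      rw [map_mul, map_mul, map_mul, map_inv, map_inv, map_br, hFε, hFε, hFt, hz, h1, ← map_br]
      have : gD * toK (br gZ gX) = toK (br gZ (br gZ gX)) * gD := by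
        apply gD_comm; rw [brX1_val, brX2_val, mD_X1]
      show toK (br gZ (br gZ gX)) * _ * _ * _ = 1
      rw [← this]; group
  have := hle hb
  have h2 : F (εB b) = 1 := this
  rw [hFε] at h2
  exact toK_inj (by rw [h2, map_one])
lemma gZ_def : gZ = gY * gX * gY := rfl
lemma gY_val : gY.val = mY := rfl
lemma gXinv_val : gX⁻¹.val = mXi := rfl
lemma gYinv_val : gY⁻¹.val = mYi := rfl
attribute [irreducible] gZ
end

/-! Part 3 -/

noncomputable section

section abstr
variable {G : Type*} [Group G] {A : Type*} [CommRing A] [IsDomain A]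

def Gnd (a : ℕ → G) (Z : Subgroup G) (n d : ℕ) : Subgroup G :=
  Subgroup.closure ({g | ∃ k, n ≤ k ∧ k < n + d ∧ g = a k} ∪ Z)

lemma Gnd_mono (a : ℕ → G) (Z : Subgroup G) {n d n' d' : ℕ} (h : n' ≤ n) (h2 : n + d ≤ n' + d') :
    Gnd a Z n d ≤ Gnd a Z n' d' := by
  apply Subgroup.closure_mono
  apply Set.union_subset_union_left
  rintro g ⟨k, hk, hk2, rfl⟩
  exact ⟨k, by omega, by omega, rfl⟩

lemma Gnd_a (a : ℕ → G) (Z : Subgroup G) {n d k : ℕ} (h : n ≤ k) (h2 : k < n + d) :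
    a k ∈ Gnd a Z n d := Subgroup.subset_closure (Or.inl ⟨k, h, h2, rfl⟩)
lemma Gnd_Z (a : ℕ → G) (Z : Subgroup G) {n d : ℕ} {g : G} (h : g ∈ Z) :
    g ∈ Gnd a Z n d := Subgroup.subset_closure (Or.inr h)

lemma Gnd_split (a : ℕ → G) (Z : Subgroup G)
    (hsq : ∀ k, a k * a k ∈ Z) (hcent : ∀ ζ ∈ Z, ∀ k, ζ * a k = a k * ζ)
    (hcomm : ∀ i j, ∃ ζ ∈ Z, a i * a j = ζ * (a j * a i)) (n d : ℕ) (u : G)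
    (hu : u ∈ Gnd a Z n (d+1)) :
    u ∈ Gnd a Z (n+1) d ∨ ∃ v ∈ Gnd a Z (n+1) d, u = a n * v := by
  have hconj : ∀ v ∈ Gnd a Z (n+1) d, a n * v * (a n)⁻¹ ∈ Gnd a Z (n+1) d := by
    intro v hv
    induction hv using Subgroup.closure_induction with
    | mem v hv =>
      rcases hv with ⟨k, hk, hk2, rfl⟩ | hv
      · obtain ⟨ζ, hζ, h⟩ := hcomm n k
        rw [h]
        have : ζ * (a k * a n) * (a n)⁻¹ = ζ * a k := by group
        rw [this]
        exact mul_mem (Gnd_Z a Z hζ) (Gnd_a a Z hk hk2)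
      · rw [← hcent v hv]
        simpa using Gnd_Z a Z hv
    | one => simp
    | mul v w _ _ h1 h2 => 
      have : a n * (v * w) * (a n)⁻¹ = (a n * v * (a n)⁻¹) * (a n * w * (a n)⁻¹) := by group
      rw [this]; exact mul_mem h1 h2
    | inv v _ h => 
      have : a n * v⁻¹ * (a n)⁻¹ = (a n * v * (a n)⁻¹)⁻¹ := by group
      rw [this]; exact inv_mem h
  have hconj2 : ∀ v ∈ Gnd a Z (n+1) d, (a n)⁻¹ * v * a n ∈ Gnd a Z (n+1) d := by
    intro v hv
    have h1 := hconj v hv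
    have : (a n)⁻¹ * v * a n = (a n * a n)⁻¹ * (a n * v * (a n)⁻¹) * (a n * a n) := by group
    rw [this]
    exact mul_mem (mul_mem (inv_mem (Gnd_Z a Z (hsq n))) h1) (Gnd_Z a Z (hsq n))
  have hs : a n * a n ∈ Gnd a Z (n+1) d := Gnd_Z a Z (hsq n)
  induction hu using Subgroup.closure_induction with
  | mem u hu =>
    rcases hu with ⟨k, hk, hk2, rfl⟩ | hu
    · rcases Nat.eq_or_lt_of_le hk with rfl | hk
      · right; exact ⟨1, one_mem _, by simp⟩
      · left; exact Gnd_a a Z hk (by omega)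
    · left; exact Gnd_Z a Z hu
  | one => left; exact one_mem _
  | mul u w _ _ h1 h2 =>
    rcases h1 with h1 | ⟨v, hv, rfl⟩
    · rcases h2 with h2 | ⟨w, hw, rfl⟩
      · left; exact mul_mem h1 h2
      · right
        exact ⟨_, mul_mem (hconj2 u h1) hw, by group⟩
    · rcases h2 with h2 | ⟨w, hw, rfl⟩
      · right; exact ⟨_, mul_mem hv h2, by group⟩
      · left
        have : a n * v * (a n * w) = (a n * a n) * ((a n)⁻¹ * v * a n) * w := by group
        rw [this]
        exact mul_mem (mul_mem hs (hconj2 v hv)) hw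
  | inv u _ h =>
    rcases h with h | ⟨v, hv, rfl⟩
    · left; exact inv_mem h
    · right
      refine ⟨((a n)⁻¹ * v⁻¹ * a n) * (a n * a n)⁻¹, mul_mem (hconj2 _ (inv_mem hv)) (inv_mem hs), ?_⟩
      group

lemma abstract_ker (a : ℕ → G) (Z Γ : Subgroup G) (φ : G → A) (q : A) (hq0 : q ≠ 0) (hq : ¬ IsUnit q)
    (hφ : ∀ u ∈ Γ, ∀ v ∈ Γ, φ (u * v) = φ u + φ v)
    (haΓ : ∀ k, a k ∈ Γ) (hZΓ : Z ≤ Γ) (hφa : ∀ k, φ (a k) = q ^ k) (hφZ : ∀ ζ ∈ Z, φ ζ = 0)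
    (hsq : ∀ k, a k * a k ∈ Z) (hcent : ∀ ζ ∈ Z, ∀ k, ζ * a k = a k * ζ)
    (hcomm : ∀ i j, ∃ ζ ∈ Z, a i * a j = ζ * (a j * a i)) (u : G)
    (hu : u ∈ Subgroup.closure (Set.range a ∪ Z)) (h0 : φ u = 0) : u ∈ Z := by
  have h1 : φ 1 = 0 := hφZ 1 (one_mem _)
  have hinv : ∀ u ∈ Γ, φ u⁻¹ = - φ u := by
    intro u hu
    have := hφ u hu _ (inv_mem hu)
    rw [mul_inv_cancel, h1] at this
    linear_combination -this
  have hdiv : ∀ n d, ∀ u ∈ Gnd a Z n d, u ∈ Γ ∧ q ^ n ∣ φ u := by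
    intro n d u hu
    induction hu using Subgroup.closure_induction with
    | mem u hu =>
      rcases hu with ⟨k, hk, hk2, rfl⟩ | hu
      · exact ⟨haΓ k, by rw [hφa]; exact pow_dvd_pow _ hk⟩
      · exact ⟨hZΓ hu, by rw [hφZ u hu]; exact dvd_zero _⟩
    | one => exact ⟨one_mem _, by rw [h1]; exact dvd_zero _⟩
    | mul u v _ _ h h' => exact ⟨mul_mem h.1 h'.1, by rw [hφ u h.1 v h'.1]; exact dvd_add h.2 h'.2⟩
    | inv u _ h => exact ⟨inv_mem h.1, by rw [hinv u h.1]; exact (dvd_neg).2 h.2⟩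
  have key : ∀ d n, ∀ u ∈ Gnd a Z n d, φ u = 0 → u ∈ Z := by
    intro d
    induction d with
    | zero =>
      intro n u hu _
      have : Gnd a Z n 0 = Z := by
        unfold Gnd
        rw [show ({g | ∃ k, n ≤ k ∧ k < n + 0 ∧ g = a k} : Set G) = ∅ by
          ext g; simp; intro k h1 h2; omega]
        simp
      rwa [this] at hu
    | succ d ih =>
      intro n u hu h0
      rcases Gnd_split a Z hsq hcent hcomm n d u hu with h | ⟨v, hv, rfl⟩
      · exact ih _ _ h h0
      · exfalso
        obtain ⟨hvΓ, c, hc⟩ := hdiv _ _ v hv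
        rw [hφ _ (haΓ n) _ hvΓ, hφa, hc] at h0
        have : q ^ n * (1 + q * c) = 0 := by linear_combination h0
        rcases mul_eq_zero.1 this with h | h
        · exact pow_ne_zero n hq0 h
        · exact hq (IsUnit.of_mul_eq_one (-c) (by linear_combination -h))
  have hh : ∀ w, (∃ N, w ∈ Gnd a Z 0 N) → ∃ N, ∀ M, N ≤ M → w ∈ Gnd a Z 0 M := by
    rintro w ⟨N, hN⟩
    exact ⟨N, fun M hM => Gnd_mono a Z le_rfl (by omega) hN⟩
  obtain ⟨N, hN⟩ : ∃ N, u ∈ Gnd a Z 0 N := by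
    clear h0
    induction hu using Subgroup.closure_induction with
    | mem u hu =>
      rcases hu with ⟨k, rfl⟩ | hu
      · exact ⟨k+1, Gnd_a a Z (by omega) (by omega)⟩
      · exact ⟨0, Gnd_Z a Z hu⟩
    | one => exact ⟨0, one_mem _⟩
    | mul u v _ _ h h' =>
      obtain ⟨N, hN⟩ := hh _ h
      obtain ⟨M, hM⟩ := hh _ h'
      exact ⟨max N M, mul_mem (hN _ (le_max_left _ _)) (hM _ (le_max_right _ _))⟩
    | inv u _ h => obtain ⟨N, hN⟩ := h; exact ⟨N, inv_mem hN⟩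
  exact key _ _ _ hN h0
end abstr
end

/-! Part 4 -/

noncomputable section

section stepA
variable {G : Type*} [Group G]

/-- the hypotheses -/
structure Hyp (x y : G) : Prop where
  gen : Subgroup.closure {x, y} = ⊤
  x4 : x ^ 4 = y ^ 3
  e4 : ∀ n, 1 ≤ n → xseq x y n ^ 4 = 1
  ez : ∀ n, Commute (xseq x y n ^ 2) (y * x * y)

lemma Hyp.central {x y : G} (h : Hyp x y) (g : G) : x ^ 4 * g = g * x ^ 4 := by
  have hg : g ∈ Subgroup.closure {x, y} := by rw [h.gen]; trivial
  have : Commute (x ^ 4) g := by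
    induction hg using Subgroup.closure_induction with
    | mem g hg =>
      rcases hg with rfl | rfl
      · exact (Commute.refl _).pow_left 4
      · rw [h.x4]; exact (Commute.refl _).pow_left 3
    | one => exact Commute.one_right _
    | mul a b _ _ ha hb => exact ha.mul_right hb
    | inv a _ ha => exact ha.inv_right
  exact this

def PP (x y : G) : Subgroup G := Subgroup.closure {x, y * x * y}
lemma x_mem_PP (x y : G) : x ∈ PP x y := Subgroup.subset_closure (by simp)
lemma z_mem_PP (x y : G) : y * x * y ∈ PP x y := Subgroup.subset_closure (by simp)
lemma e_mem_PP (x y : G) (n : ℕ) : xseq x y n ∈ PP x y := by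
  induction n with
  | zero => exact x_mem_PP x y
  | succ n ih => 
    exact mul_mem (mul_mem (mul_mem (inv_mem (z_mem_PP x y)) (inv_mem ih)) (z_mem_PP x y)) ih

lemma PP_comm {x y : G} {κ : G} (h1 : κ * x = x * κ) (h2 : κ * (y * x * y) = (y * x * y) * κ) :
    ∀ p ∈ PP x y, κ * p = p * κ := by
  intro p hp
  have : Commute κ p := by
    induction hp using Subgroup.closure_induction with
    | mem g hg =>
      rcases hg with rfl | rfl
      · exact h1
      · exact h2
    | one => exact Commute.one_right _
    | mul a b _ _ ha hb => exact ha.mul_right hb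
    | inv a _ ha => exact ha.inv_right
  exact this

def Zp (x y : G) : Subgroup G := Subgroup.closure {g | ∃ k, 1 ≤ k ∧ g = xseq x y k * xseq x y k}
lemma Zp_le_PP (x y : G) : Zp x y ≤ PP x y := by
  apply (Subgroup.closure_le _).2
  rintro g ⟨k, _, rfl⟩
  exact mul_mem (e_mem_PP x y k) (e_mem_PP x y k)

def CC (x y : G) : Subgroup G where
  carrier := {κ | κ ∈ Zp x y ∧ (∀ p ∈ PP x y, κ * p = p * κ) ∧ κ * κ = 1}
  mul_mem' := by
    rintro a b ⟨h1, h2, h3⟩ ⟨h1', h2', h3'⟩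
    refine ⟨mul_mem h1 h1', fun p hp => ?_, ?_⟩
    · rw [mul_assoc, h2' p hp, ← mul_assoc, h2 p hp, mul_assoc]
    · have := h2 b (Zp_le_PP _ _ h1')
      calc a * b * (a * b) = a * (b * a) * b := by group
        _ = a * (a * b) * b := by rw [this]
        _ = (a * a) * (b * b) := by group
        _ = 1 := by rw [h3, h3', mul_one]
  one_mem' := ⟨one_mem _, by simp, by simp⟩
  inv_mem' := by
    rintro a ⟨h1, h2, h3⟩
    have : a⁻¹ = a := inv_eq_of_mul_eq_one_left h3
    rw [this]; exact ⟨h1, h2, h3⟩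

lemma e_conj (x y : G) (n : ℕ) : (y*x*y)⁻¹ * xseq x y n * (y * x * y) = xseq x y n * (xseq x y (n+1))⁻¹ := by
  simp only [xseq, br]; group

lemma e_anti {x y : G} (h : Hyp x y) (n : ℕ) : xseq x y n * xseq x y (n+1) * (xseq x y n)⁻¹ = (xseq x y (n+1))⁻¹ := by
  have h1 := e_conj x y n
  have h2 := (h.ez n).eq
  set a := xseq x y n
  set b := xseq x y (n+1)
  set z := y * x * y
  have h3 : (a * b⁻¹) * (a * b⁻¹) = a * a := by
    rw [← h1, ← pow_two a, show z⁻¹ * a * z * (z⁻¹ * a * z) = z⁻¹ * (a ^ 2 * z) by rw [pow_two]; group, h2]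
    group
  have h4 : b⁻¹ * a * b⁻¹ = a := by
    have : a * (b⁻¹ * a * b⁻¹) = a * a := by rw [← h3]; group
    exact mul_left_cancel this
  calc a * b * a⁻¹ = (b⁻¹ * a * b⁻¹) * b * a⁻¹ := by rw [h4]
    _ = b⁻¹ := by group

lemma step_alg {a0 a1 c d κ κ' ζ : G} (hκ : ∀ g ∈ ({a0, a1, c, d, ζ, κ'} : Set G), κ * g = g * κ) 
    (hκ' : ∀ g ∈ ({a0, a1, c, d} : Set G), κ' * g = g * κ')
    (hζ : ∀ g ∈ ({a0, a1, c, d} : Set G), ζ * g = g * ζ)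
    (hζ' : ζ * κ' = κ' * ζ)
    (h1 : a0 * c * a0⁻¹ = κ * c) (h2 : a1 * c * a1⁻¹ = κ' * c)
    (h3 : (a0 * a1⁻¹) * (c * d⁻¹) * (a0 * a1⁻¹)⁻¹ = κ * (c * d⁻¹))
    (e : G) (h4 : a1 * e * a1⁻¹ = ζ * d⁻¹) :
    a0 * e * a0⁻¹ = (κ' * ζ) * d⁻¹ := by
  have k1 := hκ' a0 (by simp)
  have k2 := hκ' c (by simp)
  have k3 := hζ a1 (by simp)
  have k3' := hζ a0 (by simp)
  have k4 := hκ' a1 (by simp)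
  have k5 := hζ c (by simp)
  have k6 := hκ c (by simp)
  have k7 := hκ a0 (by simp)
  -- a1⁻¹ c a1 = κ'⁻¹ c
  have e1 : c * a1 = κ'⁻¹ * a1 * c := by
    have : a1 * c = κ' * c * a1 := by rw [← h2]; group
    rw [mul_assoc, this]; group
  have e2 : a1⁻¹ * c * a1 = κ'⁻¹ * c := by
    have k4' : κ'⁻¹ * a1 = a1 * κ'⁻¹ := by
      rw [inv_mul_eq_iff_eq_mul, ← mul_assoc, k4]; group
    rw [mul_assoc, e1, k4']; group
  have e3 : a1⁻¹ * d⁻¹ * a1 = ζ⁻¹ * e := by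
    have : d⁻¹ = ζ⁻¹ * (a1 * e * a1⁻¹) := by rw [h4]; group
    rw [this]
    have k3'' : a1⁻¹ * ζ⁻¹ = ζ⁻¹ * a1⁻¹ := by
      rw [← _root_.mul_inv_rev, ← _root_.mul_inv_rev, k3]
    calc a1⁻¹ * (ζ⁻¹ * (a1 * e * a1⁻¹)) * a1 = (a1⁻¹ * ζ⁻¹) * a1 * e := by group
      _ = ζ⁻¹ * e := by rw [k3'']; group
  have e4 : a0 * ((κ'⁻¹ * c) * (ζ⁻¹ * e)) * a0⁻¹ = κ * (c * d⁻¹) := by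
    rw [← h3, ← e2, ← e3]; group
  have e5 : a0 * ((κ'⁻¹ * c) * (ζ⁻¹ * e)) * a0⁻¹ = κ'⁻¹ * ζ⁻¹ * (a0 * c * a0⁻¹) * (a0 * e * a0⁻¹) := by
    have i1 : a0 * κ'⁻¹ = κ'⁻¹ * a0 := by
      rw [eq_inv_mul_iff_mul_eq, ← mul_assoc, k1]; group
    have i2 : c * ζ⁻¹ = ζ⁻¹ * c := by
      rw [eq_inv_mul_iff_mul_eq, ← mul_assoc, k5]; group
    have i3 : a0 * ζ⁻¹ = ζ⁻¹ * a0 := by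
      rw [eq_inv_mul_iff_mul_eq, ← mul_assoc, k3']; group
    calc a0 * ((κ'⁻¹ * c) * (ζ⁻¹ * e)) * a0⁻¹ = (a0 * κ'⁻¹) * (c * ζ⁻¹) * e * a0⁻¹ := by group
      _ = κ'⁻¹ * (a0 * ζ⁻¹) * c * e * a0⁻¹ := by rw [i1, i2]; group
      _ = _ := by rw [i3]; group
  rw [e5, h1] at e4
  have k8 := hκ ζ (by simp)
  have k9 := hκ κ' (by simp)
  have e6 : κ * (c * (a0 * e * a0⁻¹)) = κ * (c * ((κ' * ζ) * d⁻¹)) := by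
    calc κ * (c * (a0 * e * a0⁻¹)) = ζ * κ' * (κ'⁻¹ * ζ⁻¹ * (κ * c) * (a0 * e * a0⁻¹)) := by group
      _ = ζ * (κ' * κ) * c * d⁻¹ := by rw [e4]; group
      _ = (ζ * κ) * κ' * c * d⁻¹ := by rw [← k9]; group
      _ = κ * ζ * (κ' * c) * d⁻¹ := by rw [← k8]; group
      _ = κ * (ζ * c) * κ' * d⁻¹ := by rw [k2]; group
      _ = κ * c * (ζ * κ') * d⁻¹ := by rw [k5]; group
      _ = κ * c * (κ' * ζ) * d⁻¹ := by rw [hζ']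
      _ = _ := by group
  exact mul_left_cancel (mul_left_cancel e6)

lemma stepA_main {x y : G} (h : Hyp x y) (n : ℕ) :
    (∀ k, 1 ≤ k → k ≤ n → xseq x y k * xseq x y k ∈ CC x y) ∧
    (∀ i j, i ≤ n → j ≤ n → ∃ κ ∈ CC x y, xseq x y i * xseq x y j * (xseq x y i)⁻¹ = κ * xseq x y j) := by
  induction n with
  | zero =>
    refine ⟨fun k h1 h2 => by omega, fun i j hi hj => ⟨1, one_mem _, ?_⟩⟩
    have : i = 0 := by omega
    have : j = 0 := by omega
    subst i j; group
  | succ n ih =>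
    obtain ⟨ih1, ih2⟩ := ih
    set e := xseq x y with he
    have key : ∀ m, m ≤ n → ∃ ζ ∈ CC x y, e (n-m) * e (n+1) * (e (n-m))⁻¹ = ζ * e (n+1) ∨
        e (n-m) * e (n+1) * (e (n-m))⁻¹ = ζ * (e (n+1))⁻¹ := by
      intro m
      induction m with
      | zero =>
        intro _
        exact ⟨1, one_mem _, Or.inr (by rw [one_mul]; exact e_anti h n)⟩
      | succ m ihm =>
        intro hm
        obtain ⟨ζ, hζ, h4⟩ := ihm (by omega)
        obtain ⟨i, hi⟩ : ∃ i, i = n - (m+1) := ⟨_, rfl⟩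
        have hi1 : n - m = i + 1 := by omega
        rw [← hi]
        rw [hi1] at h4
        obtain ⟨κ, hκ, h1⟩ := ih2 i n (by omega) le_rfl
        obtain ⟨κ', hκ', h2⟩ := ih2 (i+1) n (by omega) le_rfl
        have hz := hκ.2.1 _ (z_mem_PP x y)
        have h3 : (e i * (e (i+1))⁻¹) * (e n * (e (n+1))⁻¹) * (e i * (e (i+1))⁻¹)⁻¹ = κ * (e n * (e (n+1))⁻¹) := by
          rw [he, ← e_conj x y i, ← e_conj x y n, ← he]
          set z := y * x * y
          have hz' : z⁻¹ * κ = κ * z⁻¹ := by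
            rw [inv_mul_eq_iff_eq_mul, ← mul_assoc, ← hz]; group
          calc _ = z⁻¹ * (e i * e n * (e i)⁻¹) * z := by group
            _ = (z⁻¹ * κ) * e n * z := by rw [h1]; group
            _ = _ := by rw [hz']; group
        have hh : ∀ κ ∈ CC x y, ∀ k, κ * e k = e k * κ := fun κ hκ k => hκ.2.1 _ (e_mem_PP x y k)
        have hh2 : ∀ κ ∈ CC x y, ∀ κ' ∈ CC x y, κ * κ' = κ' * κ := fun κ hκ κ' hκ' => hκ.2.1 _ (Zp_le_PP _ _ hκ'.1)
        have fin : ∀ ζ ∈ CC x y, ∀ f, e (i+1) * f * (e (i+1))⁻¹ = ζ * (e (n+1))⁻¹ → 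
            e i * f * (e i)⁻¹ = (κ' * ζ) * (e (n+1))⁻¹ := by
          intro ζ hζ f hf
          refine step_alg (κ := κ) ?_ ?_ ?_ (hh2 _ hζ _ hκ') h1 h2 h3 f hf
          · rintro g (rfl | rfl | rfl | rfl | rfl | rfl)
            · exact hh _ hκ _
            · exact hh _ hκ _
            · exact hh _ hκ _
            · exact hh _ hκ _
            · exact hh2 _ hκ _ hζ
            · exact hh2 _ hκ _ hκ'
          · rintro g (rfl | rfl | rfl | rfl) <;> exact hh _ hκ' _
          · rintro g (rfl | rfl | rfl | rfl) <;> exact hh _ hζ _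
        have hζ' : (κ' * ζ⁻¹)⁻¹ ∈ CC x y := inv_mem (mul_mem hκ' (inv_mem hζ))
        rcases h4 with h4 | h4
        · have := fin ζ⁻¹ (inv_mem hζ) (e (n+1))⁻¹ (by
            rw [show e (i+1) * (e (n+1))⁻¹ * (e (i+1))⁻¹ = (e (i+1) * (e (n+1)) * (e (i+1))⁻¹)⁻¹ by group, h4,
              _root_.mul_inv_rev]
            exact ((show Commute ζ⁻¹ (e (n+1)) from hh _ (inv_mem hζ) (n+1)).inv_right.eq).symm)
          refine ⟨_, hζ', Or.inl ?_⟩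
          have h5 : e i * e (n+1) * (e i)⁻¹ = (e i * (e (n+1))⁻¹ * (e i)⁻¹)⁻¹ := by group
          rw [h5, this, _root_.mul_inv_rev, inv_inv]
          exact (hh _ hζ' (n+1)).symm
        · exact ⟨_, mul_mem hκ' hζ, Or.inr (fin ζ hζ _ h4)⟩
    have hω : e (n+1) * e (n+1) ∈ CC x y := by
      obtain ⟨ζ, hζ, h4⟩ := key n le_rfl
      rw [Nat.sub_self] at h4
      have e4 : e (n+1) * e (n+1) * (e (n+1) * e (n+1)) = 1 := by
        have := h.e4 (n+1) (by omega)
        rw [← this, he]; simp only [pow_succ, pow_zero, one_mul, mul_assoc]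
      refine ⟨Subgroup.subset_closure ⟨n+1, by omega, rfl⟩, PP_comm ?_ ?_, e4⟩
      · have hx : e 0 = x := rfl
        have c1 := hζ.2.1 _ (e_mem_PP x y (n+1))
        rw [← he] at c1
        have c2 : ζ * (e (n+1))⁻¹ = (e (n+1))⁻¹ * ζ := by
          rw [eq_inv_mul_iff_mul_eq, ← mul_assoc, ← c1]; group
        have : e 0 * (e (n+1) * e (n+1)) * (e 0)⁻¹ = e (n+1) * e (n+1) := by
          rw [show e 0 * (e (n+1) * e (n+1)) * (e 0)⁻¹ = (e 0 * e (n+1) * (e 0)⁻¹) * (e 0 * e (n+1) * (e 0)⁻¹) by group]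
          rcases h4 with h4 | h4
          · rw [h4]
            calc ζ * e (n+1) * (ζ * e (n+1)) = ζ * (e (n+1) * ζ) * e (n+1) := by group
              _ = (ζ * ζ) * (e (n+1) * e (n+1)) := by rw [← c1]; group
              _ = _ := by rw [hζ.2.2, one_mul]
          · rw [h4]
            calc ζ * (e (n+1))⁻¹ * (ζ * (e (n+1))⁻¹) = ζ * ((e (n+1))⁻¹ * ζ) * (e (n+1))⁻¹ := by group
              _ = (ζ * ζ) * (e (n+1) * e (n+1))⁻¹ := by rw [← c2]; group
              _ = _ := by rw [hζ.2.2, one_mul]; exact inv_eq_of_mul_eq_one_left e4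
        rw [hx] at this
        exact (mul_inv_eq_iff_eq_mul.1 this).symm
      · have := (h.ez (n+1)).eq
        rwa [pow_two] at this
    have k1 : ∀ i, i ≤ n → ∃ κ ∈ CC x y, e i * e (n+1) * (e i)⁻¹ = κ * e (n+1) := by
      intro i hi
      obtain ⟨ζ, hζ, h4⟩ := key (n - i) (by omega)
      rw [show n - (n - i) = i by omega] at h4
      rcases h4 with h4 | h4
      · exact ⟨ζ, hζ, h4⟩
      · exact ⟨ζ * (e (n+1) * e (n+1))⁻¹, mul_mem hζ (inv_mem hω), by rw [h4]; group⟩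
    constructor
    · intro k hk hk2
      rcases Nat.lt_or_ge n k with h5 | h5
      · have : k = n+1 := by omega
        subst k; exact hω
      · exact ih1 k hk h5
    · intro i j hi hj
      rcases Nat.lt_or_ge n i with h5 | h5
      · have : i = n+1 := by omega
        subst i
        rcases Nat.lt_or_ge n j with h6 | h6
        · have : j = n+1 := by omega
          subst j; exact ⟨1, one_mem _, by group⟩
        · obtain ⟨κ, hκ, h7⟩ := k1 j h6
          refine ⟨κ⁻¹, inv_mem hκ, ?_⟩
          have h8 : e j * e (n+1) = κ * e (n+1) * e j := by rw [← h7]; group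
          have h9 : e (n+1) * e j = κ⁻¹ * (e j * e (n+1)) := by rw [h8]; group
          rw [h9]; group
      · rcases Nat.lt_or_ge n j with h6 | h6
        · have : j = n+1 := by omega
          subst j; exact k1 i h5
        · exact ih2 i j h5 h6

lemma e_sq_mem {x y : G} (h : Hyp x y) (k : ℕ) (hk : 1 ≤ k) : xseq x y k * xseq x y k ∈ CC x y :=
  (stepA_main h k).1 k hk le_rfl
lemma e_comm {x y : G} (h : Hyp x y) (i j : ℕ) :
    ∃ κ ∈ CC x y, xseq x y i * xseq x y j = κ * (xseq x y j * xseq x y i) := by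
  obtain ⟨κ, hκ, h1⟩ := (stepA_main h (max i j)).2 i j (le_max_left _ _) (le_max_right _ _)
  exact ⟨κ, hκ, by rw [← mul_assoc, ← h1]; group⟩
lemma e0_sq_comm {x y : G} (h : Hyp x y) : ∀ p ∈ PP x y, (x * x) * p = p * (x * x) := by
  apply PP_comm
  · group
  · have := (h.ez 0).eq
    rwa [pow_two] at this
end stepA
end

/-! Part 5 -/

noncomputable section

lemma grp1 {G : Type*} [Group G] (z g : G) : z * (z⁻¹ * g * z) = g * z := by group
lemma grp2 {G : Type*} [Group G] (z g : G) : (z * g * z⁻¹) * z = z * g := by group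

def bar : R2 →+* R2 := (invert : R2 ≃ₐ[ZMod 2] R2).toRingEquiv.toRingHom
lemma bar_T (n : ℤ) : bar (T n) = T (-n) := invert_T n
lemma bar_coeff (p : R2) (n : ℤ) : (bar p).coeff n = p.coeff (-n) := invert_apply p n
lemma bar_bar (p : R2) : bar (bar p) = p := by
  apply LaurentPolynomial.ext; intro n; rw [bar_coeff, bar_coeff, neg_neg]
lemma bar_tt : bar tt = ti := bar_T 1
lemma bar_ti : bar ti = tt := by rw [ti, bar_T]; rfl
def ev1 : R2 →+* ZMod 2 := LaurentPolynomial.eval₂ (RingHom.id _) 1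
lemma ev1_T (n : ℤ) : ev1 (T n) = 1 := by simp [ev1]
lemma ev1_tt : ev1 tt = 1 := ev1_T 1
lemma ev1_ti : ev1 ti = 1 := ev1_T _
lemma T_ne (n : ℤ) : (T n : R2) ≠ 0 := by
  intro h
  have := ev1_T n
  rw [h] at this; simp at this
lemma T_inj {a b : ℤ} (h : (T a : R2) = T b) : a = b := by
  have h1 : (T a : R2).coeff b = (T b : R2).coeff b := by rw [h]
  simp [T_apply] at h1
  exact h1
lemma T_mul_neg (a : ℤ) : (T a : R2) * T (-a) = 1 := by rw [← T_add]; simp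
lemma T_neg_mul (a : ℤ) : (T (-a) : R2) * T a = 1 := by rw [← T_add]; simp
lemma nu_1t : ¬ IsUnit (1 + tt : R2) := by
  intro h
  have := h.map ev1
  rw [map_add, ev1_tt, map_one] at this
  exact absurd this (by decide)
lemma nu_s : ¬ IsUnit (tt + ti : R2) := by
  intro h
  have := h.map ev1
  rw [map_add, ev1_tt, ev1_ti] at this
  exact absurd this (by decide)

def Um (b c : R2) : Matrix (Fin 3) (Fin 3) R2 := !![1, bar b, c; 0, 1, b; 0, 0, 1]
lemma Um_mul (b c b' c' : R2) : Um b c * Um b' c' = Um (b + b') (c + c' + bar b * b') := by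
  refine Matrix.ext fun i j => ?_; fin_cases i <;> fin_cases j <;>
  simp [Um, Matrix.mul_apply, Fin.sum_univ_three] <;> grind
lemma Um_zero : Um 0 0 = 1 := by
  refine Matrix.ext fun i j => ?_; fin_cases i <;> fin_cases j <;> simp [Um]
def rel (b c : R2) : Prop := (1 + tt) * (c + bar c + b * bar b) = tt * b + bar b
lemma rel_mul {b c b' c' : R2} (h : rel b c) (h' : rel b' c') : rel (b + b') (c + c' + bar b * b') := by
  unfold rel at *
  simp only [map_add, map_mul, bar_bar]
  grind
abbrev M3 := GL (Fin 3) R2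
def UTp (g : M3) (e : ℤ) (b c : R2) : Prop := g.val = (T e : R2) • Um b c
lemma UTp_mul {g g' : M3} {e e' : ℤ} {b c b' c' : R2} (h : UTp g e b c) (h' : UTp g' e' b' c') :
    UTp (g * g') (e + e') (b + b') (c + c' + bar b * b') := by
  unfold UTp at *
  rw [Units.val_mul, h, h', T_add, ← Um_mul, Matrix.smul_mul, Matrix.mul_smul, smul_smul]
lemma UTp_one : UTp 1 0 0 0 := by simp [UTp, Um_zero]
lemma UTp_eq {g g' : M3} {e : ℤ} {b c : R2} (h : UTp g e b c) (h' : UTp g' e b c) : g = g' :=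
  Units.ext (by rw [h, h'])
lemma val_inv_of {g : M3} {M : Matrix (Fin 3) (Fin 3) R2} (h : g.val * M = 1) : g⁻¹.val = M := by
  have : g⁻¹.val * (g.val * M) = M := by
    rw [← mul_assoc, ← Units.val_mul]; simp
  rw [← this, h, mul_one]
lemma UTp_inv {g : M3} {e : ℤ} {b c : R2} (h : UTp g e b c) : UTp g⁻¹ (-e) b (c + bar b * b) := by
  apply val_inv_of
  rw [h, Matrix.smul_mul, Matrix.mul_smul, smul_smul, Um_mul, T_mul_neg]
  rw [CharTwo.add_self_eq_zero, show c + (c + bar b * b) + bar b * b = 0 by grind, Um_zero, one_smul]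
lemma rel_inv {b c : R2} (h : rel b c) : rel b (c + bar b * b) := by
  unfold rel at *
  simp only [map_add, map_mul, bar_bar]
  grind
def UTr : Subgroup M3 where
  carrier := {g | ∃ e b c, UTp g e b c ∧ rel b c}
  mul_mem' := by
    rintro g g' ⟨e, b, c, h, hr⟩ ⟨e', b', c', h', hr'⟩
    exact ⟨_, _, _, UTp_mul h h', rel_mul hr hr'⟩
  one_mem' := ⟨_, _, _, UTp_one, by simp [rel]⟩
  inv_mem' := by
    rintro g ⟨e, b, c, h, hr⟩
    exact ⟨_, _, _, UTp_inv h, rel_inv hr⟩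

lemma gX_UT : UTp gX 1 1 0 := by
  unfold UTp; rw [gX_val]
  refine Matrix.ext fun i j => ?_; fin_cases i <;> fin_cases j <;> simp [Um, mX, T1_eq]
lemma gX_UTr : gX ∈ UTr := ⟨_, _, _, gX_UT, by simp [rel]; grind⟩

lemma Z_conj_mat (b c : R2) : Um b c * mZ = mZ * Um (tt * b) (c + b + bar b + tt * b) := by
  have := tt_ti
  refine Matrix.ext fun i j => ?_; fin_cases i <;> fin_cases j <;>
  simp [Um, mZ, bar_tt, Matrix.mul_apply, Fin.sum_univ_three] <;> grind

lemma Z_conj {g : M3} {e : ℤ} {b c : R2} (h : UTp g e b c) :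
    UTp (gZ⁻¹ * g * gZ) e (tt * b) (c + b + bar b + tt * b) := by
  unfold UTp at *
  have h2 : gZ.val * (gZ⁻¹ * g * gZ).val = g.val * mZ := by
    rw [← gZ_val]; exact congrArg Units.val (grp1 gZ g)
  rw [h, Matrix.smul_mul, Z_conj_mat, ← Matrix.mul_smul, ← gZ_val] at h2
  exact gZ.isUnit.mul_left_cancel h2
lemma Z_conj' {g : M3} {e : ℤ} {b c : R2} (h : UTp g e b c) :
    UTp (gZ * g * gZ⁻¹) e (ti * b) (c + ti * b + tt * bar b + b) := by
  unfold UTp at *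
  have h2 : (gZ * g * gZ⁻¹).val * gZ.val = mZ * g.val := by
    rw [← gZ_val]; exact congrArg Units.val (grp2 gZ g)
  have h3 := Z_conj_mat (ti * b) (c + ti * b + tt * bar b + b)
  have e1 : tt * (ti * b) = b := by rw [← mul_assoc, tt_ti, one_mul]
  rw [e1, map_mul, bar_ti] at h3
  rw [show c + ti * b + tt * bar b + b + ti * b + tt * bar b + b = c by grind] at h3
  rw [h, Matrix.mul_smul, ← h3, ← Matrix.smul_mul, ← gZ_val] at h2
  exact gZ.isUnit.mul_right_cancel h2
lemma rel_conj {b c : R2} (h : rel b c) : rel (tt * b) (c + b + bar b + tt * b) := by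
  unfold rel at *
  have := tt_ti
  simp only [map_add, map_mul, bar_bar, bar_tt]
  grind
lemma rel_conj' {b c : R2} (h : rel b c) : rel (ti * b) (c + ti * b + tt * bar b + b) := by
  unfold rel at *
  have := tt_ti
  simp only [map_add, map_mul, bar_bar, bar_tt, bar_ti]
  grind

lemma br_UT {g : M3} {e : ℤ} {b c : R2} (h : UTp g e b c) :
    ∃ c', UTp (br gZ g) 0 ((1 + tt) * b) c' := by
  have h1 := Z_conj (UTp_inv h)
  have h2 := UTp_mul h1 h
  rw [show -e + e = 0 by ring, show tt * b + b = (1 + tt) * b by ring] at h2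
  exact ⟨_, h2⟩

/-- upper triangular -/
def IsTri (M : Matrix (Fin 3) (Fin 3) R2) (a d : ℤ) : Prop :=
  M 1 0 = 0 ∧ M 2 0 = 0 ∧ M 2 1 = 0 ∧ M 0 0 = T a ∧ M 2 2 = T a ∧ M 1 1 = T d
lemma IsTri_mul {M N : Matrix (Fin 3) (Fin 3) R2} {a d a' d' : ℤ} (h : IsTri M a d) (h' : IsTri N a' d') :
    IsTri (M * N) (a + a') (d + d') := by
  obtain ⟨h1, h2, h3, h4, h5, h6⟩ := h
  obtain ⟨k1, k2, k3, k4, k5, k6⟩ := h'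
  refine ⟨?_, ?_, ?_, ?_, ?_, ?_⟩ <;> rw [Matrix.mul_apply, Fin.sum_univ_three]
  · rw [h1, k1, k2]; ring
  · rw [h2, h3, k2]; ring
  · rw [h2, h3, k3]; ring
  · rw [h4, k1, k2, k4, T_add]; ring
  · rw [h2, h3, h5, k5, T_add]; ring
  · rw [h1, h6, k3, k6, T_add]; ring
def IsTriG (g : M3) (a d : ℤ) : Prop := IsTri g.val a d ∧ IsTri g⁻¹.val (-a) (-d)
lemma IsTriG_mul {g g' : M3} {a d a' d' : ℤ} (h : IsTriG g a d) (h' : IsTriG g' a' d') :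
    IsTriG (g * g') (a + a') (d + d') := by
  refine ⟨by rw [Units.val_mul]; exact IsTri_mul h.1 h'.1, ?_⟩
  rw [_root_.mul_inv_rev, Units.val_mul, neg_add_rev, neg_add_rev]
  exact IsTri_mul h'.2 h.2
lemma IsTriG_inv {g : M3} {a d : ℤ} (h : IsTriG g a d) : IsTriG g⁻¹ (-a) (-d) := by
  refine ⟨h.2, ?_⟩
  rw [inv_inv, neg_neg, neg_neg]; exact h.1
lemma IsTriG_one : IsTriG 1 0 0 := by
  constructor <;> simp [IsTri]
lemma IsTriG_UT {g : M3} {e : ℤ} {b c : R2} (h : UTp g e b c) : IsTriG g e e := by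
  have h' := UTp_inv h
  unfold UTp at h h'
  constructor
  · rw [h]; simp [IsTri, Um]
  · rw [h']; simp [IsTri, Um]
lemma T_nat (n : ℕ) : (T (n : ℤ) : R2) = tt ^ n := by rw [tt, T_pow]; simp
lemma T_negnat (n : ℕ) : (T (-(n : ℤ)) : R2) = ti ^ n := by rw [ti, T_pow]; simp
lemma gZinv_val : gZ⁻¹.val = mZi := by
  apply val_inv_of
  have := tt_ti
  rw [gZ_val]
  refine Matrix.ext fun i j => ?_; fin_cases i <;> fin_cases j <;>
  simp [mZ, mZi, Matrix.mul_apply, Fin.sum_univ_three] <;> grind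
lemma IsTriG_Z : IsTriG gZ 4 3 := by
  have e1 := T_nat 4
  have e2 := T_nat 3
  have e3 := T_negnat 4
  have e4 := T_negnat 3
  push_cast at e1 e2 e3 e4
  constructor
  · rw [gZ_val]; simp [IsTri, mZ, e1, e2]
  · rw [gZinv_val]; simp [IsTri, mZi, e3, e4]
lemma IsTriG_X : IsTriG gX 1 1 := IsTriG_UT gX_UT
lemma IsTriG_zpow {g : M3} {a d : ℤ} (h : IsTriG g a d) (k : ℤ) : IsTriG (g ^ k) (k * a) (k * d) := by
  induction k using Int.induction_on with
  | zero => simpa using IsTriG_one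
  | succ n ih => 
    rw [_root_.zpow_add_one, add_mul, add_mul, one_mul, one_mul]; exact IsTriG_mul ih h
  | pred n ih => 
    rw [_root_.zpow_sub_one, sub_mul, sub_mul, one_mul, one_mul]; exact IsTriG_mul ih (IsTriG_inv h)
lemma IsTriG_unique {g : M3} {a d a' d' : ℤ} (h : IsTriG g a d) (h' : IsTriG g a' d') : a = a' ∧ d = d' :=
  ⟨T_inj (h.1.2.2.2.1.symm.trans h'.1.2.2.2.1), T_inj (h.1.2.2.2.2.2.symm.trans h'.1.2.2.2.2.2)⟩
end

/-! Part 6 -/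

noncomputable section

section rep
variable {G : Type*} [Group G]

structure Rp (x y : G) (π : G →* M3) : Prop extends Hyp x y where
  hx : π x = gX
  hy : π y = gY

variable {x y : G} {π : G →* M3}

lemma Rp.hz (h : Rp x y π) : π (y * x * y) = gZ := by
  rw [map_mul, map_mul, h.hx, h.hy, gZ_def]

lemma UTr_conj {g : M3} (h : g ∈ UTr) : gZ⁻¹ * g * gZ ∈ UTr := by
  obtain ⟨e, b, c, h, hr⟩ := h
  exact ⟨_, _, _, Z_conj h, rel_conj hr⟩
lemma UTr_conj' {g : M3} (h : g ∈ UTr) : gZ * g * gZ⁻¹ ∈ UTr := by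
  obtain ⟨e, b, c, h, hr⟩ := h
  exact ⟨_, _, _, Z_conj' h, rel_conj' hr⟩

lemma e_UT (h : Rp x y π) (n : ℕ) : ∃ e c, UTp (π (xseq x y n)) e ((1 + tt) ^ n) c := by
  induction n with
  | zero => exact ⟨1, 0, by rw [pow_zero]; show UTp (π x) _ _ _; rw [h.hx]; exact gX_UT⟩
  | succ n ih =>
    obtain ⟨e, c, h1⟩ := ih
    obtain ⟨c', h2⟩ := br_UT h1
    refine ⟨0, c', ?_⟩
    rw [pow_succ']
    show UTp (π (br (y * x * y) (xseq x y n))) _ _ _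
    rw [map_br, h.hz]; exact h2
lemma e_UTr (h : Rp x y π) (n : ℕ) : π (xseq x y n) ∈ UTr := by
  induction n with
  | zero => show π x ∈ UTr; rw [h.hx]; exact gX_UTr
  | succ n ih =>
    show π (br (y * x * y) (xseq x y n)) ∈ UTr
    rw [map_br, h.hz]
    exact mul_mem (UTr_conj (inv_mem ih)) ih

def PU (x y : G) : Subgroup G := Subgroup.closure (Set.range (xseq x y))
lemma e_mem_PU (n : ℕ) : xseq x y n ∈ PU x y := Subgroup.subset_closure ⟨n, rfl⟩
lemma PU_conj {w : G} (hw : w ∈ PU x y) : (y*x*y)⁻¹ * w * (y*x*y) ∈ PU x y := by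
  induction hw using Subgroup.closure_induction with
  | mem w hw =>
    obtain ⟨n, rfl⟩ := hw
    rw [e_conj]
    exact mul_mem (e_mem_PU n) (inv_mem (e_mem_PU (n+1)))
  | one =>
    have : (y*x*y)⁻¹ * 1 * (y*x*y) = 1 := by group
    rw [this]; exact one_mem _
  | mul a b _ _ ha hb =>
    have := mul_mem ha hb
    convert this using 1; group
  | inv a _ ha =>
    have := inv_mem ha
    convert this using 1; group
lemma PU_UTr (h : Rp x y π) {w : G} (hw : w ∈ PU x y) : π w ∈ UTr := by
  have : PU x y ≤ UTr.comap π := by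
    apply (Subgroup.closure_le _).2
    rintro _ ⟨n, rfl⟩
    exact e_UTr h n
  exact this hw

def bfun (g : M3) : R2 := g⁻¹.val 0 0 * g.val 1 2
def cfun (g : M3) : R2 := g⁻¹.val 0 0 * g.val 0 2
lemma bfun_eq {g : M3} {e : ℤ} {b c : R2} (h : UTp g e b c) : bfun g = b := by
  have h' := UTp_inv h
  unfold UTp at h h'
  unfold bfun
  rw [h, h']
  simp only [Um, Matrix.smul_apply, smul_eq_mul]
  simp
lemma cfun_eq {g : M3} {e : ℤ} {b c : R2} (h : UTp g e b c) : cfun g = c := by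
  have h' := UTp_inv h
  unfold UTp at h h'
  unfold cfun
  rw [h, h']
  simp only [Um, Matrix.smul_apply, smul_eq_mul]
  simp

def Zw (x y : G) : Subgroup G := Subgroup.closure (Set.range (fun n => xseq x y n * xseq x y n))
lemma e_sq_UT (h : Rp x y π) (n : ℕ) : ∃ e, UTp (π (xseq x y n * xseq x y n)) e 0 ((tt + ti) ^ n) := by
  obtain ⟨e, c, h1⟩ := e_UT h n
  have h2 := UTp_mul h1 h1
  rw [← map_mul, CharTwo.add_self_eq_zero ((1+tt)^n : R2), CharTwo.add_self_eq_zero c, zero_add] at h2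
  have h3 : bar ((1 + tt) ^ n) * (1 + tt) ^ n = (tt + ti) ^ n := by
    rw [map_pow, ← mul_pow, map_add, map_one, bar_tt]
    congr 1
    have := tt_ti
    grind
  rw [h3] at h2
  exact ⟨_, h2⟩
lemma Zw_UT (h : Rp x y π) {u : G} (hu : u ∈ Zw x y) : ∃ e c, UTp (π u) e 0 c := by
  induction hu using Subgroup.closure_induction with
  | mem u hu => obtain ⟨n, rfl⟩ := hu; obtain ⟨e, he⟩ := e_sq_UT h n; exact ⟨_, _, he⟩
  | one => exact ⟨0, 0, by rw [map_one]; exact UTp_one⟩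
  | mul a b _ _ ha hb =>
    obtain ⟨e, c, h1⟩ := ha
    obtain ⟨e', c', h2⟩ := hb
    have := UTp_mul h1 h2
    rw [← map_mul, add_zero] at this
    exact ⟨_, _, this⟩
  | inv a _ ha =>
    obtain ⟨e, c, h1⟩ := ha
    exact ⟨_, _, by rw [map_inv]; exact UTp_inv h1⟩
lemma Zw_le_PU : Zw x y ≤ PU x y := by
  apply (Subgroup.closure_le _).2
  rintro _ ⟨n, rfl⟩
  exact mul_mem (e_mem_PU n) (e_mem_PU n)
lemma CC_le_Zw : CC x y ≤ Zw x y := by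
  intro κ hκ
  have : Zp x y ≤ Zw x y := by
    apply Subgroup.closure_mono
    rintro _ ⟨n, _, rfl⟩
    exact ⟨n, rfl⟩
  exact this hκ.1
lemma e_sq_central (h : Hyp x y) (n : ℕ) : ∀ p ∈ PP x y, (xseq x y n * xseq x y n) * p = p * (xseq x y n * xseq x y n) := by
  rcases Nat.eq_zero_or_pos n with rfl | hn
  · exact e0_sq_comm h
  · exact (e_sq_mem h n hn).2.1
lemma Zw_central (h : Hyp x y) {u : G} (hu : u ∈ Zw x y) : ∀ p ∈ PP x y, u * p = p * u := by
  intro p hp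
  have : Commute u p := by
    induction hu using Subgroup.closure_induction with
    | mem u hu => obtain ⟨n, rfl⟩ := hu; exact e_sq_central h n p hp
    | one => exact Commute.one_left _
    | mul a b _ _ ha hb => exact ha.mul_left hb
    | inv a _ ha => exact ha.inv_left
  exact this
lemma x4_UT (h : Rp x y π) (k : ℤ) : ∃ e, UTp (π ((x ^ 4) ^ k)) e 0 0 := by
  have h0 : UTp (π (x ^ 4)) 4 0 0 := by
    have h1 := UTp_mul gX_UT gX_UT
    rw [CharTwo.add_self_eq_zero (1:R2)] at h1
    have h2 := UTp_mul h1 h1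
    rw [map_pow, h.hx, show gX ^ 4 = gX * gX * (gX * gX) by simp only [pow_succ, pow_zero, one_mul, mul_assoc]]
    convert h2 using 1
    · simp
    · rw [add_zero]
    · rw [map_zero, zero_mul, add_zero, CharTwo.add_self_eq_zero (0 + 0 + bar 1 * 1 : R2)]
  induction k using Int.induction_on with
  | zero => exact ⟨0, by rw [zpow_zero, map_one]; exact UTp_one⟩
  | succ n ih => 
    obtain ⟨e, he⟩ := ih
    have := UTp_mul he h0
    simp only [add_zero, map_zero, mul_zero] at this
    exact ⟨_, by rw [_root_.zpow_add_one, map_mul]; exact this⟩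
  | pred n ih =>
    obtain ⟨e, he⟩ := ih
    have := UTp_mul he (UTp_inv h0)
    simp only [add_zero, map_zero, mul_zero] at this
    exact ⟨_, by rw [_root_.zpow_sub_one, map_mul, map_inv]; exact this⟩

lemma PU_scalar (h : Rp x y π) {u : G} (hu : u ∈ PU x y) {e : ℤ} (h0 : UTp (π u) e 0 0) :
    u ∈ Subgroup.zpowers (x ^ 4) := by
  have h1 : u ∈ Zw x y := by
    refine abstract_ker (xseq x y) (Zw x y) (PU x y) (fun g => bfun (π g)) (1 + tt) one_add_tt_ne nu_1t
      ?_ e_mem_PU Zw_le_PU ?_ ?_ ?_ ?_ ?_ u ?_ (bfun_eq h0)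
    · intro u hu v hv
      obtain ⟨_, _, _, h1, _⟩ := PU_UTr h hu
      obtain ⟨_, _, _, h2, _⟩ := PU_UTr h hv
      have h3 := UTp_mul h1 h2
      rw [← map_mul] at h3
      show bfun _ = bfun _ + bfun _
      rw [bfun_eq h1, bfun_eq h2, bfun_eq h3]
    · intro k
      obtain ⟨e, c, h1⟩ := e_UT h k
      exact bfun_eq h1
    · intro ζ hζ
      obtain ⟨e, c, h1⟩ := Zw_UT h hζ
      exact bfun_eq h1
    · intro k; exact Subgroup.subset_closure ⟨k, rfl⟩
    · intro ζ hζ k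
      exact Zw_central h.toHyp hζ _ (e_mem_PP x y k)
    · intro i j
      obtain ⟨κ, hκ, h1⟩ := e_comm h.toHyp i j
      exact ⟨κ, CC_le_Zw hκ, h1⟩
    · exact Subgroup.closure_mono Set.subset_union_left hu
  have hx4 : Subgroup.zpowers (x ^ 4) ≤ Zw x y := by
    rw [Subgroup.zpowers_le]
    have h2 : x * x ∈ Zw x y := Subgroup.subset_closure ⟨0, rfl⟩
    have := mul_mem h2 h2
    convert this using 1; simp only [pow_succ, pow_zero, one_mul, mul_assoc]
  refine abstract_ker (fun n => xseq x y n * xseq x y n) (Subgroup.zpowers (x ^ 4)) (Zw x y)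
      (fun g => cfun (π g)) (tt + ti) tt_add_ti_ne nu_s
      ?_ (fun k => Subgroup.subset_closure ⟨k, rfl⟩) hx4 ?_ ?_ ?_ ?_ ?_ u ?_ (cfun_eq h0)
  · intro u hu v hv
    obtain ⟨_, _, h1⟩ := Zw_UT h hu
    obtain ⟨_, _, h2⟩ := Zw_UT h hv
    have h3 := UTp_mul h1 h2
    rw [← map_mul, mul_zero, add_zero] at h3
    show cfun _ = cfun _ + cfun _
    rw [cfun_eq h1, cfun_eq h2, cfun_eq h3, add_zero]
  · intro k
    obtain ⟨e, h1⟩ := e_sq_UT h k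
    exact cfun_eq h1
  · rintro _ ⟨k, rfl⟩
    obtain ⟨e, h1⟩ := x4_UT h k
    exact cfun_eq h1
  · intro k
    rcases Nat.eq_zero_or_pos k with rfl | hk
    · refine ⟨1, ?_⟩
      show (x^4)^(1:ℤ) = (x * x) * (x * x)
      rw [zpow_one]; simp only [pow_succ, pow_zero, one_mul, mul_assoc]
    · rw [(e_sq_mem h.toHyp k hk).2.2]; exact one_mem _
  · rintro _ ⟨k, rfl⟩ n
    have : Commute (x^4) (xseq x y n * xseq x y n) := h.central _
    exact this.zpow_left k
  · intro i j
    exact ⟨1, one_mem _, by rw [one_mul]; exact e_sq_central h.toHyp i _ (mul_mem (e_mem_PP x y j) (e_mem_PP x y j))⟩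
  · exact Subgroup.closure_mono Set.subset_union_left h1

def inU (x y u : G) : Prop := ∃ N : ℕ, ((y*x*y)^N)⁻¹ * u * (y*x*y)^N ∈ PU x y
lemma inU_mono {u : G} {N M : ℕ} (hNM : N ≤ M) (h : ((y*x*y)^N)⁻¹ * u * (y*x*y)^N ∈ PU x y) :
    ((y*x*y)^M)⁻¹ * u * (y*x*y)^M ∈ PU x y := by
  induction M, hNM using Nat.le_induction with
  | base => exact h
  | succ M _ ih =>
    have := PU_conj ih
    convert this using 1
    rw [pow_succ]; group
lemma inU_mul {u v : G} (hu : inU x y u) (hv : inU x y v) : inU x y (u * v) := by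
  obtain ⟨N, h1⟩ := hu
  obtain ⟨M, h2⟩ := hv
  refine ⟨max N M, ?_⟩
  have := mul_mem (inU_mono (le_max_left N M) h1) (inU_mono (le_max_right N M) h2)
  convert this using 1
  group
lemma inU_inv {u : G} (hu : inU x y u) : inU x y u⁻¹ := by
  obtain ⟨N, h1⟩ := hu
  refine ⟨N, ?_⟩
  have := inv_mem h1
  convert this using 1
  group
lemma inU_PU {u : G} (hu : u ∈ PU x y) : inU x y u := ⟨0, by simpa using hu⟩
lemma inU_x : inU x y x := inU_PU (e_mem_PU 0)
lemma inU_one : inU x y 1 := inU_PU (one_mem _)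
lemma inU_conj {u : G} (hu : inU x y u) : inU x y ((y*x*y)⁻¹ * u * (y*x*y)) := by
  obtain ⟨N, h1⟩ := hu
  refine ⟨N, ?_⟩
  have := PU_conj h1
  have e : ∀ z : G, (z^N)⁻¹ * (z⁻¹ * u * z) * z^N = z⁻¹ * ((z^N)⁻¹ * u * z^N) * z := by intro z; group
  rw [e]; exact this
lemma inU_conj' {u : G} (hu : inU x y u) : inU x y ((y*x*y) * u * (y*x*y)⁻¹) := by
  obtain ⟨N, h1⟩ := hu
  refine ⟨N+1, ?_⟩
  have e : ∀ z : G, (z^(N+1))⁻¹ * (z * u * z⁻¹) * z^(N+1) = ((z^N)⁻¹ * u * z^N) := by intro z; rw [pow_succ']; group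
  rw [e]; exact h1
def ta (x y : G) : G := (y * x * y) * x
lemma inU_ta {u : G} (hu : inU x y u) : inU x y (ta x y * u * (ta x y)⁻¹) := by
  have := inU_conj' (inU_mul (inU_mul inU_x hu) (inU_inv inU_x))
  convert this using 1; unfold ta; group
lemma inU_ta' {u : G} (hu : inU x y u) : inU x y ((ta x y)⁻¹ * u * ta x y) := by
  have := (inU_mul (inU_mul (inU_inv inU_x) (inU_conj hu)) inU_x)
  convert this using 1; unfold ta; group
lemma inU_tak {u : G} (hu : inU x y u) (k : ℤ) : inU x y ((ta x y)^k * u * ((ta x y)^k)⁻¹) := by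
  induction k using Int.induction_on with
  | zero => simpa using hu
  | succ n ih =>
    have := inU_ta ih
    convert this using 1
    rw [add_comm, _root_.zpow_one_add]; group
  | pred n ih =>
    have := inU_ta' ih
    convert this using 1
    rw [sub_eq_add_neg, add_comm, _root_.zpow_add, _root_.zpow_neg_one]; group
lemma PP_form {p : G} (hp : p ∈ PP x y) : ∃ u k, inU x y u ∧ p = u * (ta x y) ^ (k : ℤ) := by
  induction hp using Subgroup.closure_induction with
  | mem p hp =>
    rcases hp with rfl | rfl
    · exact ⟨p, 0, inU_x, by simp⟩
    · refine ⟨_, 1, inU_ta (inU_inv (inU_x (x := x) (y := y))), ?_⟩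
      unfold ta; group
  | one => exact ⟨1, 0, inU_one, by simp⟩
  | mul p q _ _ hp hq =>
    obtain ⟨u, k, h1, rfl⟩ := hp
    obtain ⟨v, l, h2, rfl⟩ := hq
    exact ⟨_, k + l, inU_mul h1 (inU_tak h2 k), by rw [_root_.zpow_add]; group⟩
  | inv p _ hp =>
    obtain ⟨u, k, h1, rfl⟩ := hp
    refine ⟨_, -k, inU_tak (inU_inv h1) (-k), ?_⟩
    group
lemma inU_UTr (h : Rp x y π) {u : G} (hu : inU x y u) : π u ∈ UTr := by
  obtain ⟨N, h1⟩ := hu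
  induction N generalizing u with
  | zero => apply PU_UTr h; simpa using h1
  | succ N ih =>
    have h2 : π ((y*x*y)⁻¹ * u * (y*x*y)) ∈ UTr := by
      apply ih
      have e : ∀ z : G, (z^(N+1))⁻¹ * u * z^(N+1) = (z^N)⁻¹ * (z⁻¹ * u * z) * z^N := by intro z; rw [pow_succ']; group
      rw [← e]; exact h1
    have h3 := UTr_conj' h2
    rw [← h.hz, ← map_inv, ← map_mul, ← map_mul] at h3
    convert h3 using 2
    group
lemma inU_scalar (h : Rp x y π) {u : G} (hu : inU x y u) {e : ℤ} (h0 : UTp (π u) e 0 0) :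
    u ∈ Subgroup.zpowers (x ^ 4) := by
  obtain ⟨N, h1⟩ := hu
  have h2 : UTp (π (((y*x*y)^N)⁻¹ * u * (y*x*y)^N)) e 0 0 := by
    clear h1
    induction N with
    | zero => simpa using h0
    | succ N ih =>
      have := Z_conj ih
      simp only [mul_zero, add_zero, map_zero] at this
      rw [← h.hz, ← map_inv, ← map_mul, ← map_mul] at this
      convert this using 2
      rw [pow_succ]; group
  have h3 := PU_scalar h h1 h2
  obtain ⟨k, hk⟩ := h3
  refine ⟨k, ?_⟩
  have hc : Commute ((x^4)^k) ((y*x*y)^N) := Commute.zpow_left (h.central _) k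
  set w := (y*x*y)^N
  have : u = w * ((x^4)^k) * w⁻¹ := by
    show u = w * ((fun k : ℤ => (x^4)^k) k) * w⁻¹
    rw [hk]; group
  rw [this, ← hc.eq]; simp
lemma ta_Tri (h : Rp x y π) : IsTriG (π (ta x y)) 5 4 := by
  unfold ta; rw [map_mul, h.hz, h.hx]
  exact IsTriG_mul IsTriG_Z IsTriG_X
lemma PP_Tri (h : Rp x y π) {p : G} (hp : p ∈ PP x y) : ∃ a d, IsTriG (π p) a d := by
  obtain ⟨u, k, hu, rfl⟩ := PP_form hp
  obtain ⟨e, b, c, h1, _⟩ := inU_UTr h hu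
  rw [map_mul, map_zpow]
  exact ⟨_, _, IsTriG_mul (IsTriG_UT h1) (IsTriG_zpow (ta_Tri h) k)⟩
lemma PP_inj (h : Rp x y π) {p : G} (hp : p ∈ PP x y) (h1 : π p = 1) : p = 1 := by
  obtain ⟨u, k, hu, rfl⟩ := PP_form hp
  obtain ⟨e, b, c, h2, _⟩ := inU_UTr h hu
  have h3 := IsTriG_mul (IsTriG_UT h2) (IsTriG_zpow (ta_Tri h) k)
  rw [← map_zpow, ← map_mul, h1] at h3
  have h4 := IsTriG_unique h3 IsTriG_one
  have hk : k = 0 := by omega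
  subst k
  rw [zpow_zero, mul_one] at h1 ⊢
  obtain ⟨m, hm⟩ := inU_scalar h hu (by rw [h1]; exact UTp_one)
  have hm' : (x^4)^m = u := hm
  have h5 := IsTriG_zpow (IsTriG_zpow (IsTriG_X) 4) m
  rw [show (gX : M3) ^ (4:ℤ) = gX ^ 4 from zpow_ofNat _ _, ← h.hx, ← map_pow, ← map_zpow, hm', h1] at h5
  have h6 := IsTriG_unique h5 IsTriG_one
  have : m = 0 := by omega
  rw [← hm', this, zpow_zero]
end rep
end

/-! Part 7 -/

noncomputable section

lemma T_mul_coeff (p : R2) (n i : ℤ) : (T n * p : R2).coeff i = p.coeff (i - n) := by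
  have := AddMonoidAlgebra.coeff_single_mul_apply p (1 : ZMod 2) n i
  rw [one_mul, show -n + i = i - n by ring] at this
  exact this
lemma zm2 (a : ZMod 2) (h : a ≠ 0) : a = 1 := by
  revert a; decide
lemma sumT (p : R2) : p = ∑ i ∈ p.coeff.support, (T i : R2) := by
  apply LaurentPolynomial.ext
  intro a
  rw [AddMonoidAlgebra.coeff_sum, Finsupp.finset_sum_apply]
  simp only [T_apply]
  rw [Finset.sum_ite_eq']
  split_ifs with h
  · exact zm2 _ (Finsupp.mem_support_iff.1 h)
  · exact Finsupp.notMem_support_iff.1 h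
lemma R2_ind {M : R2 → Prop} (h0 : M 0) (hT : ∀ i, M (T i)) (ha : ∀ p q, M p → M q → M (p + q)) (p : R2) : M p := by
  rw [sumT p]
  exact Finset.sum_induction _ M ha h0 (fun i _ => hT i)

def O (k : ℤ) : AddSubgroup R2 where
  carrier := {p | ∀ i < k, p.coeff i = 0}
  zero_mem' := by intro i _; simp
  add_mem' := by
    intro p q hp hq i hi
    simp [hp i hi, hq i hi]
  neg_mem' := by
    intro p hp i hi
    simp [hp i hi]
lemma O_mono {k l : ℤ} (h : l ≤ k) : O k ≤ O l := fun p hp i hi => hp i (by omega)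
lemma T_mem_O {i k : ℤ} (h : k ≤ i) : (T i : R2) ∈ O k := by
  intro j hj; rw [T_apply, if_neg (by omega)]
lemma one_mem_O {k : ℤ} (h : k ≤ 0) : (1 : R2) ∈ O k := by
  rw [← T_zero]; exact T_mem_O h
lemma T_mem_O_iff {i k : ℤ} : (T i : R2) ∈ O k ↔ k ≤ i := by
  refine ⟨fun h => ?_, T_mem_O⟩
  by_contra hc
  have := h i (by omega)
  simp [T_apply] at this
lemma O_ind {k : ℤ} {M : R2 → Prop} (h0 : M 0) (hT : ∀ i, k ≤ i → M (T i)) (ha : ∀ p q, M p → M q → M (p + q))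
    {p : R2} (hp : p ∈ O k) : M p := by
  rw [sumT p]
  refine Finset.sum_induction _ M ha h0 (fun i hi => hT i ?_)
  by_contra hc
  exact (Finsupp.mem_support_iff.1 hi) (hp i (by omega))
lemma T_mul_mem {p : R2} {n k : ℤ} : T n * p ∈ O k ↔ p ∈ O (k - n) := by
  constructor
  · intro h i hi
    have := h (i + n) (by omega)
    rw [T_mul_coeff] at this
    rwa [show i + n - n = i by ring] at this
  · intro h i hi
    rw [T_mul_coeff]; exact h _ (by omega)
lemma O_mul {p q : R2} {a b : ℤ} (hp : p ∈ O a) (hq : q ∈ O b) : p * q ∈ O (a + b) := by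
  refine O_ind (M := fun p => p * q ∈ O (a + b)) ?_ ?_ ?_ hp
  · rw [zero_mul]; exact zero_mem _
  · intro i hi; rw [T_mul_mem]; exact O_mono (by omega) hq
  · intro p p' h h'; rw [add_mul]; exact add_mem h h'
lemma O_ex (p : R2) : ∃ n : ℕ, p ∈ O (-n) := by
  refine R2_ind (M := fun p => ∃ n : ℕ, p ∈ O (-n)) ⟨0, zero_mem _⟩ ?_ ?_ p
  · intro i; exact ⟨i.natAbs, T_mem_O (by omega)⟩
  · rintro p q ⟨n, hn⟩ ⟨m, hm⟩
    exact ⟨n + m, add_mem (O_mono (by push_cast; omega) hn) (O_mono (by push_cast; omega) hm)⟩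
/-- ideals -/
lemma ideal_up {I : AddSubgroup R2} (hI : ∀ p ∈ I, T 1 * p ∈ I) {n : ℤ} (hn : O n ≤ I) {r : R2} {i : ℤ}
    (hr : r ∈ I) (hri : r ∈ O i) (hc : r.coeff i ≠ 0) : O i ≤ I := by
  by_cases hin : n ≤ i
  · exact (O_mono hin).trans hn
  have hTk : ∀ (k : ℕ) p, p ∈ I → T k * p ∈ I := by
    intro k
    induction k with
    | zero => intro p hp; simpa using hp
    | succ k ih =>
      intro p hp
      have := hI _ (ih p hp)
      rw [← mul_assoc, ← T_add] at this
      rw [Nat.cast_succ, add_comm]; exact this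
  have key : ∀ (m : ℕ) (j : ℤ), n ≤ j + m → i ≤ j → O j ≤ I := by
    intro m
    induction m with
    | zero => intro j hj _; exact (O_mono (by push_cast at hj; omega)).trans hn
    | succ m ih =>
      intro j hj hij p hp
      have h1 := ih (j+1) (by push_cast at hj; omega) (by omega)
      by_cases h0 : p.coeff j = 0
      · apply h1
        intro l hl
        by_cases hlj : l = j
        · rw [hlj]; exact h0
        · exact hp l (by omega)
      · have h2 := hTk (j - i).toNat r hr
        rw [Int.toNat_of_nonneg (by omega)] at h2
        have h3 : p - T (j - i) * r ∈ I := by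
          apply h1
          intro l hl
          have e : (p - T (j - i) * r).coeff l = p.coeff l - (T (j - i) * r).coeff l := by simp
          rw [e, T_mul_coeff]
          by_cases hlj : l = j
          · rw [hlj, zm2 _ h0, show j - (j - i) = i by ring, zm2 _ hc, sub_self]
          · rw [hp l (by omega), hri _ (by omega), sub_self]
        have := add_mem h3 h2
        simpa using this
  exact key (n - i).toNat i (by omega) le_rfl
lemma ideal_O {I : AddSubgroup R2} (hI : ∀ p ∈ I, T 1 * p ∈ I) {n m : ℤ} (hn : O n ≤ I) (hm : I ≤ O m) :
    ∃ j, ∀ p, p ∈ I ↔ p ∈ O j := by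
  have key : ∀ (k : ℕ) (m : ℤ), n ≤ m + k → I ≤ O m → ∃ j, ∀ p, p ∈ I ↔ p ∈ O j := by
    intro k
    induction k with
    | zero => intro m h1 h2; exact ⟨m, fun p => ⟨fun h => h2 h, fun h => hn (O_mono (by simpa using h1) h)⟩⟩
    | succ k ih =>
      intro m h1 h2
      by_cases h : I ≤ O (m+1)
      · exact ih (m+1) (by push_cast at h1; omega) h
      · obtain ⟨r, hr, hr'⟩ := Set.not_subset.1 h
        refine ⟨m, fun p => ⟨fun h => h2 h, fun hp => ?_⟩⟩
        refine ideal_up hI hn hr (h2 hr) ?_ hp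
        intro h0
        apply hr'
        intro l hl
        by_cases hlj : l = m
        · rw [hlj]; exact h0
        · exact h2 hr l (by omega)
  exact key (n - m).toNat m (by omega) hm

lemma negpart (p : R2) : ∃ q, q - p ∈ O 0 ∧ bar q ∈ O 0 := by
  refine R2_ind (M := fun p => ∃ q, q - p ∈ O 0 ∧ bar q ∈ O 0) ⟨0, by simp, by simp⟩ ?_ ?_ p
  · intro i
    by_cases h : 0 ≤ i
    · exact ⟨0, by rw [zero_sub]; exact neg_mem (T_mem_O h), by simp⟩
    · exact ⟨T i, by simp, by rw [bar_T]; exact T_mem_O (by omega)⟩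
  · rintro p p' ⟨q, h1, h2⟩ ⟨q', h1', h2'⟩
    refine ⟨q + q', ?_, by rw [map_add]; exact add_mem h2 h2'⟩
    have := add_mem h1 h1'
    convert this using 1; ring
lemma twopart (p r : R2) : ∃ q, q - p ∈ O 0 ∧ bar q - r ∈ O 0 := by
  obtain ⟨q, h1, h2⟩ := negpart p
  obtain ⟨q', h1', h2'⟩ := negpart r
  refine ⟨q + bar q', ?_, ?_⟩
  · have := add_mem h1 h2'
    convert this using 1; ring
  · rw [map_add, bar_bar]
    have := add_mem h2 h1'
    convert this using 1; ring

section rep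
variable {G : Type*} [Group G] {x y : G} {π : G →* M3}
def Rz (x y : G) (π : G →* M3) (b c : R2) : Prop := ∃ p ∈ PP x y, ∃ e, UTp (π p) e b c
lemma Rz_mul {b c b' c' : R2} (h : Rz x y π b c) (h' : Rz x y π b' c') : Rz x y π (b + b') (c + c' + bar b * b') := by
  obtain ⟨p, hp, e, h1⟩ := h
  obtain ⟨q, hq, e', h2⟩ := h'
  exact ⟨p * q, mul_mem hp hq, _, by rw [map_mul]; exact UTp_mul h1 h2⟩
lemma Rz_one : Rz x y π 0 0 := ⟨1, one_mem _, 0, by rw [map_one]; exact UTp_one⟩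
lemma Rz_x (h : Rp x y π) : Rz x y π 1 0 := ⟨x, x_mem_PP x y, 1, by rw [h.hx]; exact gX_UT⟩
lemma Rz_conj (h : Rp x y π) {b c : R2} (h1 : Rz x y π b c) : ∃ c', Rz x y π (tt * b) c' := by
  obtain ⟨p, hp, e, h1⟩ := h1
  have := Z_conj h1
  rw [← h.hz, ← map_inv, ← map_mul, ← map_mul] at this
  exact ⟨_, _, mul_mem (mul_mem (inv_mem (z_mem_PP x y)) hp) (z_mem_PP x y), _, this⟩
lemma Rz_conj' (h : Rp x y π) {b c : R2} (h1 : Rz x y π b c) : ∃ c', Rz x y π (ti * b) c' := by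
  obtain ⟨p, hp, e, h1⟩ := h1
  have := Z_conj' h1
  rw [← h.hz, ← map_inv, ← map_mul, ← map_mul] at this
  exact ⟨_, _, mul_mem (mul_mem (z_mem_PP x y) hp) (inv_mem (z_mem_PP x y)), _, this⟩
lemma Rz_T (h : Rp x y π) (k : ℤ) : ∃ c, Rz x y π (T k) c := by
  induction k using Int.induction_on with
  | zero => exact ⟨0, by rw [T_zero]; exact Rz_x h⟩
  | succ n ih =>
    obtain ⟨c, hc⟩ := ih
    obtain ⟨c', hc'⟩ := Rz_conj h hc
    refine ⟨c', ?_⟩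
    rw [tt, ← T_add, add_comm] at hc'; exact hc'
  | pred n ih =>
    obtain ⟨c, hc⟩ := ih
    obtain ⟨c', hc'⟩ := Rz_conj' h hc
    refine ⟨c', ?_⟩
    rw [ti, ← T_add, add_comm] at hc'; exact hc'
lemma Rz_b (h : Rp x y π) (b : R2) : ∃ c, Rz x y π b c := by
  refine R2_ind (M := fun b => ∃ c, Rz x y π b c) ⟨0, Rz_one⟩ (Rz_T h) ?_ b
  rintro p q ⟨c, hc⟩ ⟨c', hc'⟩
  exact ⟨_, Rz_mul hc hc'⟩
lemma Rz_sq {b c : R2} (h : Rz x y π b c) : Rz x y π 0 (bar b * b) := by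
  have := Rz_mul h h
  rwa [CharTwo.add_self_eq_zero b, CharTwo.add_self_eq_zero c, zero_add] at this
lemma Rz_add {c c' : R2} (h : Rz x y π 0 c) (h' : Rz x y π 0 c') : Rz x y π 0 (c + c') := by
  have := Rz_mul h h'
  rwa [mul_zero, add_zero, add_zero] at this
lemma Rz_c (h : Rp x y π) (c : R2) : ∃ c', Rz x y π 0 c' ∧ c' - c ∈ O 0 := by
  refine R2_ind (M := fun c => ∃ c', Rz x y π 0 c' ∧ c' - c ∈ O 0) ⟨0, Rz_one, by simp⟩ ?_ ?_ c
  · intro i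
    by_cases hi : 0 ≤ i
    · exact ⟨0, Rz_one, by rw [zero_sub]; exact neg_mem (T_mem_O hi)⟩
    · obtain ⟨c, hc⟩ := Rz_b h (1 + T i)
      refine ⟨_, Rz_sq hc, ?_⟩
      have e : bar (1 + T i) * (1 + T i) - T i = T (-i) := by
        rw [map_add, map_one, bar_T]
        have := T_neg_mul i
        grind
      rw [e]; exact T_mem_O (by omega)
  · rintro p q ⟨c, h1, h2⟩ ⟨c', h1', h2'⟩
    refine ⟨_, Rz_add h1 h1', ?_⟩
    have := add_mem h2 h2'
    convert this using 1; ring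
lemma Rz_bc (h : Rp x y π) (b c : R2) : ∃ c', Rz x y π b c' ∧ c' - c ∈ O 0 := by
  obtain ⟨d, hd⟩ := Rz_b h b
  obtain ⟨c', h1, h2⟩ := Rz_c h (c - d)
  have := Rz_mul hd h1
  rw [mul_zero, add_zero, add_zero] at this
  refine ⟨_, this, ?_⟩
  convert h2 using 1; ring

/-- unitarity -/
def JJ : Matrix (Fin 3) (Fin 3) R2 := !![0,0,tt+ti;0,tt+ti,1+ti;tt+ti,1+tt,tt+ti]
def Un (g : M3) : Prop := JJ * g⁻¹.val = (g.val.map bar)ᵀ * JJ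
lemma map_bar_mul (M N : Matrix (Fin 3) (Fin 3) R2) : (M * N).map bar = M.map bar * N.map bar := Matrix.map_mul
lemma Un_mul {g h : M3} (hg : Un g) (hh : Un h) : Un (g * h) := by
  unfold Un at *
  rw [_root_.mul_inv_rev, Units.val_mul, Units.val_mul, map_bar_mul, Matrix.transpose_mul, ← mul_assoc, hh, mul_assoc, hg, mul_assoc]
lemma Un_one : Un 1 := by
  unfold Un
  rw [inv_one, Units.val_one, Matrix.map_one _ (map_zero _) (map_one _), Matrix.transpose_one, one_mul, mul_one]
lemma Un_inv {g : M3} (hg : Un g) : Un g⁻¹ := by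
  unfold Un at *
  rw [inv_inv]
  have h1 : (g⁻¹.val.map bar)ᵀ * (g.val.map bar)ᵀ = 1 := by
    rw [← Matrix.transpose_mul, ← map_bar_mul, ← Units.val_mul, mul_inv_cancel, Units.val_one,
      Matrix.map_one _ (map_zero _) (map_one _), Matrix.transpose_one]
  have h2 : JJ * g.val = (g⁻¹.val.map bar)ᵀ * (JJ * g⁻¹.val) * g.val := by
    rw [hg, ← mul_assoc, h1, one_mul]
  rw [h2, mul_assoc, mul_assoc JJ, ← Units.val_mul, inv_mul_cancel, Units.val_one, mul_one]
lemma Un_X : Un gX := by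
  unfold Un; rw [gX_val, gXinv_val]
  have := tt_ti
  refine Matrix.ext fun i j => ?_; fin_cases i <;> fin_cases j <;>
  simp [JJ, mX, mXi, bar_tt, bar_ti, Matrix.mul_apply, Fin.sum_univ_three] <;> grind
lemma Un_Y : Un gY := by
  unfold Un; rw [gY_val, gYinv_val]
  have := tt_ti
  refine Matrix.ext fun i j => ?_; fin_cases i <;> fin_cases j <;>
  simp [JJ, mY, mYi, bar_tt, bar_ti, Matrix.mul_apply, Fin.sum_univ_three] <;> grind
lemma Un_all (h : Rp x y π) (g : G) : Un (π g) := by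
  have hg : g ∈ Subgroup.closure {x, y} := by rw [h.gen]; trivial
  induction hg using Subgroup.closure_induction with
  | mem g hg =>
    rcases hg with rfl | rfl
    · rw [h.hx]; exact Un_X
    · rw [h.hy]; exact Un_Y
  | one => rw [map_one]; exact Un_one
  | mul a b _ _ ha hb => rw [map_mul]; exact Un_mul ha hb
  | inv a _ ha => rw [map_inv]; exact Un_inv ha
lemma r_bar (h : Rp x y π) (g : G) : (π g)⁻¹.val 2 0 = bar ((π g).val 2 0) := by
  have h1 := congrFun (congrFun (Un_all h g) 0) 0
  rw [Matrix.mul_apply, Matrix.mul_apply, Fin.sum_univ_three, Fin.sum_univ_three] at h1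
  simp [JJ, -Matrix.coe_units_inv] at h1
  rw [mul_comm] at h1
  exact mul_right_cancel₀ tt_add_ti_ne h1
/-- reduction at t = 1 -/
def Ev (g : M3) : Prop := ev1 (g.val 0 0) = 1 ∧ ev1 (g.val 1 0) = 0 ∧ ev1 (g.val 2 0) = 0
lemma Ev_mul {g h : M3} (hg : Ev g) (hh : Ev h) : Ev (g * h) := by
  unfold Ev at *
  obtain ⟨h1, h2, h3⟩ := hg
  obtain ⟨k1, k2, k3⟩ := hh
  rw [Units.val_mul]
  simp only [Matrix.mul_apply, Fin.sum_univ_three, map_add, map_mul, h1, h2, h3, k1, k2, k3]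
  simp
lemma Ev_inv {g : M3} (hg : Ev g) : Ev g⁻¹ := by
  obtain ⟨h1, h2, h3⟩ := hg
  have h : g⁻¹.val * g.val = 1 := by rw [← Units.val_mul, inv_mul_cancel, Units.val_one]
  have key : ∀ i, ev1 (g⁻¹.val i 0) = ev1 ((1 : Matrix (Fin 3) (Fin 3) R2) i 0) := by
    intro i
    rw [← h, Matrix.mul_apply, Fin.sum_univ_three]
    simp only [map_add, map_mul, h1, h2, h3]; simp
  refine ⟨?_, ?_, ?_⟩ <;> rw [key] <;> simp
lemma Ev_all (h : Rp x y π) (g : G) : Ev (π g) := by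
  have hg : g ∈ Subgroup.closure {x, y} := by rw [h.gen]; trivial
  induction hg using Subgroup.closure_induction with
  | mem g hg =>
    rcases hg with rfl | rfl
    · rw [h.hx]; unfold Ev; rw [gX_val]; simp [mX, ev1_tt]
    · rw [h.hy]; unfold Ev; rw [gY_val]; simp [mY, ev1_tt]; decide
  | one => rw [map_one]; unfold Ev; simp
  | mul a b _ _ ha hb => rw [map_mul]; exact Ev_mul ha hb
  | inv a _ ha => rw [map_inv]; exact Ev_inv ha
/-- r vanishes -/
lemma r_zero (h : Rp x y π) (g : G) {e : ℤ} (h1 : (π g).val 2 0 ∈ O e) (h2 : (π g)⁻¹.val 2 0 ∈ O (-e)) :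
    (π g).val 2 0 = 0 := by
  have h3 := (Ev_all h g).2.2
  rw [r_bar h] at h2
  set r := (π g).val 2 0
  by_cases hr : r.coeff e = 0
  · apply LaurentPolynomial.ext
    intro i
    rcases lt_trichotomy i e with hi | hi | hi
    · simpa using h1 i hi
    · rw [hi]; simpa using hr
    · have := h2 (-i) (by omega)
      rw [bar_coeff, neg_neg] at this; simpa using this
  · exfalso
    have : r = T e := by
      apply LaurentPolynomial.ext
      intro i
      rw [T_apply]
      rcases lt_trichotomy i e with hi | hi | hi
      · rw [if_neg (by omega)]; exact h1 i hi
      · rw [if_pos hi.symm, hi]; exact zm2 _ hr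
      · rw [if_neg (by omega)]
        have := h2 (-i) (by omega)
        rwa [bar_coeff, neg_neg] at this
    rw [this, ev1_T] at h3
    exact one_ne_zero h3
end rep
end

/-! Part 8 -/

noncomputable section

abbrev V3 := Fin 3 → R2
abbrev Lt := AddSubgroup V3
def scH (k : ℤ) : V3 →+ V3 where
  toFun w := (T k : R2) • w
  map_zero' := smul_zero _
  map_add' := smul_add _
def sc (k : ℤ) (L : Lt) : Lt := L.comap (scH (-k))
lemma mem_sc {k : ℤ} {L : Lt} {w : V3} : w ∈ sc k L ↔ (T (-k) : R2) • w ∈ L := Iff.rfl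
def acH (M : Matrix (Fin 3) (Fin 3) R2) : V3 →+ V3 where
  toFun w := M *ᵥ w
  map_zero' := Matrix.mulVec_zero _
  map_add' := Matrix.mulVec_add _
def act (g : M3) (L : Lt) : Lt := L.comap (acH g⁻¹.val)
lemma mem_act {g : M3} {L : Lt} {w : V3} : w ∈ act g L ↔ g⁻¹.val *ᵥ w ∈ L := Iff.rfl
lemma mem_act' {g : M3} {L : Lt} {w : V3} : w ∈ act g⁻¹ L ↔ g.val *ᵥ w ∈ L := by
  rw [mem_act, inv_inv]
lemma act_mul (g h : M3) (L : Lt) : act (g * h) L = act g (act h L) := by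
  ext w
  rw [mem_act, mem_act, mem_act, _root_.mul_inv_rev, Units.val_mul, Matrix.mulVec_mulVec]
lemma act_one (L : Lt) : act 1 L = L := by
  ext w
  rw [mem_act, inv_one, Units.val_one, Matrix.one_mulVec]
lemma act_inv_act (g : M3) (L : Lt) : act g⁻¹ (act g L) = L := by rw [← act_mul, inv_mul_cancel, act_one]
lemma act_act_inv (g : M3) (L : Lt) : act g (act g⁻¹ L) = L := by rw [← act_mul, mul_inv_cancel, act_one]
lemma sc_sc (k l : ℤ) (L : Lt) : sc k (sc l L) = sc (k + l) L := by
  ext w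
  rw [mem_sc, mem_sc, mem_sc, smul_smul, ← T_add, neg_add_rev]
lemma sc_zero (L : Lt) : sc 0 L = L := by
  ext w
  rw [mem_sc, neg_zero, T_zero, one_smul]
lemma sc_act (k : ℤ) (g : M3) (L : Lt) : sc k (act g L) = act g (sc k L) := by
  ext w
  rw [mem_sc, mem_act, mem_act, mem_sc, Matrix.mulVec_smul]
lemma sc_mono (k : ℤ) {L L' : Lt} (h : L ≤ L') : sc k L ≤ sc k L' := fun w hw => h hw
lemma act_mono (g : M3) {L L' : Lt} (h : L ≤ L') : act g L ≤ act g L' := fun w hw => h hw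

def Bk (k : ℤ) : Lt where
  carrier := {w | ∀ i, w i ∈ O k}
  zero_mem' := fun i => zero_mem _
  add_mem' := fun ha hb i => add_mem (ha i) (hb i)
  neg_mem' := fun ha i => neg_mem (ha i)
lemma mem_Bk {k : ℤ} {w : V3} : w ∈ Bk k ↔ ∀ i, w i ∈ O k := Iff.rfl
lemma sc_Bk (k l : ℤ) : sc k (Bk l) = Bk (k + l) := by
  ext w
  rw [mem_sc, mem_Bk, mem_Bk]
  refine forall_congr' fun i => ?_
  rw [Pi.smul_apply, smul_eq_mul, T_mul_mem, sub_neg_eq_add, add_comm]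
lemma Bk_mono {k l : ℤ} (h : l ≤ k) : Bk k ≤ Bk l := fun w hw i => O_mono h (hw i)
lemma Bk_le {k l : ℤ} (h : Bk k ≤ Bk l) : l ≤ k := by
  have h1 : (fun _ => T k : V3) ∈ Bk k := fun i => T_mem_O le_rfl
  exact T_mem_O_iff.1 (h h1 0)

structure IsLat (L : Lt) : Prop where
  tc : ∀ w ∈ L, (T 1 : R2) • w ∈ L
  lo : ∃ n, Bk n ≤ L
  up : ∃ n, L ≤ Bk n
lemma IsLat.tk {L : Lt} (h : IsLat L) {k : ℤ} (hk : 0 ≤ k) {w : V3} (hw : w ∈ L) : (T k : R2) • w ∈ L := by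
  obtain ⟨n, rfl⟩ := Int.eq_ofNat_of_zero_le hk
  clear hk
  induction n with
  | zero => simpa using hw
  | succ n ih =>
    have := h.tc _ ih
    rw [smul_smul, ← T_add] at this
    rw [Nat.cast_succ, add_comm]; exact this
lemma IsLat.op {L : Lt} (h : IsLat L) {p : R2} (hp : p ∈ O 0) {w : V3} (hw : w ∈ L) : p • w ∈ L := by
  refine O_ind (M := fun p => p • w ∈ L) ?_ ?_ ?_ hp
  · rw [zero_smul]; exact zero_mem _
  · intro i hi; exact h.tk hi hw
  · intro p q hp hq; rw [add_smul]; exact add_mem hp hq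
lemma IsLat.sc_le {L : Lt} (h : IsLat L) {k l : ℤ} (hkl : l ≤ k) : sc k L ≤ sc l L := by
  intro w hw
  rw [mem_sc] at *
  have := h.tk (k := k - l) (by omega) hw
  rw [smul_smul, ← T_add] at this
  convert this using 3; ring
lemma IsLat_sc {L : Lt} (h : IsLat L) (k : ℤ) : IsLat (sc k L) := by
  refine ⟨?_, ?_, ?_⟩
  · intro w hw
    rw [mem_sc] at *
    have := h.tc _ hw
    rwa [smul_comm] at this
  · obtain ⟨n, hn⟩ := h.lo
    exact ⟨k + n, by rw [← sc_Bk]; exact sc_mono k hn⟩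
  · obtain ⟨n, hn⟩ := h.up
    exact ⟨k + n, by rw [← sc_Bk]; exact sc_mono k hn⟩
lemma mat_bd (M : Matrix (Fin 3) (Fin 3) R2) : ∃ n : ℕ, ∀ i j, M i j ∈ O (-n) := by
  have h : ∀ i j, ∃ n : ℕ, M i j ∈ O (-n) := fun i j => O_ex _
  choose f hf using h
  refine ⟨∑ i, ∑ j, f i j, fun i j => O_mono ?_ (hf i j)⟩
  have h1 : f i j ≤ ∑ j, f i j := Finset.single_le_sum (f := fun j => f i j) (fun _ _ => Nat.zero_le _) (Finset.mem_univ j)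
  have h2 : ∑ j, f i j ≤ ∑ i, ∑ j, f i j := Finset.single_le_sum (f := fun i => ∑ j, f i j) (fun _ _ => Nat.zero_le _) (Finset.mem_univ i)
  omega
lemma mulVec_O {M : Matrix (Fin 3) (Fin 3) R2} {a b : ℤ} (hM : ∀ i j, M i j ∈ O a) {w : V3} (hw : w ∈ Bk b) :
    M *ᵥ w ∈ Bk (a + b) := by
  intro i
  rw [Matrix.mulVec, dotProduct]
  exact sum_mem fun j _ => O_mul (hM i j) (hw j)
lemma act_Bk (g : M3) (k : ℤ) : (∃ n, Bk n ≤ act g (Bk k)) ∧ ∃ n, act g (Bk k) ≤ Bk n := by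
  constructor
  · obtain ⟨n, hn⟩ := mat_bd g⁻¹.val
    refine ⟨n + k, fun w hw => ?_⟩
    rw [mem_act]
    have := mulVec_O hn hw
    rwa [show -(n : ℤ) + (n + k) = k by ring] at this
  · obtain ⟨n, hn⟩ := mat_bd g.val
    refine ⟨-n + k, fun w hw => ?_⟩
    rw [mem_act] at hw
    have := mulVec_O hn hw
    rwa [Matrix.mulVec_mulVec, ← Units.val_mul, mul_inv_cancel, Units.val_one, Matrix.one_mulVec] at this
lemma IsLat_act {L : Lt} (h : IsLat L) (g : M3) : IsLat (act g L) := by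
  refine ⟨?_, ?_, ?_⟩
  · intro w hw
    rw [mem_act] at *
    rw [Matrix.mulVec_smul]; exact h.tc _ hw
  · obtain ⟨n, hn⟩ := h.lo
    obtain ⟨m, hm⟩ := (act_Bk g n).1
    exact ⟨m, hm.trans (act_mono g hn)⟩
  · obtain ⟨n, hn⟩ := h.up
    obtain ⟨m, hm⟩ := (act_Bk g n).2
    exact ⟨m, (act_mono g hn).trans hm⟩
lemma IsLat_Bk (k : ℤ) : IsLat (Bk k) := by
  refine ⟨?_, ⟨k, le_rfl⟩, ⟨k, le_rfl⟩⟩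
  intro w hw i
  rw [Pi.smul_apply, smul_eq_mul, T_mul_mem]
  exact O_mono (by omega) (hw i)

def Adj (L L' : Lt) : Prop := ∃ k, sc 1 L ≤ sc k L' ∧ sc k L' ≤ L
lemma Adj_symm {L L' : Lt} (h : Adj L L') : Adj L' L := by
  obtain ⟨k, h1, h2⟩ := h
  refine ⟨1 - k, ?_, ?_⟩
  · have := sc_mono (1 - k) h2
    rwa [sc_sc, show 1 - k + k = 1 by ring] at this
  · have := sc_mono (-k) h1
    rwa [sc_sc, sc_sc, neg_add_cancel, sc_zero, show -k + 1 = 1 - k by ring] at this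
lemma Adj_act {L L' : Lt} (g : M3) (h : Adj L L') : Adj (act g L) (act g L') := by
  obtain ⟨k, h1, h2⟩ := h
  exact ⟨k, by rw [sc_act, sc_act]; exact act_mono g h1, by rw [sc_act]; exact act_mono g h2⟩
lemma Adj_sc_left {L L' : Lt} (m : ℤ) (h : Adj L L') : Adj (sc m L) L' := by
  obtain ⟨k, h1, h2⟩ := h
  refine ⟨m + k, ?_, ?_⟩
  · have := sc_mono m h1
    rw [sc_sc, sc_sc] at this
    rwa [sc_sc, add_comm 1 m]
  · have := sc_mono m h2
    rwa [sc_sc] at this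
lemma Adj_sc_right {L L' : Lt} (m : ℤ) (h : Adj L L') : Adj L (sc m L') :=
  Adj_symm (Adj_sc_left m (Adj_symm h))
lemma Adj_of {L L' : Lt} (k : ℤ) (h1 : L ≤ sc k L') (h2 : sc k L' ≤ sc (-1) L) : Adj L L' := by
  refine ⟨k + 1, ?_, ?_⟩
  · have := sc_mono 1 h1
    rwa [sc_sc, add_comm 1 k] at this
  · have := sc_mono 1 h2
    rwa [sc_sc, sc_sc, add_comm 1 k, show (1:ℤ) + -1 = 0 by ring, sc_zero] at this

def Ht (L : Lt) (n : ℕ) : Prop := ∃ a : ℤ, L ≤ Bk (-a) ∧ Bk (n - a) ≤ L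
lemma Ht_ex {L : Lt} (h : IsLat L) : ∃ n, Ht L n := by
  obtain ⟨m, hm⟩ := h.lo
  obtain ⟨n, hn⟩ := h.up
  refine ⟨(m - n).toNat, -n, by rwa [neg_neg], (Bk_mono ?_).trans hm⟩
  omega
def ht (L : Lt) : ℕ := sInf {n | Ht L n}
lemma ht_spec {L : Lt} (h : IsLat L) : Ht L (ht L) := Nat.sInf_mem (s := {n | Ht L n}) (Ht_ex h)
lemma ht_le {L : Lt} {n : ℕ} (h : Ht L n) : ht L ≤ n := Nat.sInf_le (s := {n | Ht L n}) h
lemma ht_le' {L : Lt} {a b : ℤ} (h1 : L ≤ Bk (-a)) (h2 : Bk b ≤ L) : (ht L : ℤ) ≤ a + b := by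
  have h3 := Bk_le (h2.trans h1)
  have : Ht L (a + b).toNat := ⟨a, h1, by
    rw [Int.toNat_of_nonneg (by omega), show a + b - a = b by ring]; exact h2⟩
  have := ht_le this
  omega
lemma ht_zero {L : Lt} (h : IsLat L) (h0 : ht L = 0) : ∃ k, L = Bk k := by
  obtain ⟨a, h1, h2⟩ := ht_spec h
  rw [h0, Nat.cast_zero, zero_sub] at h2
  exact ⟨_, le_antisymm h1 h2⟩
lemma ht_Bk (k : ℤ) : ht (Bk k) = 0 := by
  have := ht_le' (L := Bk k) (a := -k) (b := k) (by rw [neg_neg]) le_rfl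
  omega
/-- cone points -/
lemma cone {L : Lt} (hL : IsLat L) (h0 : 0 < ht L) : ∃ V W : Lt, IsLat V ∧ IsLat W ∧ Adj L V ∧ Adj L W ∧
    ht V < ht L ∧ ht W < ht L ∧ (∀ L', IsLat L' → Adj L L' → ht L' < ht L → Adj V L') ∧
    (∀ L', IsLat L' → Adj L L' → ht L' ≤ ht L → Adj V L' ∨ Adj W L') := by
  obtain ⟨a, h1, h2⟩ := ht_spec hL
  set b : ℤ := (ht L : ℤ) - a with hb
  have hB : Bk (b - 1) ≤ sc (-1) L := by
    have := sc_mono (-1) h2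
    rwa [sc_Bk, show -1 + b = b - 1 by ring] at this
  have hup : L ≤ sc (-1) L := by
    have := hL.sc_le (k := 0) (l := -1) (by omega)
    rwa [sc_zero] at this
  have hdn : sc 1 L ≤ L := by
    have := hL.sc_le (k := 1) (l := 0) (by omega)
    rwa [sc_zero] at this
  have hA : sc 1 L ≤ Bk (-a + 1) := by
    have := sc_mono 1 h1
    rwa [sc_Bk, add_comm] at this
  have hV : IsLat (L ⊔ Bk (b - 1)) := by
    refine ⟨?_, ⟨b - 1, le_sup_right⟩, ⟨-a, sup_le h1 (Bk_mono (by omega))⟩⟩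
    intro w hw
    obtain ⟨u, hu, v, hv, rfl⟩ := AddSubgroup.mem_sup.1 hw
    rw [smul_add]
    exact AddSubgroup.add_mem_sup (hL.tc _ hu) ((IsLat_Bk _).tc _ hv)
  have hW : IsLat (L ⊓ Bk (-a + 1)) := by
    refine ⟨?_, ⟨b, le_inf h2 (Bk_mono (by omega))⟩, ⟨-a, inf_le_left.trans h1⟩⟩
    intro w hw
    exact ⟨hL.tc _ hw.1, (IsLat_Bk _).tc _ hw.2⟩
  have key : ∀ L', IsLat L' → Adj L L' → ht L' ≤ ht L → ∃ k, L ≤ sc k L' ∧ sc k L' ≤ sc (-1) L ∧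
      (Bk (b - 1) ≤ sc k L' ∨ (ht L' = ht L ∧ sc k L' ≤ Bk (-a))) := by
    intro L' hL' ⟨k, k1, k2⟩ hle
    have j1 := sc_mono (-1) k1
    have j2 := sc_mono (-1) k2
    rw [sc_sc, sc_sc, neg_add_cancel, sc_zero] at j1
    rw [sc_sc] at j2
    refine ⟨-1 + k, j1, j2, ?_⟩
    obtain ⟨a', e1, e2⟩ := ht_spec hL'
    have f1 := sc_mono (-1 + k) e1
    have f2 := sc_mono (-1 + k) e2
    rw [sc_Bk] at f1 f2
    generalize sc (-1 + k) L' = M at *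
    generalize hc : -1 + k + -a' = c at *
    have hd : -1 + k + (ht L' - a') = ht L' + c := by omega
    rw [hd] at f2
    have g1 := ht_le' (a := -c) (b := b) (by rw [neg_neg]; exact j1.trans f1) h2
    have g2' : Bk (ht L' + c + 1) ≤ L := by
      have := sc_mono 1 (f2.trans j2)
      rwa [sc_sc, sc_Bk, show (1:ℤ) + -1 = 0 by ring, sc_zero, add_comm 1] at this
    have g2 := ht_le' (a := a) h1 g2'
    by_cases hcase : ht L' + c ≤ b - 1
    · left; exact (Bk_mono hcase).trans f2
    · right
      exact ⟨by omega, f1.trans (Bk_mono (by omega))⟩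
  refine ⟨_, _, hV, hW, ?_, ?_, ?_, ?_, ?_, ?_⟩
  · refine Adj_of 0 ?_ ?_
    · rw [sc_zero]; exact le_sup_left
    · rw [sc_zero]; exact sup_le hup hB
  · refine ⟨0, ?_, ?_⟩
    · rw [sc_zero]; exact le_inf hdn hA
    · rw [sc_zero]; exact inf_le_left
  · have := ht_le' (L := L ⊔ Bk (b - 1)) (a := a) (b := b - 1) (sup_le h1 (Bk_mono (by omega))) le_sup_right
    omega
  · have := ht_le' (L := L ⊓ Bk (-a + 1)) (a := a - 1) (b := b) (inf_le_right.trans (Bk_mono (by omega))) (le_inf h2 (Bk_mono (by omega)))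
    omega
  · intro L' hL' hadj hlt
    obtain ⟨k, k1, k2, k3 | k3⟩ := key L' hL' hadj hlt.le
    · exact Adj_of k (sup_le k1 k3) (k2.trans (sc_mono _ le_sup_left))
    · omega
  · intro L' hL' hadj hle
    obtain ⟨k, k1, k2, k3 | k3⟩ := key L' hL' hadj hle
    · left; exact Adj_of k (sup_le k1 k3) (k2.trans (sc_mono _ le_sup_left))
    · right
      refine Adj_of k (inf_le_left.trans k1) ?_
      intro w hw
      refine ⟨k2 hw, ?_⟩
      have : w ∈ sc (-1) (Bk (-a + 1)) := by
        rw [sc_Bk, show -1 + (-a + 1) = -a by ring]; exact k3.2 hw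
      exact this
end

/-! Part 9 -/

noncomputable section

def e0 : V3 := ![1,0,0]
def InH (L : Lt) : Prop := ∃ d : ℤ, (T d : R2) • e0 ∈ L ∧ ∀ u ∈ L, u 2 ∈ O d
lemma InH_sc {L : Lt} (k : ℤ) (h : InH L) : InH (sc k L) := by
  obtain ⟨d, h1, h2⟩ := h
  refine ⟨k + d, ?_, ?_⟩
  · rw [mem_sc, smul_smul, ← T_add, neg_add_cancel_left]; exact h1
  · intro u hu
    have := h2 _ (mem_sc.1 hu)
    rw [Pi.smul_apply, smul_eq_mul, T_mul_mem] at this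
    exact O_mono (by omega) this
lemma InH_sc_iff {L : Lt} (k : ℤ) : InH (sc k L) ↔ InH L := by
  refine ⟨fun h => ?_, InH_sc k⟩
  have := InH_sc (-k) h
  rwa [sc_sc, neg_add_cancel, sc_zero] at this
lemma mv3 (M : Matrix (Fin 3) (Fin 3) R2) (l m n : R2) : M *ᵥ ![l,m,n] =
    ![M 0 0 * l + M 0 1 * m + M 0 2 * n, M 1 0 * l + M 1 1 * m + M 1 2 * n, M 2 0 * l + M 2 1 * m + M 2 2 * n] := by
  refine funext fun i => ?_
  fin_cases i <;> simp [Matrix.mulVec, dotProduct, Fin.sum_univ_three]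
lemma vec3 (w : V3) : w = ![w 0, w 1, w 2] := by
  refine funext fun i => ?_
  fin_cases i <;> rfl
lemma sm3 (a l m n : R2) : a • ![l,m,n] = ![a*l,a*m,a*n] := by simp
lemma add3 (l m n l' m' n' : R2) : ![l,m,n] + ![l',m',n'] = ![l+l',m+m',n+n'] := by simp
lemma tri_mv {M : Matrix (Fin 3) (Fin 3) R2} {a d : ℤ} (h : IsTri M a d) (l m n : R2) :
    M *ᵥ ![l,m,n] = ![T a * l + M 0 1 * m + M 0 2 * n, T d * m + M 1 2 * n, T a * n] := by
  obtain ⟨h1, h2, h3, h4, h5, h6⟩ := h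
  rw [mv3, h1, h2, h3, h4, h5, h6]; simp
lemma mv_col (M : Matrix (Fin 3) (Fin 3) R2) (a : R2) : M *ᵥ (a • e0) = ![a * M 0 0, a * M 1 0, a * M 2 0] := by
  rw [e0, sm3, mv3]; simp [mul_comm]
lemma val_inv_mv (g : M3) (w : V3) : g.val *ᵥ (g⁻¹.val *ᵥ w) = w := by
  rw [Matrix.mulVec_mulVec, ← Units.val_mul, mul_inv_cancel, Units.val_one, Matrix.one_mulVec]
lemma inv_val_mv (g : M3) (w : V3) : g⁻¹.val *ᵥ (g.val *ᵥ w) = w := by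
  rw [Matrix.mulVec_mulVec, ← Units.val_mul, inv_mul_cancel, Units.val_one, Matrix.one_mulVec]
lemma InH_tri {L : Lt} {g : M3} {a d : ℤ} (hg : IsTriG g a d) (h : InH L) : InH (act g L) := by
  obtain ⟨c, h1, h2⟩ := h
  refine ⟨a + c, ?_, ?_⟩
  · rw [mem_act, e0, sm3, tri_mv hg.2]
    rw [e0, sm3] at h1
    simp only [mul_zero, add_zero, mul_one] at h1 ⊢
    rw [← T_add, neg_add_cancel_left]
    exact h1
  · intro u hu
    have := h2 _ (mem_act.1 hu)
    rw [vec3 u, tri_mv hg.2] at this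
    have t2 : T (-a) * u 2 ∈ O c := this
    rw [T_mul_mem] at t2
    exact O_mono (by omega) t2

section rep
variable {G : Type*} [Group G] {x y : G} {π : G →* M3}
def Hor (π : G →* M3) (g : G) (L : Lt) : Prop := InH (act (π g)⁻¹ L)
lemma Hor_one {L : Lt} : Hor π 1 L ↔ InH L := by
  unfold Hor; rw [map_one, inv_one, act_one]
lemma Hor_mul {g h : G} {L : Lt} : Hor π (g * h) L ↔ Hor π h (act (π g)⁻¹ L) := by
  unfold Hor; rw [map_mul, _root_.mul_inv_rev, act_mul]
lemma Hor_sc {g : G} {L : Lt} (k : ℤ) : Hor π g (sc k L) ↔ Hor π g L := by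
  unfold Hor; rw [← sc_act, InH_sc_iff]
lemma Hor_act {g h : G} {L : Lt} : Hor π (g * h) (act (π g) L) ↔ Hor π h L := by
  rw [Hor_mul, act_inv_act]
lemma Hor_P (h : Rp x y π) {g p : G} (hp : p ∈ PP x y) {L : Lt} (hL : Hor π g L) : Hor π (g * p) L := by
  obtain ⟨a, d, ht⟩ := PP_Tri h hp
  unfold Hor at *
  rw [map_mul, _root_.mul_inv_rev, act_mul]
  exact InH_tri (IsTriG_inv ht) hL
lemma Dis0 (h : Rp x y π) {k : G} {L : Lt} (h1 : InH L) (h2 : Hor π k L) : (π k).val 2 0 = 0 := by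
  obtain ⟨d, a1, a2⟩ := h1
  obtain ⟨e, b1, b2⟩ := h2
  refine r_zero h k (e := d - e) ?_ ?_
  · rw [mem_act'] at b1
    have := a2 _ b1
    rw [mv_col] at this
    have t2 : T e * (π k).val 2 0 ∈ O d := this
    rwa [T_mul_mem] at t2
  · have m1 : (π k)⁻¹.val *ᵥ ((T d : R2) • e0) ∈ act (π k)⁻¹ L := by
      rw [mem_act', val_inv_mv]; exact a1
    have := b2 _ m1
    rw [mv_col] at this
    have t2 : T d * (π k)⁻¹.val 2 0 ∈ O e := this
    rw [T_mul_mem] at t2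
    rwa [neg_sub]
lemma Dis1 (h : Rp x y π) {g k : G} {L : Lt} (h1 : Hor π g L) (h2 : Hor π k L) : (π (g⁻¹ * k)).val 2 0 = 0 := by
  refine Dis0 h h1 ?_
  rw [show k = g * (g⁻¹ * k) by group] at h2
  exact Hor_mul.1 h2
lemma tri_20 {M N K : Matrix (Fin 3) (Fin 3) R2} {a d a' d' : ℤ} (hM : IsTri M a d) (hN : IsTri N a' d') :
    (M * K * N) 2 0 = T a * K 2 0 * T a' := by
  obtain ⟨h1, h2, h3, h4, h5, h6⟩ := hM
  obtain ⟨k1, k2, k3, k4, k5, k6⟩ := hN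
  simp only [Matrix.mul_apply, Fin.sum_univ_three, h1, h2, h3, h4, h5, h6, k1, k2, k3, k4, k5, k6]
  ring
lemma P_20 (h : Rp x y π) {p q k : G} (hp : p ∈ PP x y) (hq : q ∈ PP x y) (h0 : (π (p * k * q)).val 2 0 = 0) :
    (π k).val 2 0 = 0 := by
  obtain ⟨a, d, h1⟩ := PP_Tri h hp
  obtain ⟨a', d', h2⟩ := PP_Tri h hq
  rw [map_mul, map_mul, Units.val_mul, Units.val_mul, tri_20 h1.1 h2.1] at h0
  rcases mul_eq_zero.1 h0 with h3 | h3
  · rcases mul_eq_zero.1 h3 with h4 | h4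
    · exact absurd h4 (T_ne _)
    · exact h4
  · exact absurd h3 (T_ne _)
lemma tt_ne : tt ≠ 0 := T_ne 1
lemma y_20 (h : Rp x y π) : (π y).val 2 0 ≠ 0 := by
  rw [h.hy, gY_val]
  have : (mY 2 0 : R2) = tt * (1 + tt) := by simp [mY]; ring
  rw [this]
  exact mul_ne_zero tt_ne one_add_tt_ne
lemma yPy (h : Rp x y π) {p : G} (hp : p ∈ PP x y) (h0 : (π (y⁻¹ * p * y)).val 2 0 = 0) : y⁻¹ * p * y ∈ PP x y := by
  obtain ⟨u, k, hu, rfl⟩ := PP_form hp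
  have ht : ∀ k : ℤ, y⁻¹ * (ta x y) ^ k * y = (x * (y * x * y)) ^ k := by
    intro k
    have : y⁻¹ * ta x y * y = x * (y * x * y) := by unfold ta; group
    rw [← this]
    have := (conj_zpow (a := y⁻¹) (b := ta x y) (i := k))
    rw [inv_inv] at this
    exact this.symm
  have hm : (x * (y * x * y)) ^ k ∈ PP x y := zpow_mem (mul_mem (x_mem_PP x y) (z_mem_PP x y)) k
  have e1 : y⁻¹ * (u * (ta x y)^k) * y = (y⁻¹ * u * y) * (x * (y * x * y)) ^ k := by
    rw [← ht]; group
  rw [e1] at h0 ⊢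
  refine mul_mem ?_ hm
  have h1 : (π (y⁻¹ * u * y)).val 2 0 = 0 := P_20 h (one_mem _) hm (by rwa [one_mul])
  obtain ⟨e, b, c, h2, hr⟩ := inU_UTr h hu
  have h3 : b = (1 + tt) * (bar b + c) := by
    rw [map_mul, map_mul, map_inv, h.hy, Units.val_mul, Units.val_mul, gYinv_val, gY_val, h2] at h1
    rw [Matrix.mul_smul, Matrix.smul_mul, Matrix.smul_apply, smul_eq_mul] at h1
    have h4 := (mul_eq_zero.1 h1).resolve_left (T_ne _)
    have h5 : (mYi * Um b c * mY) 2 0 = ti * (1 + tt) * (b + (1 + tt) * (bar b + c)) := by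
      have := tt_ti
      simp [mY, mYi, Um, Matrix.mul_apply, Fin.sum_univ_three]
      grind
    rw [h5] at h4
    have h6 := (mul_eq_zero.1 h4).resolve_left (mul_ne_zero (T_ne _) one_add_tt_ne)
    grind
  have h3' : bar b = (1 + ti) * (b + bar c) := by
    have := congrArg bar h3
    rw [map_mul, map_add, map_add, map_one, bar_tt, bar_bar] at this
    exact this
  unfold rel at hr
  have h4 : (1 + tt) * (b * bar b) = 0 := by
    have := tt_ti
    have e : tt * bar b = (1 + tt) * (b + bar c) := by
      rw [h3']; grind
    grind
  have h5 := (mul_eq_zero.1 h4).resolve_left one_add_tt_ne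
  have hb : b = 0 := by
    rcases mul_eq_zero.1 h5 with hb | hb
    · exact hb
    · rw [← bar_bar b, hb, map_zero]
  subst hb
  rw [map_zero, zero_add] at h3
  have hc : c = 0 := (mul_eq_zero.1 h3.symm).resolve_left one_add_tt_ne
  subst hc
  obtain ⟨m, hm⟩ := inU_scalar h hu h2
  have hm' : (x^4)^m = u := hm
  have hcm : Commute ((x^4)^m) y := Commute.zpow_left (h.central _) m
  have : y⁻¹ * u * y = (x^4)^m := by
    rw [← hm', mul_assoc, hcm.eq]; group
  rw [this]
  exact zpow_mem (pow_mem (x_mem_PP x y) 4) m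
lemma Coset (h : Rp x y π) {p1 q1 p2 q2 : G} (hp1 : p1 ∈ PP x y) (hq1 : q1 ∈ PP x y) (hp2 : p2 ∈ PP x y) (hq2 : q2 ∈ PP x y)
    {L : Lt} (h1 : Hor π (p1 * y * q1) L) (h2 : Hor π (p2 * y * q2) L) :
    (p1 * y * q1)⁻¹ * (p2 * y * q2) ∈ PP x y := by
  have h3 := Dis1 h h1 h2
  have e : (p1 * y * q1)⁻¹ * (p2 * y * q2) = q1⁻¹ * (y⁻¹ * (p1⁻¹ * p2) * y) * q2 := by group
  rw [e] at h3 ⊢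
  have h4 := P_20 h (inv_mem hq1) hq2 h3
  exact mul_mem (mul_mem (inv_mem hq1) (yPy h (mul_mem (inv_mem hp1) hp2) h4)) hq2
end rep
end

/-! Part 10 -/

noncomputable section

lemma T_mem_iff1 {p : R2} : p ∈ O 1 ↔ p ∈ O 0 ∧ p.coeff 0 = 0 := by
  constructor
  · intro h
    exact ⟨O_mono (by omega) h, h 0 (by omega)⟩
  · rintro ⟨h1, h2⟩ i hi
    rcases eq_or_ne i 0 with rfl | hne
    · exact h2
    · exact h1 i (by omega)
lemma offnorm {L0 L' : Lt} (h1 : e0 ∈ L0) (h2 : ∀ u ∈ L0, u 2 ∈ O 0) (h3 : sc 1 L0 ≤ L') (h4 : L' ≤ L0)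
    (h5 : ¬ InH L') : e0 ∉ L' ∧ ∃ u ∈ L', (u 2).coeff 0 ≠ 0 := by
  constructor
  · intro h
    refine h5 ⟨0, ?_, fun u hu => h2 u (h4 hu)⟩
    rw [T_zero, one_smul]; exact h
  · by_contra! h
    refine h5 ⟨1, ?_, fun u hu => T_mem_iff1.2 ⟨h2 u (h4 hu), h u hu⟩⟩
    refine h3 ?_
    rw [mem_sc, smul_smul, ← T_add, neg_add_cancel, T_zero, one_smul]; exact h1
lemma coeff_C0 (a : ZMod 2) : (C a : R2).coeff 0 = a := by
  rw [← LaurentPolynomial.single_eq_C]; simp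
lemma C_mem_O (a : ZMod 2) : (C a : R2) ∈ O 0 := by
  intro i hi
  rw [← LaurentPolynomial.single_eq_C]
  simp [Finsupp.single_apply]
  intro h; omega
def res (w : V3) : V3 := ![C ((w 0).coeff 0), C ((w 1).coeff 0), C ((w 2).coeff 0)]
lemma res_sub {w : V3} (hw : w ∈ Bk 0) : w - res w ∈ Bk 1 := by
  intro i
  rw [T_mem_iff1]
  fin_cases i
  · refine ⟨sub_mem (hw 0) (C_mem_O _), ?_⟩
    show (w 0 - C ((w 0).coeff 0)).coeff 0 = 0
    simp [coeff_C0]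
  · refine ⟨sub_mem (hw 1) (C_mem_O _), ?_⟩
    show (w 1 - C ((w 1).coeff 0)).coeff 0 = 0
    simp [coeff_C0]
  · refine ⟨sub_mem (hw 2) (C_mem_O _), ?_⟩
    show (w 2 - C ((w 2).coeff 0)).coeff 0 = 0
    simp [coeff_C0]
lemma res_iff {L : Lt} (h : Bk 1 ≤ L) {w : V3} (hw : w ∈ Bk 0) : w ∈ L ↔ res w ∈ L := by
  constructor
  · intro h1
    have := sub_mem h1 (h (res_sub hw))
    simpa using this
  · intro h1
    have := add_mem h1 (h (res_sub hw))
    simpa using this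
def Q : Fin 4 → V3 := ![![1,1,1], ![0,0,1], ![0,1,1], ![1,0,1]]
def el : Fin 4 → V3 → R2 := ![fun w => w 0 + w 1, fun w => w 0, fun w => w 0 + w 1 + w 2, fun w => w 0 + w 2]
def mu : Fin 4 → V3 → R2 := ![fun w => w 0, fun w => w 0 + w 1 + w 2, fun w => w 0 + w 2, fun w => w 0 + w 1]
lemma G2fin {S : ZMod 2 → ZMod 2 → ZMod 2 → Prop} (ha : ∀ a b c a' b' c', S a b c → S a' b' c' → S (a+a') (b+b') (c+c'))
    (h0 : ¬ S 1 0 0) (h1 : ∃ a b, S a b 1) : 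
    (S 1 1 1 ∧ ∀ a b c, S a b c → a + b = 0) ∨ (S 0 0 1 ∧ ∀ a b c, S a b c → a = 0) ∨
    (S 0 1 1 ∧ ∀ a b c, S a b c → a + b + c = 0) ∨ (S 1 0 1 ∧ ∀ a b c, S a b c → a + c = 0) := by
  have e0 : ∀ P : ZMod 2 → Prop, (∀ a, P a) ↔ P 0 ∧ P 1 := by
    intro P; constructor
    · intro h; exact ⟨h 0, h 1⟩
    · rintro ⟨h0, h1⟩ a
      rcases eq_or_ne a 0 with rfl | h
      · exact h0
      · rw [zm2 a h]; exact h1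
  have e1 : ∀ P : ZMod 2 → Prop, (∃ a, P a) ↔ P 0 ∨ P 1 := by
    intro P; constructor
    · rintro ⟨a, h⟩
      rcases eq_or_ne a 0 with rfl | h'
      · exact Or.inl h
      · rw [zm2 a h'] at h; exact Or.inr h
    · rintro (h | h)
      exacts [⟨_, h⟩, ⟨_, h⟩]
  have two : (1 : ZMod 2) + 1 = 0 := by decide
  have f1 := ha 0 0 1 0 1 0
  have f2 := ha 0 0 1 0 1 1
  have f3 := ha 0 0 1 1 0 1
  have f4 := ha 0 0 1 1 1 0
  have f5 := ha 0 0 1 1 1 1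
  have f6 := ha 0 1 0 0 1 1
  have f7 := ha 0 1 0 1 0 1
  have f8 := ha 0 1 0 1 1 0
  have f9 := ha 0 1 0 1 1 1
  have g1 := ha 0 1 1 1 0 1
  have g2 := ha 0 1 1 1 1 0
  have g3 := ha 0 1 1 1 1 1
  have g4 := ha 1 0 1 1 1 0
  have g5 := ha 1 0 1 1 1 1
  have g6 := ha 1 1 0 1 1 1
  simp only [two, add_zero, zero_add] at f1 f2 f3 f4 f5 f6 f7 f8 f9 g1 g2 g3 g4 g5 g6
  have ne : ¬ (1 : ZMod 2) = 0 := by decide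
  simp only [e0, e1, two, ne, add_zero, zero_add, imp_true_iff, true_and, and_true, imp_false] at h1 ⊢
  clear ha e0 e1
  by_cases a1 : S 0 0 1 <;> by_cases a2 : S 0 1 1 <;> by_cases a3 : S 1 0 1 <;> by_cases a4 : S 1 1 1 <;>
  by_cases a5 : S 0 1 0 <;> by_cases a6 : S 1 1 0 <;> simp_all
lemma el_coeff (i : Fin 4) (w : V3) (h : ∀ a b c : ZMod 2, (w 0).coeff 0 = a → (w 1).coeff 0 = b → (w 2).coeff 0 = c →
   (![a + b, a, a + b + c, a + c] : Fin 4 → ZMod 2) i = 0) : (el i w).coeff 0 = 0 := by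
  have := h _ _ _ rfl rfl rfl
  fin_cases i <;> simpa [el] using this
lemma G2a {L : Lt} (h1 : Bk 1 ≤ L) (h2 : L ≤ Bk 0) (h3 : e0 ∉ L) (h4 : ∃ u ∈ L, (u 2).coeff 0 ≠ 0) :
    ∃ i, Q i ∈ L ∧ ∀ w ∈ L, (el i w).coeff 0 = 0 := by
  have key := G2fin (S := fun a b c => (![C a, C b, C c] : V3) ∈ L) ?_ ?_ ?_
  · have hr : ∀ w ∈ L, (![C ((w 0).coeff 0), C ((w 1).coeff 0), C ((w 2).coeff 0)] : V3) ∈ L :=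
      fun w hw => (res_iff h1 (h2 hw)).1 hw
    rcases key with ⟨k1, k2⟩ | ⟨k1, k2⟩ | ⟨k1, k2⟩ | ⟨k1, k2⟩
    · refine ⟨0, by simpa [Q] using k1, fun w hw => el_coeff 0 w ?_⟩
      rintro a b c rfl rfl rfl; exact k2 _ _ _ (hr w hw)
    · refine ⟨1, by simpa [Q] using k1, fun w hw => el_coeff 1 w ?_⟩
      rintro a b c rfl rfl rfl; exact k2 _ _ _ (hr w hw)
    · refine ⟨2, by simpa [Q] using k1, fun w hw => el_coeff 2 w ?_⟩
      rintro a b c rfl rfl rfl; exact k2 _ _ _ (hr w hw)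
    · refine ⟨3, by simpa [Q] using k1, fun w hw => el_coeff 3 w ?_⟩
      rintro a b c rfl rfl rfl; exact k2 _ _ _ (hr w hw)
  · intro a b c a' b' c' h h'
    have := add_mem h h'
    rw [add3, ← map_add, ← map_add, ← map_add] at this
    exact this
  · intro h
    apply h3
    have : (![C 1, C 0, C 0] : V3) = e0 := by simp [e0]
    rw [← this]; exact h
  · obtain ⟨u, hu, hc⟩ := h4
    refine ⟨(u 0).coeff 0, (u 1).coeff 0, ?_⟩
    rw [← zm2 _ hc]
    exact (res_iff h1 (h2 hu)).1 hu
def Dat (g : M3) (m : ℤ) (w l : V3) : Prop := g.val *ᵥ e0 = (T m : R2) • w ∧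
  ∀ u, (g⁻¹.val *ᵥ u) 2 = T (-m - 1) * (l 0 * u 0 + l 1 * u 1 + l 2 * u 2)
lemma Dat_Y : Dat gY 1 ![1,1+tt,1+tt] ![1+tt,1,0] := by
  have t := tt_ti
  constructor
  · rw [e0, gY_val, mv3, sm3, ← show tt = T 1 from rfl]
    refine funext fun i => ?_
    fin_cases i <;> simp [mY] <;> grind
  · intro u
    rw [vec3 u, gYinv_val, mv3]
    have : (T (-1-1) : R2) = ti * ti := by rw [ti, ← T_add]; rfl
    rw [this]
    simp [mYi]
    grind
lemma Dat_X {g : M3} {m : ℤ} {a b c d e f : R2} (h : Dat g m ![a,b,c] ![d,e,f]) :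
    Dat (gX * g) (m+1) ![a+b,b+c,c] ![d,d+e,d+e+f] := by
  have t := tt_ti
  constructor
  · have := congrArg (gX.val *ᵥ ·) h.1
    simp only [Matrix.mulVec_mulVec, ← Units.val_mul] at this
    rw [this, gX_val, sm3, mv3, sm3, T_add, ← show tt = T 1 from rfl]
    refine funext fun i => ?_
    fin_cases i <;> simp [mX] <;> grind
  · intro u
    have := h.2 (gX⁻¹.val *ᵥ u)
    rw [Matrix.mulVec_mulVec, ← Units.val_mul, ← _root_.mul_inv_rev] at this
    rw [this, vec3 u, gXinv_val, mv3]
    rw [show -(m+1) - 1 = (-m-1) + (-1) by ring, T_add, ← show ti = T (-1) from rfl]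
    simp [mXi]
    grind
lemma Dat_i (i : Fin 4) : Dat (gX ^ (i : ℕ) * gY) (i + 1) (Q i + tt • (![![0,1,1],![1,0,1],![1,1,1],![0,0,1]] : Fin 4 → V3) i)
   ((![![1,1,0],![1,0,0],![1,1,1],![1,0,1]] : Fin 4 → V3) i + tt • (![![1,0,0],![1,1,1],![1,0,1],![1,1,0]] : Fin 4 → V3) i) := by
  have two : (1 : R2) + 1 = 0 := CharTwo.add_self_eq_zero 1
  have d0 := Dat_Y
  have d1 := Dat_X d0
  have d2 := Dat_X d1
  have d3 := Dat_X d2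
  fin_cases i
  · simp [Q] 
    convert d0 using 2
  · simp [Q] 
    convert d1 using 2 <;> first | grind | (refine funext fun i => ?_; fin_cases i <;> simp <;> grind)
  · simp [Q, pow_succ, mul_assoc] 
    convert d2 using 2 <;> first | grind | (refine funext fun i => ?_; fin_cases i <;> simp <;> grind)
  · simp [Q, pow_succ, mul_assoc] 
    convert d3 using 2 <;> first | grind | (refine funext fun i => ?_; fin_cases i <;> simp <;> grind)
section rep
variable {G : Type*} [Group G] {x y : G} {π : G →* M3}
lemma lam_eq (i : Fin 4) (w : V3) : ∀ l : V3, l = ((![![1,1,0],![1,0,0],![1,1,1],![1,0,1]] : Fin 4 → V3) i + tt • (![![1,0,0],![1,1,1],![1,0,1],![1,1,0]] : Fin 4 → V3) i) →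
    l 0 * w 0 + l 1 * w 1 + l 2 * w 2 = el i w + tt * mu i w := by
  rintro l rfl
  fin_cases i <;> simp [el, mu] <;> ring
lemma mu_mem (i : Fin 4) {w : V3} (hw : w ∈ Bk 0) : mu i w ∈ O 0 := by
  fin_cases i
  · exact hw 0
  · exact add_mem (add_mem (hw 0) (hw 1)) (hw 2)
  · exact add_mem (hw 0) (hw 2)
  · exact add_mem (hw 0) (hw 1)
lemma el_mem (i : Fin 4) {w : V3} (hw : w ∈ Bk 0) : el i w ∈ O 0 := by
  fin_cases i
  · exact add_mem (hw 0) (hw 1)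
  · exact hw 0
  · exact add_mem (add_mem (hw 0) (hw 1)) (hw 2)
  · exact add_mem (hw 0) (hw 2)
lemma G2b (h : Rp x y π) {L : Lt} (h1 : Bk 1 ≤ L) (h2 : L ≤ Bk 0) {i : Fin 4} (h3 : Q i ∈ L) 
    (h4 : ∀ w ∈ L, (el i w).coeff 0 = 0) : Hor π (x ^ (i:ℕ) * y) L := by
  obtain ⟨d1, d2⟩ := Dat_i i
  unfold Hor
  rw [map_mul, map_pow, h.hx, h.hy]
  generalize gX ^ (i:ℕ) * gY = g at *
  refine ⟨-(i+1), ?_, ?_⟩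
  · rw [mem_act', Matrix.mulVec_smul, d1, smul_smul, ← T_add, neg_add_cancel, T_zero, one_smul]
    refine add_mem h3 (h1 ?_)
    rw [show tt = T 1 from rfl]
    intro j
    rw [Pi.smul_apply, smul_eq_mul, T_mul_mem]
    fin_cases i <;> fin_cases j <;> simp [zero_mem, one_mem_O]
  · intro u hu
    rw [mem_act'] at hu
    have e := d2 (g.val *ᵥ u)
    rw [inv_val_mv, lam_eq i _ _ rfl] at e
    rw [e, T_mul_mem]
    refine O_mono (k := 1) (by omega) (add_mem (T_mem_iff1.2 ⟨el_mem i (h2 hu), h4 _ hu⟩) ?_)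
    rw [show tt = T 1 from rfl, T_mul_mem]
    exact mu_mem i (h2 hu)
lemma Q_el (i : Fin 4) : (el i (Q (i+2))).coeff 0 ≠ 0 := by
  have two : (1 : R2) + 1 = 0 := CharTwo.add_self_eq_zero 1
  have o : (1 : R2).coeff 0 = 1 := by
    have := coeff_C0 1
    simpa using this
  fin_cases i <;> simp [el, Q, two] <;> (try simp [o]) <;> decide
lemma G2' (h : Rp x y π) {L : Lt} (hA : Adj (Bk 0) L) (hn : ¬ InH L) :
    ∃ (k : ℤ) (i : Fin 4), Hor π (x ^ (i:ℕ) * y) L ∧ Bk 1 ≤ sc k L ∧ sc k L ≤ Bk 0 ∧ Q i ∈ sc k L ∧ Q (i+2) ∉ sc k L := by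
  obtain ⟨k, a1, a2⟩ := hA
  have a3 : Bk 1 ≤ sc k L := by rwa [sc_Bk, add_zero] at a1
  have hn' : ¬ InH (sc k L) := by rwa [InH_sc_iff]
  have e0m : e0 ∈ Bk 0 := by
    intro j; fin_cases j <;> simp [e0, zero_mem, one_mem_O]
  obtain ⟨b1, b2⟩ := offnorm e0m (fun u hu => hu 2) a1 a2 hn'
  obtain ⟨i, c1, c2⟩ := G2a a3 a2 b1 b2
  exact ⟨k, i, (Hor_sc k).1 (G2b h a3 a2 c1 c2), a3, a2, c1, fun hq => Q_el i (c2 _ hq)⟩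
end rep
end

/-! Part 11 -/

noncomputable section

def Tri3 (L : Lt) (i j k : ℤ) : Prop := (∀ l, ![l,0,0] ∈ L ↔ l ∈ O i) ∧ (∀ m, (∃ l, ![l,m,0] ∈ L) ↔ m ∈ O j) ∧
  (∀ n, (∃ l m, ![l,m,n] ∈ L) ↔ n ∈ O k)
lemma Tri3_sc {L : Lt} {i j k : ℤ} (e : ℤ) (h : Tri3 L i j k) : Tri3 (sc e L) (e+i) (e+j) (e+k) := by
  obtain ⟨h1, h2, h3⟩ := h
  have hm : ∀ l m n, ![l,m,n] ∈ sc e L ↔ ![T (-e) * l, T (-e) * m, T (-e) * n] ∈ L := by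
    intro l m n; rw [mem_sc, sm3]
  refine ⟨?_, ?_, ?_⟩
  · intro l
    rw [hm, mul_zero, h1, T_mul_mem]
    rw [show i - -e = e + i by ring]
  · intro m
    rw [show e + j = j - -e by ring, ← T_mul_mem, ← h2]
    constructor
    · rintro ⟨l, hl⟩
      rw [hm, mul_zero] at hl
      exact ⟨_, hl⟩
    · rintro ⟨l, hl⟩
      refine ⟨T e * l, ?_⟩
      rw [hm, mul_zero, ← mul_assoc, ← T_add, neg_add_cancel, T_zero, one_mul]; exact hl
  · intro n
    rw [show e + k = k - -e by ring, ← T_mul_mem, ← h3]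
    constructor
    · rintro ⟨l, m, hl⟩
      rw [hm] at hl
      exact ⟨_, _, hl⟩
    · rintro ⟨l, m, hl⟩
      refine ⟨T e * l, T e * m, ?_⟩
      rw [hm, ← mul_assoc, ← mul_assoc, ← T_add, neg_add_cancel, T_zero, one_mul, one_mul]; exact hl
lemma Tri3_act {L : Lt} {i j k a d : ℤ} {g : M3} (hg : IsTriG g a d) (h : Tri3 L i j k) :
    Tri3 (act g L) (a+i) (d+j) (a+k) := by
  obtain ⟨h1, h2, h3⟩ := h
  have hm : ∀ l m n, ![l,m,n] ∈ act g L ↔ ![T (-a) * l + g⁻¹.val 0 1 * m + g⁻¹.val 0 2 * n, T (-d) * m + g⁻¹.val 1 2 * n, T (-a) * n] ∈ L := by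
    intro l m n; rw [mem_act, tri_mv hg.2]
  generalize g⁻¹.val 0 1 = A at hm
  generalize g⁻¹.val 0 2 = B at hm
  generalize g⁻¹.val 1 2 = D at hm
  have hT : ∀ (b : ℤ) (p : R2), T (-b) * (T b * p) = p := by
    intro b p; rw [← mul_assoc, ← T_add, neg_add_cancel, T_zero, one_mul]
  refine ⟨?_, ?_, ?_⟩
  · intro l
    rw [hm]; simp only [mul_zero, add_zero]
    rw [h1, T_mul_mem]
    rw [show i - -a = a + i by ring]
  · intro m
    rw [show d + j = j - -d by ring, ← T_mul_mem, ← h2]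
    constructor
    · rintro ⟨l, hl⟩
      rw [hm] at hl; simp only [mul_zero, add_zero] at hl
      exact ⟨_, hl⟩
    · rintro ⟨l, hl⟩
      refine ⟨T a * (l - A * m), ?_⟩
      rw [hm]; simp only [mul_zero, add_zero]
      rw [hT, sub_add_cancel]; exact hl
  · intro n
    rw [show a + k = k - -a by ring, ← T_mul_mem, ← h3]
    constructor
    · rintro ⟨l, m, hl⟩
      rw [hm] at hl
      exact ⟨_, _, hl⟩
    · rintro ⟨l, m, hl⟩
      refine ⟨T a * (l - B * n - A * (T d * (m - D * n))), T d * (m - D * n), ?_⟩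
      rw [hm, hT, hT, sub_add_cancel, sub_add_cancel, sub_add_cancel]; exact hl
def I1 (L : Lt) : AddSubgroup R2 where
  carrier := {l | (![l,0,0] : V3) ∈ L}
  zero_mem' := by
    have : (![0,0,0] : V3) = 0 := by refine funext fun i => ?_; fin_cases i <;> rfl
    show ![0,0,0] ∈ L
    rw [this]; exact zero_mem _
  add_mem' := by
    intro a b ha hb
    have := add_mem (S := Lt) ha hb
    rw [add3, add_zero] at this; exact this
  neg_mem' := by
    intro a ha
    have := neg_mem (S := Lt) ha
    show ![-a,0,0] ∈ L
    simpa using this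
def I2 (L : Lt) : AddSubgroup R2 where
  carrier := {m | ∃ l, (![l,m,0] : V3) ∈ L}
  zero_mem' := ⟨0, (I1 L).zero_mem⟩
  add_mem' := by
    rintro a b ⟨l, ha⟩ ⟨l', hb⟩
    have := add_mem ha hb
    rw [add3, add_zero] at this; exact ⟨_, this⟩
  neg_mem' := by
    rintro a ⟨l, ha⟩
    have := neg_mem ha
    refine ⟨-l, ?_⟩
    simpa using this
def I3 (L : Lt) : AddSubgroup R2 where
  carrier := {n | ∃ l m, (![l,m,n] : V3) ∈ L}
  zero_mem' := ⟨0, 0, (I1 L).zero_mem⟩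
  add_mem' := by
    rintro a b ⟨l, m, ha⟩ ⟨l', m', hb⟩
    have := add_mem ha hb
    rw [add3] at this; exact ⟨_, _, this⟩
  neg_mem' := by
    rintro a ⟨l, m, ha⟩
    have := neg_mem ha
    refine ⟨-l, -m, ?_⟩
    simpa using this
lemma mem_Bk3 {k : ℤ} {l m n : R2} : (![l,m,n] : V3) ∈ Bk k ↔ l ∈ O k ∧ m ∈ O k ∧ n ∈ O k := by
  rw [mem_Bk]
  constructor
  · intro h; exact ⟨h 0, h 1, h 2⟩
  · rintro ⟨h0, h1, h2⟩ i
    fin_cases i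
    exacts [h0, h1, h2]
lemma Tri3_ex {L : Lt} (hL : IsLat L) (h1 : e0 ∈ L) (h2 : (T (-1) : R2) • e0 ∉ L) (h3 : ∀ u ∈ L, u 2 ∈ O 0)
    (h4 : ∃ u ∈ L, (u 2).coeff 0 ≠ 0) : ∃ j, Tri3 L 0 j 0 := by
  obtain ⟨n, hn⟩ := hL.lo
  obtain ⟨m, hm⟩ := hL.up
  obtain ⟨j1, hj1⟩ := by
    refine ideal_O (I := I1 L) (n := n) (m := m) ?_ ?_ ?_
    · intro p hp
      have := hL.tc _ (show ![p,0,0] ∈ L from hp)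
      rw [sm3, mul_zero] at this
      exact this
    · intro p hp
      exact hn (mem_Bk3.2 ⟨hp, zero_mem _, zero_mem _⟩)
    · intro p hp
      exact (mem_Bk3.1 (hm hp)).1
  obtain ⟨j2, hj2⟩ := by
    refine ideal_O (I := I2 L) (n := n) (m := m) ?_ ?_ ?_
    · rintro p ⟨l, hp⟩
      have := hL.tc _ hp
      rw [sm3, mul_zero] at this
      exact ⟨_, this⟩
    · intro p hp
      exact ⟨0, hn (mem_Bk3.2 ⟨zero_mem _, hp, zero_mem _⟩)⟩
    · rintro p ⟨l, hp⟩
      exact (mem_Bk3.1 (hm hp)).2.1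
  obtain ⟨j3, hj3⟩ := by
    refine ideal_O (I := I3 L) (n := n) (m := m) ?_ ?_ ?_
    · rintro p ⟨l, m', hp⟩
      have := hL.tc _ hp
      rw [sm3] at this
      exact ⟨_, _, this⟩
    · intro p hp
      exact ⟨0, 0, hn (mem_Bk3.2 ⟨zero_mem _, zero_mem _, hp⟩)⟩
    · rintro p ⟨l, m', hp⟩
      exact (mem_Bk3.1 (hm hp)).2.2
  refine ⟨j2, ?_, hj2, ?_⟩
  · have e : j1 = 0 := by
      have a1 : (T 0 : R2) ∈ O j1 := (hj1 _).1 (by rw [T_zero]; exact h1)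
      have a2 : (T (-1) : R2) ∉ O j1 := by
        rw [← hj1]; intro h; apply h2
        rw [e0, sm3, mul_one, mul_zero]; exact h
      rw [T_mem_O_iff] at a1 a2
      omega
    rw [← e]; exact hj1
  · have e : j3 = 0 := by
      obtain ⟨u, hu, hc⟩ := h4
      have a1 : u 2 ∈ O j3 := (hj3 _).1 ⟨u 0, u 1, by rw [← vec3]; exact hu⟩
      have a2 : ¬ 0 < j3 := fun h => hc (a1 0 h)
      obtain ⟨l, m', hw⟩ := (hj3 (T j3)).2 (T_mem_O le_rfl)
      have a3 : (T j3 : R2) ∈ O 0 := h3 _ hw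
      rw [T_mem_O_iff] at a3
      omega
    rw [← e]; exact hj3
section rep
variable {G : Type*} [Group G] {x y : G} {π : G →* M3}
lemma Um_mv (b c l m n : R2) : Um b c *ᵥ ![l,m,n] = ![l + bar b * m + c * n, m + b * n, n] := by
  rw [mv3]; simp [Um]
lemma G1core0 (h : Rp x y π) {L : Lt} (hL : IsLat L) (hT : Tri3 L 0 0 0) : ∃ p ∈ PP x y, ∃ e,
    sc e (act (π p)⁻¹ L) = Bk 0 := by
  obtain ⟨t1, t2, t3⟩ := hT
  obtain ⟨α, hα⟩ := (t2 1).2 (one_mem_O le_rfl)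
  obtain ⟨γ0, β0, hγ⟩ := (t3 1).2 (one_mem_O le_rfl)
  obtain ⟨β, b1, b2⟩ := twopart β0 α
  obtain ⟨γ, ⟨p, hp, e, hU⟩, g2⟩ := Rz_bc h β (γ0 + (β - β0) * α)
  refine ⟨p, hp, e, ?_⟩
  have hmem : ∀ w, w ∈ sc e (act (π p)⁻¹ L) ↔ Um β γ *ᵥ w ∈ L := by
    intro w
    rw [mem_sc, mem_act', show (π p).val = _ from hU, Matrix.smul_mulVec, Matrix.mulVec_smul, smul_smul, ← T_add,
      add_neg_cancel, T_zero, one_smul]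
  have m0 : Um β γ *ᵥ ![1,0,0] ∈ L := by
    rw [Um_mv]; simp only [mul_zero, add_zero]
    exact (t1 1).2 (one_mem_O le_rfl)
  have m1 : Um β γ *ᵥ ![0,1,0] ∈ L := by
    rw [Um_mv]; simp only [mul_zero, add_zero, zero_add, mul_one]
    have := add_mem hα ((t1 _).2 b2)
    rw [add3] at this
    simpa using this
  have m2 : Um β γ *ᵥ ![0,0,1] ∈ L := by
    rw [Um_mv]; simp only [mul_zero, add_zero, zero_add, mul_one]
    have := add_mem hγ (add_mem (hL.op b1 hα) ((t1 _).2 g2))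
    rw [sm3, add3, add3] at this
    convert this using 2
    · ring
    · refine funext fun i => ?_
      fin_cases i <;> simp
  ext w
  rw [hmem]
  have hw : w = w 0 • ![1,0,0] + w 1 • ![0,1,0] + w 2 • ![0,0,1] := by
    refine funext fun i => ?_
    fin_cases i <;> simp
  constructor
  · intro hm
    have c2 : w 2 ∈ O 0 := by
      rw [← t3]
      rw [vec3 w, Um_mv] at hm
      exact ⟨_, _, hm⟩
    have hm1 : Um β γ *ᵥ ![w 0, w 1, 0] ∈ L := by
      have := sub_mem hm (hL.op c2 m2)
      rw [← Matrix.mulVec_smul, ← Matrix.mulVec_sub] at this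
      have e : w - w 2 • ![0,0,1] = ![w 0, w 1, 0] := by
        refine funext fun i => ?_
        fin_cases i <;> simp
      rw [e] at this; exact this
    have c1 : w 1 ∈ O 0 := by
      rw [← t2]
      rw [Um_mv, mul_zero, mul_zero, add_zero, add_zero] at hm1
      exact ⟨_, hm1⟩
    have hm0 : Um β γ *ᵥ ![w 0, 0, 0] ∈ L := by
      have := sub_mem hm1 (hL.op c1 m1)
      rw [← Matrix.mulVec_smul, ← Matrix.mulVec_sub] at this
      have e : ![w 0, w 1, 0] - w 1 • ![0,1,0] = ![w 0, 0, 0] := by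
        refine funext fun i => ?_
        fin_cases i <;> simp
      rw [e] at this; exact this
    have c0 : w 0 ∈ O 0 := by
      rw [← t1]
      rw [Um_mv] at hm0
      simpa using hm0
    rw [vec3 w, mem_Bk3]; exact ⟨c0, c1, c2⟩
  · intro hm
    rw [hw, Matrix.mulVec_add, Matrix.mulVec_add, Matrix.mulVec_smul, Matrix.mulVec_smul, Matrix.mulVec_smul]
    exact add_mem (add_mem (hL.op (hm 0) m0) (hL.op (hm 1) m1)) (hL.op (hm 2) m2)
lemma G1core (h : Rp x y π) {L : Lt} (hL : IsLat L) {j : ℤ} (hT : Tri3 L 0 j 0) : ∃ p ∈ PP x y, ∃ e,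
    sc e (act (π p)⁻¹ L) = Bk 0 := by
  have ht := IsTriG_zpow (ta_Tri h) j
  have h1 := Tri3_sc (-(5*j)) (Tri3_act ht hT)
  rw [show -(5*j) + (j * 5 + 0) = 0 by ring, show -(5*j) + (j*4+j) = 0 by ring] at h1
  obtain ⟨p, hp, e, he⟩ := G1core0 h (IsLat_sc (IsLat_act hL _) _) h1
  refine ⟨(ta x y ^ j)⁻¹ * p, mul_mem (inv_mem (zpow_mem (mul_mem (z_mem_PP x y) (x_mem_PP x y)) j)) hp, e - 5*j, ?_⟩
  rw [← sc_act, sc_sc] at he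
  rw [map_mul, map_inv, map_zpow, _root_.mul_inv_rev, inv_inv, act_mul, ← he]
  rfl
lemma G1 (h : Rp x y π) {L L' : Lt} (hL : IsLat L) (hi : InH L) (hA : Adj L L') (hn : ¬ InH L') :
    ∃ p ∈ PP x y, ∃ e, sc e (act (π p)⁻¹ L) = Bk 0 := by
  obtain ⟨d, d1, d2⟩ := hi
  have hA' : Adj (sc (-d) L) L' := Adj_sc_left _ hA
  have f1 : e0 ∈ sc (-d) L := by rw [mem_sc, neg_neg]; exact d1
  have f2 : ∀ u ∈ sc (-d) L, u 2 ∈ O 0 := by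
    intro u hu
    have := d2 _ (mem_sc.1 hu)
    rw [neg_neg, Pi.smul_apply, smul_eq_mul, T_mul_mem, sub_self] at this
    exact this
  obtain ⟨k, a1, a2⟩ := hA'
  obtain ⟨b1, u, hu, hc⟩ := offnorm f1 f2 a1 a2 (by rwa [InH_sc_iff])
  obtain ⟨j, hj⟩ := Tri3_ex (IsLat_sc hL (-d)) f1 (fun hh => b1 (a1 (mem_sc.2 hh))) f2 ⟨u, a2 hu, hc⟩
  obtain ⟨p, hp, e, he⟩ := G1core h (IsLat_sc hL (-d)) hj
  refine ⟨p, hp, e - d, ?_⟩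
  rw [← sc_act, sc_sc] at he
  exact he
end rep
end

/-! Part 12 -/

noncomputable section

section rep
variable {G : Type*} [Group G] {x y : G} {π : G →* M3}
def Dc (x y k : G) : Prop := k ∈ PP x y ∨ ∃ p ∈ PP x y, ∃ q ∈ PP x y, k = p * y * q
lemma Dc_l {p k : G} (hp : p ∈ PP x y) (h : Dc x y k) : Dc x y (p * k) := by
  rcases h with h | ⟨p', hp', q, hq, rfl⟩
  · exact Or.inl (mul_mem hp h)
  · exact Or.inr ⟨p * p', mul_mem hp hp', q, hq, by group⟩
lemma Dc_r {p k : G} (hp : p ∈ PP x y) (h : Dc x y k) : Dc x y (k * p) := by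
  rcases h with h | ⟨p', hp', q, hq, rfl⟩
  · exact Or.inl (mul_mem h hp)
  · exact Or.inr ⟨p', hp', q * p, mul_mem hq hp, by group⟩
lemma Dc_inv {k : G} (h : Dc x y k) : Dc x y k⁻¹ := by
  rcases h with h | ⟨p', hp', q, hq, rfl⟩
  · exact Or.inl (inv_mem h)
  · exact Or.inr ⟨q⁻¹ * x, mul_mem (inv_mem hq) (x_mem_PP x y), (y*x*y)⁻¹ * p'⁻¹, 
      mul_mem (inv_mem (z_mem_PP x y)) (inv_mem hp'), by group⟩
lemma Dc_y : Dc x y y := Or.inr ⟨1, one_mem _, 1, one_mem _, by group⟩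
lemma Dc_one : Dc x y 1 := Or.inl (one_mem _)
lemma Dc_y1 (h : Hyp x y) : Dc x y (y⁻¹ * x * y) := by
  have e : y⁻¹ * x * y = y * ((x^4)⁻¹ * (y * x * y)) := by
    rw [h.x4]; simp only [pow_succ, pow_zero, one_mul]; group
  rw [e]
  exact Dc_r (mul_mem (inv_mem (pow_mem (x_mem_PP x y) 4)) (z_mem_PP x y)) Dc_y
lemma Dc_y3 (h : Hyp x y) : Dc x y (y⁻¹ * x ^ 3 * y) := by
  have e : y⁻¹ * x ^ 3 * y = x ^ 4 * (y⁻¹ * x * y)⁻¹ * (y⁻¹ * x ^ 4 * y) * (x^4)⁻¹ * ((x^4)⁻¹ * (x ^ 4)) := by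
    have c := h.central y⁻¹
    have c2 := h.central (y⁻¹ * x⁻¹ * y)
    have : y⁻¹ * x ^ 4 * y = x ^ 4 := by rw [← c]; group
    rw [this]
    have e2 : (y⁻¹ * x * y)⁻¹ = y⁻¹ * x⁻¹ * y := by group
    rw [e2]
    have e3 : x ^ 3 = x ^ 4 * x⁻¹ := by group
    rw [e3, ← mul_assoc, ← c]
    group
  rw [e]
  have c := h.central y⁻¹
  have : y⁻¹ * x ^ 4 * y = x ^ 4 := by rw [← c]; group
  have m := pow_mem (x_mem_PP x y) 4
  rw [this]
  exact Dc_r (mul_mem (inv_mem m) m) (Dc_r (inv_mem m) (Dc_r m (Dc_l m (Dc_inv (Dc_y1 h)))))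
lemma Dc_ij (h : Hyp x y) (i j : Fin 4) (hij : j ≠ i + 2) : Dc x y (y⁻¹ * ((x ^ (i:ℕ))⁻¹ * x ^ (j:ℕ)) * y) := by
  have e : ∀ n : ℤ, (j : ℤ) - i = n → (x ^ (i:ℕ))⁻¹ * x ^ (j:ℕ) = x ^ n := by
    rintro n rfl
    rw [sub_eq_neg_add, _root_.zpow_add, _root_.zpow_neg, zpow_natCast, zpow_natCast]
  have hn : ∀ i j : Fin 4, j ≠ i + 2 → ((j : ℕ) : ℤ) - ((i : ℕ) : ℤ) = 0 ∨ ((j : ℕ) : ℤ) - ((i : ℕ) : ℤ) = 1 ∨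
     ((j : ℕ) : ℤ) - ((i : ℕ) : ℤ) = -1 ∨ ((j : ℕ) : ℤ) - ((i : ℕ) : ℤ) = 3 ∨ ((j : ℕ) : ℤ) - ((i : ℕ) : ℤ) = -3 := by decide
  rcases hn i j hij with h1 | h1 | h1 | h1 | h1 <;> rw [e _ h1]
  · have : y⁻¹ * x ^ (0:ℤ) * y = 1 := by group
    rw [this]; exact Dc_one
  · have : y⁻¹ * x ^ (1:ℤ) * y = y⁻¹ * x * y := by group
    rw [this]; exact Dc_y1 h
  · have : y⁻¹ * x ^ (-1:ℤ) * y = (y⁻¹ * x * y)⁻¹ := by group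
    rw [this]; exact Dc_inv (Dc_y1 h)
  · have : y⁻¹ * x ^ (3:ℤ) * y = y⁻¹ * x ^ 3 * y := by group
    rw [this]; exact Dc_y3 h
  · have : y⁻¹ * x ^ (-3:ℤ) * y = (y⁻¹ * x ^ 3 * y)⁻¹ := by group
    rw [this]; exact Dc_inv (Dc_y3 h)
lemma Dis (h : Rp x y π) {g k : G} {L : Lt} (h1 : Hor π g L) (h2 : Hor π k L) (hd : Dc x y (g⁻¹ * k)) : g⁻¹ * k ∈ PP x y := by
  rcases hd with hd | ⟨p, hp, q, hq, e⟩
  · exact hd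
  · exfalso
    have := Dis1 h h1 h2
    rw [e] at this
    exact y_20 h (P_20 h hp hq this)
lemma Loc (h : Rp x y π) {L L' : Lt} (hA : Adj L L') (hn : ¬ InH L') {p : G} (hp : p ∈ PP x y)
    {e : ℤ} (he : sc e (act (π p)⁻¹ L) = Bk 0) : ∃ (k : ℤ) (i : Fin 4), Hor π (p * x ^ (i:ℕ) * y) L' ∧
      Q i ∈ sc k (act (π p)⁻¹ L') ∧ Q (i+2) ∉ sc k (act (π p)⁻¹ L') := by
  have hA' : Adj (Bk 0) (act (π p)⁻¹ L') := by
    rw [← he]; exact Adj_sc_left _ (Adj_act _ hA)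
  have hn' : ¬ InH (act (π p)⁻¹ L') := by
    intro hi
    apply hn
    have := Hor_P h (g := p) (inv_mem hp) hi
    rw [mul_inv_cancel] at this
    exact Hor_one.1 this
  obtain ⟨k, i, a1, a2, a3, a4, a5⟩ := G2' h hA' hn'
  refine ⟨k, i, ?_, a4, a5⟩
  rw [mul_assoc]
  exact Hor_mul.2 a1
lemma Ex0 (h : Rp x y π) {L L' : Lt} (hL : IsLat L) (hi : InH L) (hA : Adj L L') :
    ∃ k, Hor π k L' ∧ Dc x y k := by
  by_cases hn : InH L'
  · exact ⟨1, Hor_one.2 hn, Dc_one⟩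
  · obtain ⟨p, hp, e, he⟩ := G1 h hL hi hA hn
    obtain ⟨k, i, a1, -, -⟩ := Loc h hA hn hp he
    exact ⟨_, a1, Dc_l (mul_mem hp (pow_mem (x_mem_PP x y) _)) Dc_y⟩
lemma Ex (h : Rp x y π) {g : G} {L L' : Lt} (hL : IsLat L) (hi : Hor π g L) (hA : Adj L L') :
    ∃ g', Hor π g' L' ∧ Dc x y (g⁻¹ * g') := by
  obtain ⟨k, k1, k2⟩ := Ex0 h (IsLat_act hL _) hi (Adj_act (π g)⁻¹ hA)
  refine ⟨g * k, Hor_mul.2 k1, ?_⟩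
  rwa [inv_mul_cancel_left]
lemma opp {M1 M2 : Lt} (hL1 : IsLat M1) (hL2 : IsLat M2) (hA : Adj M1 M2) {i j : Fin 4} (h1 : Q i ∈ M1) (h1' : Q (i+2) ∉ M1)
    (h2 : Q j ∈ M2) (h2' : Q (j+2) ∉ M2) : j ≠ i + 2 := by
  rintro rfl
  obtain ⟨k, a1, a2⟩ := hA
  rcases le_or_gt 1 k with hk | hk
  · have := sc_mono (-1) (a1.trans (hL2.sc_le hk))
    rw [sc_sc, sc_sc, neg_add_cancel, sc_zero, sc_zero] at this
    apply h2'
    have e : ∀ i : Fin 4, i + 2 + 2 = i := by decide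
    rw [e]; exact this h1
  · have := hL2.sc_le (show k ≤ 0 by omega)
    rw [sc_zero] at this
    exact h1' (a2 (this h2))
lemma Tri0 (h : Rp x y π) {L0 L1 L2 : Lt} (h0 : IsLat L0) (h1 : IsLat L1) (h2 : IsLat L2) (hi : InH L0) {g1 g2 : G}
    (hg1 : Hor π g1 L1) (hg2 : Hor π g2 L2) (a1 : Adj L0 L1) (a2 : Adj L0 L2) (a3 : Adj L1 L2) (d1 : Dc x y g1) (d2 : Dc x y g2) :
    Dc x y (g1⁻¹ * g2) := by
  by_cases m1 : g1 ∈ PP x y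
  · exact Dc_l (inv_mem m1) d2
  by_cases m2 : g2 ∈ PP x y
  · exact Dc_r m2 (Dc_inv d1)
  have n1 : ¬ InH L1 := by
    intro hh
    have := Dis h (Hor_one.2 hh) hg1 (by simpa using d1)
    exact m1 (by simpa using this)
  have n2 : ¬ InH L2 := by
    intro hh
    have := Dis h (Hor_one.2 hh) hg2 (by simpa using d2)
    exact m2 (by simpa using this)
  obtain ⟨p1, hp1, q1, hq1, rfl⟩ := d1.resolve_left m1
  obtain ⟨p2, hp2, q2, hq2, rfl⟩ := d2.resolve_left m2
  obtain ⟨p, hp, e, he⟩ := G1 h h0 hi a1 n1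
  obtain ⟨k1, i1, b1, b2, b3⟩ := Loc h a1 n1 hp he
  obtain ⟨k2, i2, c1, c2, c3⟩ := Loc h a2 n2 hp he
  have hne := opp (IsLat_sc (IsLat_act h1 _) k1) (IsLat_sc (IsLat_act h2 _) k2)
    (Adj_sc_left _ (Adj_sc_right _ (Adj_act (π p)⁻¹ a3))) b2 b3 c2 c3
  have r1 := Coset h (mul_mem hp (pow_mem (x_mem_PP x y) i1)) (one_mem _) hp1 hq1 (by rw [mul_one]; exact b1) hg1
  have r2 := Coset h (mul_mem hp (pow_mem (x_mem_PP x y) i2)) (one_mem _) hp2 hq2 (by rw [mul_one]; exact c1) hg2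
  have := Dc_l (inv_mem r1) (Dc_r r2 (Dc_ij h.toHyp i1 i2 hne))
  generalize x ^ (i1:ℕ) = u at *
  generalize x ^ (i2:ℕ) = v at *
  convert this using 1
  group
lemma Tri (h : Rp x y π) {L0 L1 L2 : Lt} (h0 : IsLat L0) (h1 : IsLat L1) (h2 : IsLat L2) {g0 g1 g2 : G} (hg0 : Hor π g0 L0)
    (hg1 : Hor π g1 L1) (hg2 : Hor π g2 L2) (a1 : Adj L0 L1) (a2 : Adj L0 L2) (a3 : Adj L1 L2)
    (d1 : Dc x y (g0⁻¹ * g1)) (d2 : Dc x y (g0⁻¹ * g2)) :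
    Dc x y (g1⁻¹ * g2) := by
  have e : ∀ g, g = g0 * (g0⁻¹ * g) := fun g => by group
  rw [e g1] at hg1
  rw [e g2] at hg2
  have := Tri0 h (IsLat_act h0 (π g0)⁻¹) (IsLat_act h1 (π g0)⁻¹) (IsLat_act h2 (π g0)⁻¹) hg0 (Hor_mul.1 hg1) (Hor_mul.1 hg2)
    (Adj_act _ a1) (Adj_act _ a2) (Adj_act _ a3) d1 d2
  convert this using 1
  group
lemma Nb_symm {g k : G} (h : Dc x y (g⁻¹ * k)) : Dc x y (k⁻¹ * g) := by
  have := Dc_inv h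
  rwa [_root_.mul_inv_rev, inv_inv] at this
inductive Good (x y : G) (π : G →* M3) : G → Lt → Prop
  | base (g : G) (L : Lt) (hL : IsLat L) (hh : Hor π g L) (hg : g ∈ PP x y) (h0 : ht L = 0) : Good x y π g L
  | step (g : G) (L : Lt) (g' : G) (L' : Lt) (hG : Good x y π g L) (hL : IsLat L') (hh : Hor π g' L') (hA : Adj L L')
     (hN : Dc x y (g⁻¹ * g')) (hlt : ht L < ht L') : Good x y π g' L'
lemma Good.lat {g : G} {L : Lt} (h : Good x y π g L) : IsLat L := by
  cases h <;> assumption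
lemma Good.hor {g : G} {L : Lt} (h : Good x y π g L) : Hor π g L := by
  cases h <;> assumption
lemma GoodMain (h : Rp x y π) (n : ℕ) : ∀ (g : G) (L : Lt), Good x y π g L → ht L = n → ∀ (g' : G) (L' : Lt), IsLat L' → Hor π g' L' →
    Adj L L' → Dc x y (g⁻¹ * g') → ht L' ≤ n → Good x y π g' L' := by
  induction n using Nat.strong_induction_on with
  | _ n ih =>
  intro g L hG hn g' L' hL' hg' hA hN hle
  have move : ∀ (g : G) (L : Lt), Good x y π g L → ht L < n → ∀ (g' : G) (L' : Lt), IsLat L' → Hor π g' L' →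
    Adj L L' → Dc x y (g⁻¹ * g') → Good x y π g' L' := by
    intro g L hG hn g' L' hL' hg' hA hN
    rcases lt_or_ge (ht L) (ht L') with hlt | hge
    · exact Good.step g L g' L' hG hL' hg' hA hN hlt
    · exact ih _ hn g L hG rfl g' L' hL' hg' hA hN hge
  have hL := hG.lat
  have hg := hG.hor
  cases hG with
  | base _ _ _ _ hgP h0 =>
    have hn0 : ht L' = 0 := by omega
    obtain ⟨j, rfl⟩ := ht_zero hL h0
    obtain ⟨j', rfl⟩ := ht_zero hL' hn0
    have e : Bk j' = sc (j' - j) (Bk j) := by rw [sc_Bk, sub_add_cancel]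
    have hgl : Hor π g (Bk j') := by rw [e, Hor_sc]; exact hg
    have := Dis h hgl hg' hN
    refine Good.base _ _ hL' hg' ?_ hn0
    have := mul_mem hgP this
    rwa [mul_inv_cancel_left] at this
  | step g0 L0 _ _ hG0 _ _ hA0 hN0 hlt =>
    have hL0 := hG0.lat
    have hg0 := hG0.hor
    obtain ⟨V, W, lV, lW, aV, aW, hV, hW, c1, c2⟩ := cone hL (by omega)
    obtain ⟨gV, v1, v2⟩ := Ex h hL hg aV
    obtain ⟨gW, w1, w2⟩ := Ex h hL hg aW
    have b0 := c1 L0 hL0 (Adj_symm hA0) hlt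
    have GV : Good x y π gV V := move g0 L0 hG0 (by omega) gV V lV v1 (Adj_symm b0)
      (Tri h hL hL0 lV hg hg0 v1 (Adj_symm hA0) aV (Adj_symm b0) (Nb_symm hN0) v2)
    rcases c2 L' hL' hA (by omega) with c | c
    · exact move gV V GV (by omega) g' L' hL' hg' c (Tri h hL lV hL' hg v1 hg' aV hA c v2 hN)
    · have bw := c1 W lW aW hW
      have GW : Good x y π gW W := move gV V GV (by omega) gW W lW w1 bw
        (Tri h hL lV lW hg v1 w1 aV aW bw v2 w2)
      exact move gW W GW (by omega) g' L' hL' hg' c (Tri h hL lW hL' hg w1 hg' aW hA c w2 hN)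
lemma GoodMove (h : Rp x y π) {g g' : G} {L L' : Lt} (hG : Good x y π g L) (hL' : IsLat L') (hg' : Hor π g' L')
    (hA : Adj L L') (hN : Dc x y (g⁻¹ * g')) : Good x y π g' L' := by
  rcases lt_or_ge (ht L) (ht L') with hlt | hge
  · exact Good.step g L g' L' hG hL' hg' hA hN hlt
  · exact GoodMain h _ g L hG rfl g' L' hL' hg' hA hN hge
lemma tt_O {k : ℤ} (h : k ≤ 1) : tt ∈ O k := T_mem_O h
lemma ti_O {k : ℤ} (h : k ≤ -1) : ti ∈ O k := T_mem_O h
lemma tt2_O {k : ℤ} (h : k ≤ 2) : tt ^ 2 ∈ O k := by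
  rw [pow_two]; exact O_mono h (O_mul (tt_O le_rfl) (tt_O le_rfl))
lemma ti2_O {k : ℤ} (h : k ≤ -2) : ti ^ 2 ∈ O k := by
  rw [pow_two]; exact O_mono h (O_mul (ti_O le_rfl) (ti_O le_rfl))
lemma AdjB {g : M3} (h1 : ∀ i j, g.val i j ∈ O 1) (h2 : ∀ i j, g⁻¹.val i j ∈ O (-2)) : Adj (Bk 0) (act g (Bk 0)) := by
  have a1 : Bk 2 ≤ act g (Bk 0) := fun w hw => mem_act.2 (by simpa using mulVec_O h2 hw)
  have a2 : act g (Bk 0) ≤ Bk 1 := by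
    intro w hw
    have := mulVec_O h1 (mem_act.1 hw)
    rw [val_inv_mv] at this
    simpa using this
  refine ⟨-1, ?_, ?_⟩
  · have := sc_mono (-1) a1
    rw [sc_Bk] at this ⊢
    simpa using this
  · have := sc_mono (-1) a2
    rw [sc_Bk] at this
    simpa using this
lemma Adj_gX : Adj (Bk 0) (act gX (Bk 0)) := by
  refine AdjB ?_ ?_
  · intro i j
    rw [gX_val]
    fin_cases i <;> fin_cases j <;> first | exact tt_O le_rfl | exact zero_mem _
  · intro i j
    rw [gXinv_val]
    fin_cases i <;> fin_cases j <;> first | exact ti_O (by norm_num) | exact zero_mem _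
lemma Adj_gY : Adj (Bk 0) (act gY (Bk 0)) := by
  refine AdjB ?_ ?_
  · intro i j
    rw [gY_val]
    fin_cases i <;> fin_cases j <;> first | exact tt_O le_rfl | exact zero_mem _ | exact tt2_O (by norm_num) | exact add_mem (tt_O le_rfl) (tt2_O (by norm_num))
  · intro i j
    rw [gYinv_val]
    fin_cases i <;> fin_cases j <;> first | exact ti_O (by norm_num) | exact zero_mem _ | exact ti2_O (by norm_num) | exact add_mem (ti2_O le_rfl) (ti_O (by norm_num))
lemma InH_B : InH (Bk 0) := by
  refine ⟨0, ?_, fun u hu => hu 2⟩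
  rw [T_zero, one_smul, e0, mem_Bk3]
  exact ⟨one_mem_O le_rfl, zero_mem _, zero_mem _⟩
lemma Hor_B (g : G) : Hor π g (act (π g) (Bk 0)) := by
  unfold Hor; rw [act_inv_act]; exact InH_B
lemma GoodAll (h : Rp x y π) (g : G) : Good x y π g (act (π g) (Bk 0)) := by
  have stp : ∀ g s, Adj (Bk 0) (act (π s) (Bk 0)) → Dc x y s → Good x y π g (act (π g) (Bk 0)) → Good x y π (g * s) (act (π (g * s)) (Bk 0)) := by
    intro g s hA hs hG
    refine GoodMove h hG (IsLat_act (IsLat_Bk 0) _) (Hor_B _) ?_ ?_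
    · rw [map_mul, act_mul]; exact Adj_act _ hA
    · rwa [inv_mul_cancel_left]
  have aX : Adj (Bk 0) (act (π x) (Bk 0)) := by rw [h.hx]; exact Adj_gX
  have aY : Adj (Bk 0) (act (π y) (Bk 0)) := by rw [h.hy]; exact Adj_gY
  have ainv : ∀ s, Adj (Bk 0) (act (π s) (Bk 0)) → Adj (Bk 0) (act (π s⁻¹) (Bk 0)) := by
    intro s hs
    have := Adj_act (π s)⁻¹ hs
    rw [act_inv_act] at this
    rw [map_inv]; exact Adj_symm this
  have dX : Dc x y x := Or.inl (x_mem_PP x y)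
  have hm : g ∈ Subgroup.closure {x, y} := by rw [h.gen]; trivial
  induction hm using Subgroup.closure_induction_right with
  | one =>
    rw [map_one, act_one]
    exact Good.base _ _ (IsLat_Bk 0) (Hor_one.2 InH_B) (one_mem _) (ht_Bk 0)
  | mul_right g hg s hs ih =>
    rcases hs with rfl | rfl
    · exact stp g _ aX dX ih
    · exact stp g _ aY Dc_y ih
  | mul_inv_cancel g hg s hs ih =>
    rcases hs with rfl | rfl
    · exact stp g _ (ainv _ aX) (Dc_inv dX) ih
    · exact stp g _ (ainv _ aY) (Dc_inv Dc_y) ih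
theorem Rp_inj (h : Rp x y π) {g : G} (hg : π g = 1) : g = 1 := by
  have hG := GoodAll h g
  rw [hg, act_one] at hG
  generalize hB : Bk 0 = B at hG
  have h0 : ht B = 0 := by rw [← hB]; exact ht_Bk 0
  cases hG with
  | base _ _ _ _ hgP _ => exact PP_inj h hgP hg
  | step _ _ _ _ _ _ _ _ _ hlt => omega
end rep
end

/-! Part 13 -/

noncomputable section

lemma map_xseq {G H : Type*} [Group G] [Group H] (f : G →* H) (x y : G) (n : ℕ) :
    f (xseq x y n) = xseq (f x) (f y) n := by
  induction n with
  | zero => rfl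
  | succ n ih => simp only [xseq, map_br, map_mul, ih]
lemma xseq_conj {G : Type*} [Group G] {x y t : G} (h3 : br (y*x*y) (xseq x y 1) * t * (xseq x y 1)⁻¹ * t⁻¹ = 1)
    (h4 : t * (y*x*y) = (y*x*y) * t) (n : ℕ) : xseq x y (n+2) = t * xseq x y (n+1) * t⁻¹ := by
  have hz : t⁻¹ * (y*x*y) * t = y*x*y := by rw [mul_assoc, ← h4]; group
  induction n with
  | zero =>
    have : xseq x y (0+2) = br (y*x*y) (xseq x y 1) := rfl
    rw [this]
    have := mul_inv_eq_one.1 h3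
    have := mul_inv_eq_iff_eq_mul.1 this
    rw [← this]; group
  | succ n ih =>
    have e1 : xseq x y (n+1+2) = br (y*x*y) (xseq x y (n+2)) := rfl
    have e2 : xseq x y (n+1+1) = br (y*x*y) (xseq x y (n+1)) := rfl
    rw [e2, e1, ih]
    generalize xseq x y (n+1) = e
    have : br (y*x*y) (t * e * t⁻¹) = t * br (t⁻¹ * (y*x*y) * t) e * t⁻¹ := by
      unfold br; generalize y*x*y = z; group
    rw [this, hz]
lemma hyp_of {G : Type*} [Group G] {x y t : G} (h1 : xseq x y 1 ^ 4 = 1) (h2 : br (xseq x y 1 ^ 2) (y*x*y) = 1)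
    (h3 : br (y*x*y) (xseq x y 1) * t * (xseq x y 1)⁻¹ * t⁻¹ = 1) (h4 : t * (y*x*y) = (y*x*y) * t)
    (h5 : br (x^2) (y*x*y) = 1) : (∀ n, 1 ≤ n → xseq x y n ^ 4 = 1) ∧ ∀ n, Commute (xseq x y n ^ 2) (y*x*y) := by
  have key := xseq_conj h3 h4
  have a : ∀ n, xseq x y (n+1) ^ 4 = 1 := by
    intro n
    induction n with
    | zero => exact h1
    | succ n ih => rw [key, conj_pow, ih]; group
  have b : ∀ n, Commute (xseq x y (n+1) ^ 2) (y*x*y) := by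
    intro n
    induction n with
    | zero => exact br_eq_one_iff.1 h2
    | succ n ih =>
      rw [key, conj_pow]
      have ht : Commute t (y*x*y) := h4
      exact ((ht.mul_left ih).mul_left ht.inv_left)
  constructor
  · intro n hn
    obtain ⟨m, rfl⟩ := Nat.exists_eq_add_of_le' hn
    exact a m
  · rintro (_ | n)
    · exact br_eq_one_iff.1 h5
    · exact b n
lemma B4_x4 : bx ^ 4 = by' ^ 3 := by
  have : ((QuotientGroup.mk ((FreeGroup.of 0) ^ 4 * ((FreeGroup.of 1) ^ 3)⁻¹) : B4)) = 1 :=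
    PresentedGroup.one_of_mem (rels := b4Rels) (by simp [b4Rels])
  exact mul_inv_eq_one.1 this
lemma B4_c : br (bx ^ 2) (by' * bx * by') = 1 := by
  have : ((QuotientGroup.mk (br ((FreeGroup.of 0) ^ 2) (FreeGroup.of 1 * FreeGroup.of 0 * FreeGroup.of 1)) : B4)) = 1 :=
    PresentedGroup.one_of_mem (rels := b4Rels) (by simp [b4Rels])
  exact this
lemma B4_gen : Subgroup.closure {bx, by'} = ⊤ := by
  rw [← PresentedGroup.closure_range_of b4Rels]
  congr 1
  ext g
  constructor
  · rintro (rfl | rfl)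
    · exact ⟨0, rfl⟩
    · exact ⟨1, rfl⟩
  · rintro ⟨i, rfl⟩
    fin_cases i
    · exact Or.inl rfl
    · exact Or.inr rfl
lemma t_comm : tGt * εB (by' * bx * by') = εB (by' * bx * by') * tGt := by
  have := HNNExtension.t_mul_of (G := B4) (A := Subgroup.closure {by' * bx * by', bx ^ 4})
    (B := Subgroup.closure {by' * bx * by', bx ^ 4}) (φ := MulEquiv.refl _)
    ⟨by' * bx * by', Subgroup.subset_closure (by simp)⟩
  exact this
theorem hardN (π0 : B4 →* M3) (hx : π0 bx = gX) (hy : π0 by' = gY) (b : B4) (hb : π0 b = 1)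
    (N : Subgroup GrpGt) [N.Normal] (hsub : ∀ w ∈ ({εB x1 ^ 4, br (εB x1 ^ 2) (εB (by' * bx * by')),
          br (εB (by' * bx * by')) (εB x1) * tGt * (εB x1)⁻¹ * tGt⁻¹} : Set GrpGt), w ∈ N)
    (hez : ∀ b, εB b ∈ N → π0 b = 1) : εB b ∈ N := by
  let f : B4 →* GrpGt ⧸ N := (QuotientGroup.mk' N).comp εB
  have hf : ∀ b, f b = 1 ↔ εB b ∈ N := fun b => QuotientGroup.eq_one_iff _
  have hker : ∀ b ∈ f.ker, π0 b = 1 := fun b hb => hez b ((hf b).1 hb)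
  let π : B4 ⧸ f.ker →* M3 := QuotientGroup.lift f.ker π0 hker
  have rel : ∀ w ∈ ({εB x1 ^ 4, br (εB x1 ^ 2) (εB (by' * bx * by')),
          br (εB (by' * bx * by')) (εB x1) * tGt * (εB x1)⁻¹ * tGt⁻¹} : Set GrpGt), QuotientGroup.mk' N w = 1 := by
    intro w hw
    exact (QuotientGroup.eq_one_iff _).2 (hsub w hw)
  have hz : f by' * f bx * f by' = f (by' * bx * by') := by rw [map_mul, map_mul]
  have hx1 : xseq (f bx) (f by') 1 = f x1 := (map_xseq f bx by' 1).symm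
  have H := hyp_of (x := f bx) (y := f by') (t := QuotientGroup.mk' N tGt)
    (by 
      have := rel _ (Or.inl rfl)
      rw [map_pow] at this
      rw [hx1]; exact this)
    (by
      have := rel _ (Or.inr (Or.inl rfl))
      rw [map_br, map_pow] at this
      rw [hx1, hz]; exact this)
    (by
      have := rel _ (Or.inr (Or.inr rfl))
      rw [map_mul, map_mul, map_mul, map_br, map_inv, map_inv] at this
      rw [hx1, hz]; exact this)
    (by
      have := congrArg (QuotientGroup.mk' N) t_comm
      rw [map_mul (QuotientGroup.mk' N) tGt, map_mul (QuotientGroup.mk' N) _ tGt] at this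
      rw [hz]; exact this)
    (by
      have := congrArg f B4_c
      rw [map_br, map_pow, map_one] at this
      rw [hz]; exact this)
  let φ := QuotientGroup.kerLift f
  have φi : Function.Injective φ := QuotientGroup.kerLift_injective f
  let q := QuotientGroup.mk' f.ker
  have hφx : φ (q bx) = f bx := rfl
  have hφy : φ (q by') = f by' := rfl
  have hR : Rp (q bx) (q by') π := 
    { gen := by
        have := congrArg (Subgroup.map q) B4_gen
        rw [MonoidHom.map_closure, Set.image_pair] at this
        rw [this, ← MonoidHom.range_eq_map]
        exact MonoidHom.range_eq_top.2 (QuotientGroup.mk'_surjective _)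
      x4 := by rw [← map_pow, ← map_pow]; exact congrArg q B4_x4
      e4 := by
        intro n hn
        apply φi
        rw [map_pow, map_xseq, map_one]; exact H.1 n hn
      ez := by
        intro n
        have : φ (xseq (q bx) (q by') n ^ 2 * (q by' * q bx * q by')) = φ ((q by' * q bx * q by') * xseq (q bx) (q by') n ^ 2) := by
          simp only [map_mul, map_pow, map_xseq]; exact H.2 n
        exact φi this
      hx := hx
      hy := hy }
  have h1 : q b = 1 := Rp_inj hR (show π (q b) = 1 from hb)
  have h2 : b ∈ f.ker := (QuotientGroup.eq_one_iff _).1 h1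
  exact (hf b).1 h2
theorem hardDir (π0 : B4 →* M3) (hx : π0 bx = gX) (hy : π0 by' = gY) (b : B4) (hb : π0 b = 1) :
    εB b ∈ Subgroup.normalClosure
        {εB x1 ^ 4, br (εB x1 ^ 2) (εB (by' * bx * by')),
          br (εB (by' * bx * by')) (εB x1) * tGt * (εB x1)⁻¹ * tGt⁻¹} :=
  hardN π0 hx hy b hb _ (fun w hw => Subgroup.subset_normalClosure hw) (easyDir π0 hx hy)
theorem final (β : B4 →* GL (Fin 3) R2) (hβx : β bx = X) (hβy : β by' = Y) (b : B4) :
    β b = 1 ↔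
      εB b ∈ Subgroup.normalClosure
        {εB x1 ^ 4, br (εB x1 ^ 2) (εB (by' * bx * by')),
          br (εB (by' * bx * by')) (εB x1) * tGt * (εB x1)⁻¹ * tGt⁻¹} := by
  let π0 : B4 →* M3 := (MulAut.conj gB⁻¹).toMonoidHom.comp β
  have h0 : ∀ b, π0 b = gB⁻¹ * β b * gB := by
    intro b
    show gB⁻¹ * β b * gB⁻¹⁻¹ = _
    rw [inv_inv]
  have hx : π0 bx = gX := by rw [h0, hβx, gB_X]
  have hy : π0 by' = gY := by rw [h0, hβy, gB_Y]
  have e : β b = 1 ↔ π0 b = 1 := by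
    rw [h0]
    constructor
    · intro h; rw [h, mul_one, inv_mul_cancel]
    · intro h
      have : β b = gB * (gB⁻¹ * β b * gB) * gB⁻¹ := by group
      rw [this, h, mul_one, mul_inv_cancel]
  rw [e]
  exact ⟨hardDir π0 hx hy b, easyDir π0 hx hy b⟩
end

/-- **Theorem 1.3.** `ker(β₄ ⊗ 𝔽₂) = B₄ ∩ ⟪x₁⁴, [x₁², yxy], [yxy,x₁]·t·x₁⁻¹·t⁻¹⟫_{G̃}`:
for every `b ∈ B₄`, `β(b) = 1` iff `ε̃(b)` lies in the normal closure in `G̃` of the three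
listed elements. -/
theorem statement2 (β : B4 →* GL (Fin 3) R2) (hβx : β bx = X) (hβy : β by' = Y) (b : B4) :
    β b = 1 ↔
      εB b ∈ Subgroup.normalClosure
        {εB x1 ^ 4, br (εB x1 ^ 2) (εB (by' * bx * by')),
          br (εB (by' * bx * by')) (εB x1) * tGt * (εB x1)⁻¹ * tGt⁻¹} := by
  exact final β hβx hβy b
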